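/- Let n ≥ 3 and let p be a prime with p ≡ 9 (mod 16). Then the 2-class group of L_{n,p} = Q(ζ_{2^n}, √p) has rank exactly 2. -/

import Mathlib

open NumberField IntermediateField

/-- The 2-rank of the class group: dim_{F₂} Cl(K)/Cl(K)². -/
noncomputable def rank2 (K : Type*) [Field K] [NumberField K] : ℕ :=
  Nat.log 2 (Nat.card
    (ClassGroup (𝓞 K) ⧸ Subgroup.closure {x : ClassGroup (𝓞 K) | ∃ y, x = y ^ 2}))

open scoped nonZeroDivisors Pointwise

section GroupIndices

variable {A B : Type*} [CommGroup A] [CommGroup B]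

/-- The subgroup of squares of a commutative group. -/
abbrev squares (A : Type*) [CommGroup A] : Subgroup A := (powMonoidHom 2 : A →* A).range

theorem sq_mem_squares (a : A) : a ^ 2 ∈ squares A := ⟨a, rfl⟩

theorem map_sq_le_squares (H : Subgroup A) : H.map (powMonoidHom 2) ≤ squares A := by
  rintro _ ⟨a, -, rfl⟩
  exact sq_mem_squares a

open Subgroup in
/-- The index of the squares in a generalized Selmer group `D.comap f`. -/
theorem relIndex_squares_comap (f : A →* B)
    (hB : Function.Injective (powMonoidHom 2 : B →* B)) (D : Subgroup B) (hD : squares B ≤ D)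
    (hf : f.range.index ≠ 0) :
    (squares A).relIndex (D.comap f) =
      (squares A).relIndex f.ker * (squares B).relIndex D * (D ⊔ f.range).index := by
  have hker : f.ker ≤ D.comap f := by
    rw [← MonoidHom.comap_bot]
    exact Subgroup.comap_mono bot_le
  have hsq : squares A ≤ D.comap f := by
    rintro _ ⟨a, rfl⟩
    exact hD ⟨f a, by simp⟩
  have hfA : (squares A).map f = f.range.map (powMonoidHom 2) := by
    rw [MonoidHom.map_range, MonoidHom.map_range]
    congr 1
    ext a
    simp
  set P := f.range with hP
  set P2 := P.map (powMonoidHom 2) with hP2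
  have hP2P : P2 ≤ P := by
    rintro _ ⟨a, ha, rfl⟩
    exact pow_mem ha 2
  have hP2D : P2 ≤ D := (map_sq_le_squares P).trans hD
  have h1 : (squares A).relIndex (f.ker ⊔ squares A) = (squares A).relIndex f.ker := by
    rw [relIndex_sup_right]
  have h2 : (f.ker ⊔ squares A).relIndex (D.comap f) = P2.relIndex (P ⊓ D) := by
    rw [sup_comm, ← comap_map_eq, hfA, relIndex_comap, Subgroup.map_comap_eq]
  have h3 : P2.relIndex (P ⊓ D) * P.relIndex D = P2.relIndex D := by
    rw [← inf_relIndex_right P D, relIndex_mul_relIndex _ _ _ (le_inf hP2P hP2D) inf_le_right]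
  have h4 : P2.relIndex (squares B) * (squares B).relIndex D = P2.relIndex D :=
    relIndex_mul_relIndex _ _ _ (map_sq_le_squares P) hD
  have h5 : P2.relIndex (squares B) = P.index := by
    rw [squares, MonoidHom.range_eq_map, hP2, relIndex_map_map_of_injective _ _ hB,
      relIndex_top_right]
  have h6 : P.relIndex D * (D ⊔ P).index = P.index := by
    rw [← relIndex_sup_right D P, relIndex_mul_index le_sup_right]
  rw [← relIndex_mul_relIndex _ _ _ (le_sup_right : squares A ≤ f.ker ⊔ squares A)
    (sup_le hker hsq), h1, h2, mul_assoc]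
  congr 1
  have h7 : P.relIndex D ≠ 0 := fun h => hf (by rw [← h6, h, zero_mul])
  apply Nat.eq_of_mul_eq_mul_right (Nat.pos_of_ne_zero h7)
  rw [h3, ← h4, h5, ← h6]
  ring

/-- Adjoining `t` elements to a subgroup containing the squares multiplies its order by at most
`2 ^ t`. -/
theorem relIndex_closure_le (D : Subgroup A) (hD : squares A ≤ D) (s : Finset A) :
    D.relIndex (Subgroup.closure (s : Set A)) ≠ 0 ∧
      D.relIndex (Subgroup.closure (s : Set A)) ≤ 2 ^ s.card := by
  classical
  induction s using Finset.induction_on with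
  | empty => simp
  | insert a s ha ih =>
    rw [Finset.coe_insert, Set.insert_eq, Subgroup.closure_union, Finset.card_insert_of_notMem ha,
      ← Subgroup.zpowers_eq_closure]
    set C := Subgroup.closure (s : Set A)
    have h1 : D.relIndex (Subgroup.zpowers a ⊔ C) = D.relIndex (D ⊔ C ⊔ Subgroup.zpowers a) := by
      rw [← Subgroup.relIndex_sup_right (Subgroup.zpowers a ⊔ C) D]
      congr 1
      ac_rfl
    have h2 : D.relIndex (D ⊔ C) * (D ⊔ C).relIndex (D ⊔ C ⊔ Subgroup.zpowers a) =
        D.relIndex (D ⊔ C ⊔ Subgroup.zpowers a) :=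
      Subgroup.relIndex_mul_relIndex _ _ _ le_sup_left le_sup_left
    have h3 : (D ⊔ C).relIndex (D ⊔ C ⊔ Subgroup.zpowers a) ∣ 2 := by
      rw [Subgroup.relIndex_sup_left, Subgroup.relIndex_dvd_two_iff]
      refine ⟨a, Subgroup.mem_zpowers a, fun b hb => ?_⟩
      obtain ⟨k, rfl⟩ := Subgroup.mem_zpowers_iff.mp hb
      obtain ⟨m, rfl | rfl⟩ := Int.even_or_odd' k
      · right
        exact Subgroup.mem_sup_left (hD ⟨a ^ m, by
          simp only [powMonoidHom_apply, ← zpow_natCast, ← zpow_mul]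
          congr 1
          push_cast
          ring⟩)
      · left
        exact Subgroup.mem_sup_left (hD ⟨a ^ (m + 1), by
          simp only [powMonoidHom_apply, ← zpow_natCast, ← zpow_mul, ← zpow_add_one]
          congr 1
          push_cast
          ring⟩)
    have h4 : D.relIndex (D ⊔ C) = D.relIndex C := by
      rw [sup_comm, Subgroup.relIndex_sup_right]
    rw [h1, ← h2, h4, pow_succ]
    have h5 := Nat.le_of_dvd two_pos h3
    refine ⟨mul_ne_zero ih.1 (fun h => by simp [h] at h3), Nat.mul_le_mul ih.2 h5⟩

open Subgroup in
/-- The abstract form of the genus theory bound: `σ` is an involution of `A` with fixed points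
containing `K`, satisfying a weak form of Hilbert 90, and `HF`, `HK` are Selmer groups upstairs and
downstairs. -/
theorem relIndex_squares_mul_two_le (σ : A →* A) (K HF HK J V : Subgroup A)
    (h90 : ∀ x, ∀ a ∈ K, x * σ x = a ^ 2 → x ∈ K ⊔ squares A)
    (hHF : squares A ≤ HF) (hHK : K.map (powMonoidHom 2) ≤ HK)
    (hJ : ∀ x ∈ HF, x * σ x ∈ J)
    (hJ0 : (K.map (powMonoidHom 2)).relIndex J ≠ 0)
    (hV : V = K ⊓ HF) (hVK : HK ≤ V) (hV0 : HK.relIndex V ≠ 0)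
    (hK0 : (K.map (powMonoidHom 2)).relIndex HK ≠ 0)
    (d : A) (hdK : d ∈ K) (hd : d ∈ squares A) (hdK2 : d ∉ K.map (powMonoidHom 2)) :
    (squares A).relIndex HF * 2 ≤ (K.map (powMonoidHom 2)).relIndex J *
      ((K.map (powMonoidHom 2)).relIndex HK * HK.relIndex V) := by
  set K2 := K.map (powMonoidHom 2) with hK2
  have hW : squares A ≤ HF ⊓ (K ⊔ squares A) := le_inf hHF le_sup_right
  rw [← relIndex_mul_relIndex _ _ _ hW inf_le_left, mul_comm (_ * _) 2, ← mul_assoc, mul_comm]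
  apply Nat.mul_le_mul
  · let N : A →* A := MonoidHom.id A * σ
    have h1 : (K2.comap N).relIndex HF ≤ K2.relIndex J := by
      rw [relIndex_comap]
      refine relIndex_le_of_le_right ?_ hJ0
      rintro _ ⟨x, hx, rfl⟩
      exact hJ x hx
    have h2 : (K2.comap N).relIndex HF ≠ 0 := by
      rw [relIndex_comap]
      intro h
      refine hJ0 (relIndex_eq_zero_of_le_right ?_ h)
      rintro _ ⟨x, hx, rfl⟩
      exact hJ x hx
    refine le_trans ?_ h1
    rw [← inf_relIndex_right (K2.comap N)] at h2 ⊢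
    refine relIndex_le_of_le_left ?_ h2
    rintro x ⟨⟨a, ha, hax⟩, hx⟩
    exact ⟨hx, h90 x a ha hax.symm⟩
  · have h1 : HF ⊓ (K ⊔ squares A) = V ⊔ squares A := by
      rw [hV, inf_comm K, inf_sup_assoc_of_le _ hHF]
    rw [h1, relIndex_sup_right]
    have hVK2 : K2 ≤ V := hHK.trans hVK
    rw [relIndex_mul_relIndex _ _ _ hHK hVK]
    have h2 : K2.relIndex (squares A ⊓ V) * (squares A).relIndex V = K2.relIndex V := by
      rw [← inf_relIndex_right (squares A) V]
      exact relIndex_mul_relIndex _ _ _ (le_inf (map_sq_le_squares K) hVK2) inf_le_right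
    have h3 : K2.relIndex V ≠ 0 := by
      rw [← relIndex_mul_relIndex _ _ _ hHK hVK]
      exact mul_ne_zero hK0 hV0
    rw [← h2]
    apply Nat.mul_le_mul_right
    have h4 : K2.relIndex (squares A ⊓ V) ≠ 0 := fun h => h3 (by rw [← h2, h, zero_mul])
    have h5 : K2.relIndex (squares A ⊓ V) ≠ 1 := by
      rw [Ne, relIndex_eq_one]
      intro h
      exact hdK2 (h ⟨hd, by rw [hV]; exact ⟨hdK, hHF hd⟩⟩)
    omega

end GroupIndices

section UnitSquares

variable (K : Type*) [Field K] [NumberField K]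

omit [NumberField K] in
theorem mem_torsion_of_sq_mem {u : (𝓞 K)ˣ} (hu : u ^ 2 ∈ Units.torsion K) :
    u ∈ Units.torsion K := by
  rw [Units.torsion, CommGroup.mem_torsion] at hu ⊢
  exact (isOfFinOrder_pow.mp hu).resolve_right two_ne_zero

theorem relIndex_squares_torsion : (squares (𝓞 K)ˣ).relIndex (Units.torsion K) = 2 := by
  obtain ⟨⟨a, ha⟩, hgen⟩ := IsCyclic.exists_generator (α := Units.torsion K)
  have hgen' : ∀ b ∈ Units.torsion K, ∃ k : ℤ, a ^ k = b := fun b hb => by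
    obtain ⟨k, hk⟩ := Subgroup.mem_zpowers_iff.mp (hgen ⟨b, hb⟩)
    exact ⟨k, congrArg Subtype.val hk⟩
  have hord : Even (orderOf a) := by
    have h := orderOf_eq_card_of_forall_mem_zpowers hgen
    rw [← Subgroup.orderOf_mk a ha, h]
    exact Units.even_torsionOrder K
  have heven : ∀ m : ℤ, a ^ (2 * m) ∈ squares (𝓞 K)ˣ := fun m => ⟨a ^ m, by
    simp only [powMonoidHom_apply, ← zpow_natCast, ← zpow_mul]
    congr 1
    push_cast
    ring⟩
  have hodd : ∀ m : ℤ, a ^ (2 * m + 1) ∉ squares (𝓞 K)ˣ := by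
    rintro m ⟨v, hv⟩
    have hvt : v ∈ Units.torsion K :=
      mem_torsion_of_sq_mem K (by
        rw [← powMonoidHom_apply, hv]
        exact zpow_mem ha _)
    obtain ⟨j, rfl⟩ := hgen' v hvt
    have h1 : a ^ (2 * j - (2 * m + 1)) = 1 := by
      rw [zpow_sub, ← hv, mul_inv_eq_one, powMonoidHom_apply, ← zpow_natCast, ← zpow_mul]
      congr 1
      push_cast
      ring
    have h2 := orderOf_dvd_iff_zpow_eq_one.mpr h1
    have h3 : (2 : ℤ) ∣ orderOf a := by exact_mod_cast hord.two_dvd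
    have := h3.trans h2
    omega
  rw [Subgroup.relIndex_eq_two_iff]
  refine ⟨a, ha, fun b hb => ?_⟩
  obtain ⟨k, rfl⟩ := hgen' b hb
  obtain ⟨m, rfl | rfl⟩ := Int.even_or_odd' k
  · exact Or.inr ⟨heven m, by rw [← zpow_add_one]; exact hodd m⟩
  · refine Or.inl ⟨?_, hodd m⟩
    rw [← zpow_add_one, show 2 * m + 1 + 1 = 2 * (m + 1) by ring]
    exact heven _

/-- The squares have index `2 ^ r` in a free abelian group of rank `r`. -/
theorem index_squares_of_basis {B : Type*} [CommGroup B] {r : ℕ}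
    (b : Module.Basis (Fin r) ℤ (Additive B)) : (squares B).index = 2 ^ r := by
  let g : B →* Multiplicative (Fin r → ZMod 2) :=
    { toFun := fun x => Multiplicative.ofAdd fun i =>
        ((b.equivFun (Additive.ofMul x) i : ℤ) : ZMod 2)
      map_one' := by
        rw [ofMul_one, map_zero]
        simp only [Pi.zero_apply, Int.cast_zero]
        rfl
      map_mul' := fun x y => by
        rw [ofMul_mul, map_add]
        simp only [Pi.add_apply, Int.cast_add]
        rfl }
  have hg : ∀ x i, (g x).toAdd i = ((b.equivFun (Additive.ofMul x) i : ℤ) : ZMod 2) :=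
    fun _ _ => rfl
  have hker : g.ker = squares B := by
    ext x
    rw [MonoidHom.mem_ker]
    constructor
    · intro hx
      have h1 : ∀ i, ∃ c : ℤ, b.equivFun (Additive.ofMul x) i = 2 * c := fun i => by
        have h2 : ((b.equivFun (Additive.ofMul x) i : ℤ) : ZMod 2) = 0 := by
          rw [← hg, hx]; rfl
        exact (ZMod.intCast_zmod_eq_zero_iff_dvd _ 2).mp h2
      choose c hc using h1
      refine ⟨(b.equivFun.symm c).toMul, ?_⟩
      apply Additive.ofMul.injective
      apply b.equivFun.injective
      ext i
      rw [hc, powMonoidHom_apply, ofMul_pow, map_nsmul, ofMul_toMul, LinearEquiv.apply_symm_apply]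
      simp
    · rintro ⟨y, rfl⟩
      apply Multiplicative.toAdd.injective
      ext i
      rw [hg, powMonoidHom_apply, ofMul_pow, map_nsmul]
      simp only [Pi.smul_apply, nsmul_eq_mul, Int.cast_mul]
      simp
      exact Or.inl rfl
  have hsurj : Function.Surjective g := by
    intro y
    refine ⟨(b.equivFun.symm fun i => ((y.toAdd i).val : ℤ)).toMul, ?_⟩
    apply Multiplicative.toAdd.injective
    ext i
    rw [hg, ofMul_toMul, LinearEquiv.apply_symm_apply]
    simp
  rw [← hker, Subgroup.index_ker, MonoidHom.range_eq_top.mpr hsurj]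
  simp [Nat.card_eq_fintype_card]

theorem index_squares_units :
    (squares (𝓞 K)ˣ).index = 2 ^ (Units.rank K + 1) := by
  let f := QuotientGroup.mk' (Units.torsion K)
  have hf : Function.Surjective f := QuotientGroup.mk'_surjective _
  have hfr : f.range = ⊤ := MonoidHom.range_eq_top.mpr hf
  have hB : Function.Injective (@powMonoidHom ((𝓞 K)ˣ ⧸ Units.torsion K) _ 2) := by
    rw [injective_iff_map_eq_one]
    intro x hx
    obtain ⟨u, rfl⟩ := hf x
    rw [powMonoidHom_apply, ← map_pow] at hx
    exact (QuotientGroup.eq_one_iff u).mpr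
      (mem_torsion_of_sq_mem K ((QuotientGroup.eq_one_iff _).mp hx))
  have h := relIndex_squares_comap f hB ⊤ le_top (by simp [hfr])
  rw [Subgroup.comap_top, Subgroup.relIndex_top_right, Subgroup.relIndex_top_right, top_sup_eq,
    Subgroup.index_top, mul_one, QuotientGroup.ker_mk', relIndex_squares_torsion,
    index_squares_of_basis (Units.basisModTorsion K)] at h
  rw [h, pow_succ, mul_comm]

theorem rank_add_one [IsTotallyComplex K] :
    2 * (Units.rank K + 1) = Module.finrank ℚ K := by
  rw [Units.rank, Nat.sub_add_cancel Fintype.card_pos,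
    InfinitePlace.card_eq_nrRealPlaces_add_nrComplexPlaces, IsTotallyComplex.nrRealPlaces_eq_zero,
    zero_add, ← IsTotallyComplex.finrank]

end UnitSquares

section IdealGroups

variable (K : Type*) [Field K] [NumberField K]

/-- The group of nonzero fractional ideals of a number field. -/
abbrev IdealGroup := (FractionalIdeal (𝓞 K)⁰ K)ˣ

variable {K}

theorem exists_mul_mk0_eq_mk0 (A : IdealGroup K) :
    ∃ a b : (Ideal (𝓞 K))⁰, A * FractionalIdeal.mk0 K a = FractionalIdeal.mk0 K b := by
  obtain ⟨a, J, ha, hJ⟩ :=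
    FractionalIdeal.exists_eq_spanSingleton_mul (A : FractionalIdeal (𝓞 K)⁰ K)
  have ha' : algebraMap (𝓞 K) K a ≠ 0 := by simpa using ha
  have hsa : Ideal.span {a} ∈ (Ideal (𝓞 K))⁰ := by
    rw [mem_nonZeroDivisors_iff_ne_zero]
    simpa using ha
  have h : (A : FractionalIdeal (𝓞 K)⁰ K) * (Ideal.span {a} : Ideal (𝓞 K)) = (J : Ideal (𝓞 K)) := by
    rw [hJ, FractionalIdeal.coeIdeal_span_singleton, mul_right_comm,
      FractionalIdeal.spanSingleton_mul_spanSingleton, inv_mul_cancel₀ ha',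
      FractionalIdeal.spanSingleton_one, one_mul]
  have hJ0 : J ∈ (Ideal (𝓞 K))⁰ := by
    rw [mem_nonZeroDivisors_iff_ne_zero]
    rintro rfl
    have h0 : (A : FractionalIdeal (𝓞 K)⁰ K) = 0 := by rw [hJ]; simp
    exact A.ne_zero h0
  exact ⟨⟨_, hsa⟩, ⟨J, hJ0⟩, Units.ext h⟩

theorem mk0_injective : Function.Injective (FractionalIdeal.mk0 K : (Ideal (𝓞 K))⁰ → _) :=
  fun _ _ h => Subtype.ext (FractionalIdeal.coeIdeal_injective (K := K) (congrArg Units.val h))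

theorem idealGroup_sq_injective :
    Function.Injective (powMonoidHom 2 : IdealGroup K →* IdealGroup K) := by
  rw [injective_iff_map_eq_one]
  intro A hA
  obtain ⟨a, b, hab⟩ := exists_mul_mk0_eq_mk0 A
  have h : a ^ 2 = b ^ 2 := by
    apply mk0_injective
    rw [map_pow, map_pow, ← hab, mul_pow]
    simp only [powMonoidHom_apply] at hA
    rw [hA, one_mul]
  have h' : a = b := Subtype.ext ((pow_left_inj two_ne_zero).mp (congrArg Subtype.val h))
  rw [h'] at hab
  simpa using hab

theorem toPrincipalIdeal_range_index_ne_zero : (toPrincipalIdeal (𝓞 K) K).range.index ≠ 0 := by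
  rw [Subgroup.index, ← Nat.card_congr (ClassGroup.equiv K).toEquiv]
  exact Nat.card_pos.ne'

theorem toPrincipalIdeal_ker :
    (toPrincipalIdeal (𝓞 K) K).ker = (Units.map (algebraMap (𝓞 K) K : 𝓞 K →* K)).range := by
  ext x
  rw [MonoidHom.mem_ker, MonoidHom.mem_range, Units.ext_iff, coe_toPrincipalIdeal, Units.val_one]
  constructor
  · intro h
    obtain ⟨u, hu⟩ := (FractionalIdeal.mem_one_iff _).mp
      (h ▸ FractionalIdeal.mem_spanSingleton_self _ (x : K))
    have h' : FractionalIdeal.spanSingleton (𝓞 K)⁰ ((x⁻¹ : Kˣ) : K) = 1 := by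
      rw [Units.val_inv_eq_inv_val, ← FractionalIdeal.spanSingleton_inv, h, inv_one]
    obtain ⟨v, hv⟩ := (FractionalIdeal.mem_one_iff _).mp
      (h' ▸ FractionalIdeal.mem_spanSingleton_self _ ((x⁻¹ : Kˣ) : K))
    have huv : u * v = 1 := by
      apply FaithfulSMul.algebraMap_injective (𝓞 K) K
      rw [map_mul, hu, hv, map_one, Units.mul_inv]
    exact ⟨Units.mkOfMulEqOne u v huv, Units.ext hu⟩
  · rintro ⟨u, rfl⟩
    have : FractionalIdeal.spanSingleton (𝓞 K)⁰ (algebraMap (𝓞 K) K u) =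
        ((Ideal.span {(u : 𝓞 K)} : Ideal (𝓞 K)) : FractionalIdeal (𝓞 K)⁰ K) :=
      (FractionalIdeal.coeIdeal_span_singleton _).symm
    simp [this, Ideal.span_singleton_eq_top.mpr u.isUnit]

theorem relIndex_squares_toPrincipalIdeal_ker :
    (squares Kˣ).relIndex (toPrincipalIdeal (𝓞 K) K).ker = (squares (𝓞 K)ˣ).index := by
  rw [toPrincipalIdeal_ker, ← Subgroup.relIndex_top_right, MonoidHom.range_eq_map,
    ← Subgroup.relIndex_comap]
  congr 1
  ext u
  constructor
  · rintro ⟨y, hy⟩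
    have hyi : IsIntegral ℤ (y : K) := by
      refine IsIntegral.of_pow two_pos ?_
      have : (y : K) ^ 2 = algebraMap (𝓞 K) K u := congrArg Units.val hy
      rw [this]
      exact RingOfIntegers.isIntegral_coe (u : 𝓞 K)
    let v : 𝓞 K := ⟨y, hyi⟩
    have hv : v ^ 2 = u := by
      apply RingOfIntegers.ext
      exact congrArg Units.val hy
    have hvu : IsUnit v := (isUnit_pow_iff two_ne_zero).mp (hv ▸ u.isUnit)
    exact ⟨hvu.unit, Units.ext (by simpa using hv)⟩
  · rintro ⟨v, rfl⟩
    exact ⟨Units.map (algebraMap (𝓞 K) K : 𝓞 K →* K) v, by simp⟩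

/-- The elements of `K` generating an ideal which is a square up to `T`. -/
def selmer (T : Subgroup (IdealGroup K)) : Subgroup Kˣ :=
  (squares (IdealGroup K) ⊔ T).comap (toPrincipalIdeal (𝓞 K) K)

theorem squares_le_selmer (T : Subgroup (IdealGroup K)) : squares Kˣ ≤ selmer T := by
  rintro _ ⟨a, rfl⟩
  exact Subgroup.mem_sup_left ⟨toPrincipalIdeal (𝓞 K) K a, by simp⟩

variable (K) in
/-- The class of a fractional ideal. -/
noncomputable def idealClass : IdealGroup K →* ClassGroup (𝓞 K) :=
  (ClassGroup.equiv K).symm.toMonoidHom.comp (QuotientGroup.mk' _)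

theorem idealClass_mk0 (a : (Ideal (𝓞 K))⁰) :
    idealClass K (FractionalIdeal.mk0 K a) = ClassGroup.mk0 a :=
  (ClassGroup.equiv K).symm_apply_eq.mpr (ClassGroup.equiv_mk0 K a).symm

theorem idealClass_surjective : Function.Surjective (idealClass K) :=
  (ClassGroup.equiv K).symm.surjective.comp (QuotientGroup.mk'_surjective _)

theorem idealClass_ker : (idealClass K).ker = (toPrincipalIdeal (𝓞 K) K).range := by
  ext A
  rw [MonoidHom.mem_ker, idealClass, MonoidHom.comp_apply]
  exact (map_eq_one_iff _ (ClassGroup.equiv K).symm.injective).trans (QuotientGroup.eq_one_iff A)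

theorem relIndex_squares_selmer [IsTotallyComplex K] (T : Subgroup (IdealGroup K)) {N : ℕ}
    (hN : Module.finrank ℚ K = 2 * N) :
    (squares Kˣ).relIndex (selmer T) = 2 ^ N *
      (squares (IdealGroup K)).relIndex (squares (IdealGroup K) ⊔ T) *
        (squares (ClassGroup (𝓞 K)) ⊔ T.map (idealClass K)).index := by
  have h1 := rank_add_one K
  have h2 : Units.rank K + 1 = N := by omega
  have h3 : squares (ClassGroup (𝓞 K)) = (squares (IdealGroup K)).map (idealClass K) := by
    rw [MonoidHom.map_range]
    ext c
    constructor
    · rintro ⟨d, rfl⟩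
      obtain ⟨A, rfl⟩ := idealClass_surjective d
      exact ⟨A, by simp⟩
    · rintro ⟨A, rfl⟩
      exact ⟨idealClass K A, by simp⟩
  have h4 := relIndex_squares_comap (toPrincipalIdeal (𝓞 K) K) idealGroup_sq_injective
    (squares (IdealGroup K) ⊔ T) le_sup_left toPrincipalIdeal_range_index_ne_zero
  rw [selmer, h4, relIndex_squares_toPrincipalIdeal_ker, index_squares_units, h2, h3,
    ← Subgroup.map_sup, Subgroup.index_map, idealClass_ker,
    MonoidHom.range_eq_top.mpr idealClass_surjective, Subgroup.index_top, mul_one]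

end IdealGroups

section IdealMap

variable {K L M : Type*} [Field K] [NumberField K] [Field L] [NumberField L]
  [Field M] [NumberField M]

omit [NumberField K] [NumberField L] in
theorem mapRingHom_injective (φ : K →+* L) :
    Function.Injective (RingOfIntegers.mapRingHom φ) := fun _ _ h =>
  RingOfIntegers.ext (φ.injective (congrArg (algebraMap (𝓞 L) L) h))

/-- Extension of fractional ideals along an embedding of number fields. -/
noncomputable def idealMap (φ : K →+* L) : IdealGroup K →* IdealGroup L :=
  Units.map (FractionalIdeal.extendedHom' (K := K) L (f := RingOfIntegers.mapRingHom φ)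
    (nonZeroDivisors_le_comap_nonZeroDivisors_of_injective _
      (mapRingHom_injective φ))).toMonoidHom

theorem val_idealMap_mk0 (φ : K →+* L) (a : (Ideal (𝓞 K))⁰) :
    (idealMap φ (FractionalIdeal.mk0 K a) : FractionalIdeal (𝓞 L)⁰ L) =
      ((a : Ideal (𝓞 K)).map (RingOfIntegers.mapRingHom φ) : Ideal (𝓞 L)) :=
  FractionalIdeal.extended_coeIdeal_eq_map L _ _

theorem idealMap_mk0 (φ : K →+* L) {a : (Ideal (𝓞 K))⁰} {b : (Ideal (𝓞 L))⁰}
    (h : (a : Ideal (𝓞 K)).map (RingOfIntegers.mapRingHom φ) = b) :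
    idealMap φ (FractionalIdeal.mk0 K a) = FractionalIdeal.mk0 L b :=
  Units.ext (by rw [val_idealMap_mk0, h, FractionalIdeal.coe_mk0])

omit [NumberField K] [NumberField L] in
theorem map_mapRingHom_ne_bot (φ : K →+* L) {a : Ideal (𝓞 K)} (ha : a ≠ ⊥) :
    a.map (RingOfIntegers.mapRingHom φ) ≠ ⊥ := by
  rwa [Ne, Ideal.map_eq_bot_iff_of_injective (mapRingHom_injective φ)]

omit [NumberField K] [NumberField L] in
theorem exists_idealMap_mk0_eq (φ : K →+* L) (a : (Ideal (𝓞 K))⁰) :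
    ∃ b : (Ideal (𝓞 L))⁰, (a : Ideal (𝓞 K)).map (RingOfIntegers.mapRingHom φ) = b :=
  ⟨⟨_, mem_nonZeroDivisors_of_ne_zero
    (map_mapRingHom_ne_bot φ (mem_nonZeroDivisors_iff_ne_zero.mp a.2))⟩, rfl⟩

theorem idealMap_toPrincipalIdeal (φ : K →+* L) (x : Kˣ) :
    idealMap φ (toPrincipalIdeal (𝓞 K) K x) =
      toPrincipalIdeal (𝓞 L) L (Units.map (φ : K →* L) x) := by
  apply Units.ext
  rw [coe_toPrincipalIdeal, idealMap, Units.coe_map, coe_toPrincipalIdeal]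
  refine (FractionalIdeal.extended_spanSingleton L _ _).trans ?_
  congr 1
  change IsLocalization.map L (RingOfIntegers.mapRingHom φ) _ (x : K) = φ x
  obtain ⟨y, z, hz, hx⟩ := IsFractionRing.div_surjective (A := 𝓞 K) (x : K)
  rw [← hx, map_div₀, map_div₀, IsLocalization.map_eq, IsLocalization.map_eq]
  rfl

theorem idealGroup_hom_ext {G : Type*} [Group G] {f g : IdealGroup K →* G}
    (h : ∀ a, f (FractionalIdeal.mk0 K a) = g (FractionalIdeal.mk0 K a)) : f = g := by
  ext1 A
  obtain ⟨a, b, hab⟩ := exists_mul_mk0_eq_mk0 A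
  have h1 : f (A * FractionalIdeal.mk0 K a) = g (A * FractionalIdeal.mk0 K a) := by
    rw [hab, h]
  rwa [map_mul, map_mul, h, mul_left_inj] at h1

theorem idealMap_idealMap (φ : K →+* L) (ψ : L →+* M) (A : IdealGroup K) :
    idealMap ψ (idealMap φ A) = idealMap (ψ.comp φ) A := by
  have h : (idealMap ψ).comp (idealMap φ) = idealMap (ψ.comp φ) :=
    idealGroup_hom_ext fun a => by
      obtain ⟨b, hb⟩ := exists_idealMap_mk0_eq φ a
      obtain ⟨c, hc⟩ := exists_idealMap_mk0_eq ψ b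
      rw [MonoidHom.comp_apply, idealMap_mk0 φ hb, idealMap_mk0 ψ hc]
      refine (idealMap_mk0 _ ?_).symm
      rw [← hc, ← hb, Ideal.map_map]
      rfl
  exact DFunLike.congr_fun h A

theorem idealMap_id : idealMap (RingHom.id K) = MonoidHom.id _ :=
  idealGroup_hom_ext fun a => by
    rw [MonoidHom.id_apply]
    exact idealMap_mk0 _ (Ideal.map_id _)

theorem idealMap_injective (φ : K →+* L) : Function.Injective (idealMap φ) := by
  let := φ.toAlgebra
  intro A B h
  exact Units.ext (FractionalIdeal.extendedHom_injective (𝓞 K) K L (𝓞 L) (congrArg Units.val h))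

end IdealMap

section Quadratic

variable {k F : Type*} [Field k] [NumberField k] [Field F] [NumberField F] [Algebra k F]
  [IsGalois k F]

/-- The conjugate of an ideal under an automorphism. -/
abbrev conjIdeal (σ : F ≃ₐ[k] F) (P : Ideal (𝓞 F)) : Ideal (𝓞 F) :=
  P.map (RingOfIntegers.mapRingHom (σ : F →+* F))

omit [NumberField k] [NumberField F] [IsGalois k F] in
theorem smul_ideal_eq_conjIdeal (σ : F ≃ₐ[k] F) (P : Ideal (𝓞 F)) : σ • P = conjIdeal σ P := by
  rfl

theorem card_gal_eq_two (h2 : Module.finrank k F = 2) : Nat.card (F ≃ₐ[k] F) = 2 := by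
  rw [IsGalois.card_aut_eq_finrank, h2]

theorem gal_eq_one_or_eq (h2 : Module.finrank k F = 2) {σ : F ≃ₐ[k] F} (hσ : σ ≠ 1)
    (τ : F ≃ₐ[k] F) : τ = 1 ∨ τ = σ := by
  have h := card_gal_eq_two h2
  rw [Nat.card_eq_two_iff' (1 : F ≃ₐ[k] F)] at h
  by_cases hτ : τ = 1
  · exact Or.inl hτ
  · exact Or.inr (h.unique hτ hσ)

theorem prime_trichotomy (h2 : Module.finrank k F = 2) {σ : F ≃ₐ[k] F} (hσ : σ ≠ 1)
    (P : Ideal (𝓞 F)) [P.IsPrime] (hP : P ≠ ⊥) :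
    P = (P.under (𝓞 k)).map (algebraMap (𝓞 k) (𝓞 F)) ∨
      (P * conjIdeal σ P = (P.under (𝓞 k)).map (algebraMap (𝓞 k) (𝓞 F)) ∧
        (conjIdeal σ P = P → ∀ x, RingOfIntegers.mapRingHom (σ : F →+* F) x - x ∈ P)) := by
  have hPm : P.IsMaximal := ‹P.IsPrime›.isMaximal hP
  set p := P.under (𝓞 k) with hp
  have hover : P.LiesOver p := ⟨rfl⟩
  have hpm : p.IsMaximal := Ideal.IsMaximal.under _ P
  have hp0 : p ≠ ⊥ := Ideal.under_ne_bot _ hP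
  have hprimes : p.primesOver (𝓞 F) = {P, conjIdeal σ P} := by
    ext Q
    constructor
    · rintro ⟨hQ, hQp⟩
      obtain ⟨τ, rfl⟩ := Ideal.exists_smul_eq_of_isGaloisGroup p P Q (F ≃ₐ[k] F)
      rcases gal_eq_one_or_eq h2 hσ τ with rfl | rfl
      · left; exact one_smul _ _
      · right; rfl
    · rintro (rfl | rfl)
      · exact ⟨inferInstance, hover⟩
      · exact (Ideal.primesOver.mk p (σ • P)).2
  have hefg := Ideal.ncard_primesOver_mul_ramificationIdxIn_mul_inertiaDegIn p (𝓞 F) (F ≃ₐ[k] F)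
  have hmap := Ideal.map_algebraMap_eq_finsetProd_pow (R := 𝓞 F) hp0
  rw [card_gal_eq_two h2] at hefg
  rw [Ideal.ramificationIdxIn_eq_ramificationIdx p P (F ≃ₐ[k] F),
    Ideal.inertiaDegIn_eq_inertiaDeg p P (F ≃ₐ[k] F)] at hefg
  by_cases hPσ : conjIdeal σ P = P
  · rw [hPσ, Set.pair_eq_singleton] at hprimes
    rw [hprimes, Set.ncard_singleton, one_mul] at hefg
    have h3 : (p.primesOver (𝓞 F)).toFinset = {P} := by simp [hprimes]
    rw [h3, Finset.prod_singleton] at hmap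
    rcases (Nat.prime_mul_iff.mp (hefg ▸ Nat.prime_two)) with ⟨-, hf⟩ | ⟨-, he⟩
    · right
      rw [hf, mul_one] at hefg
      refine ⟨by rw [hmap, hPσ, hefg, sq], fun _ x => ?_⟩
      rw [Ideal.inertiaDeg_eq_of_isMaximal (p := p)] at hf
      let : Field (𝓞 k ⧸ p) := Ideal.Quotient.field p
      obtain ⟨r, hr⟩ := (finrank_eq_one_iff_of_nonzero' (1 : 𝓞 F ⧸ P) one_ne_zero).mp hf
        (Ideal.Quotient.mk P x)
      obtain ⟨r, rfl⟩ := Ideal.Quotient.mk_surjective r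
      rw [Algebra.smul_def, mul_one, Ideal.Quotient.algebraMap_mk_of_liesOver,
        Ideal.Quotient.eq] at hr
      have h4 := Ideal.mem_map_of_mem (RingOfIntegers.mapRingHom (σ : F →+* F)) hr
      rw [show Ideal.map _ P = P from hPσ, map_sub] at h4
      have h5 : RingOfIntegers.mapRingHom (σ : F →+* F) (algebraMap (𝓞 k) (𝓞 F) r) =
          algebraMap (𝓞 k) (𝓞 F) r := RingOfIntegers.ext (σ.commutes _)
      rw [h5] at h4
      simpa using sub_mem hr h4
    · left
      rw [hmap, he, pow_one]
  · right
    refine ⟨?_, fun h => absurd h hPσ⟩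
    have hne : P ≠ conjIdeal σ P := fun h => hPσ h.symm
    rw [hprimes, Set.ncard_pair hne] at hefg
    have he : P.ramificationIdx (𝓞 k) = 1 :=
      Nat.eq_one_of_mul_eq_one_right (by omega : _ * P.inertiaDeg (𝓞 k) = 1)
    have he' : (conjIdeal σ P).ramificationIdx (𝓞 k) = 1 :=
      by
      rw [← smul_ideal_eq_conjIdeal, Ideal.ramificationIdx_smul, he]
    have h3 : (p.primesOver (𝓞 F)).toFinset = {P, conjIdeal σ P} := by simp [hprimes]
    rw [hmap, h3, Finset.prod_pair hne, he, he', pow_one, pow_one]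

variable (σ : F ≃ₐ[k] F)

/-- The action of an automorphism on fractional ideals. -/
noncomputable abbrev conjMap : IdealGroup F →* IdealGroup F := idealMap (σ : F →+* F)

variable (k F) in
/-- Extension of fractional ideals from `k` to `F`. -/
noncomputable abbrev extMap : IdealGroup k →* IdealGroup F := idealMap (algebraMap k F)

omit [IsGalois k F] in
theorem conjMap_extMap (A : IdealGroup k) : conjMap σ (extMap k F A) = extMap k F A := by
  rw [idealMap_idealMap]
  congr 1
  exact congrArg idealMap (RingHom.ext fun x => σ.commutes x)

theorem gal_mul_self (h2 : Module.finrank k F = 2) : σ * σ = 1 := by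
  have := pow_card_eq_one' (x := σ)
  rwa [card_gal_eq_two h2, sq] at this

theorem conjMap_conjMap (h2 : Module.finrank k F = 2) (A : IdealGroup F) :
    conjMap σ (conjMap σ A) = A := by
  rw [idealMap_idealMap]
  have : ((σ : F →+* F).comp (σ : F →+* F)) = RingHom.id F :=
    RingHom.ext fun x => DFunLike.congr_fun (gal_mul_self σ h2) x
  rw [this, idealMap_id]
  rfl

omit [IsGalois k F] in
theorem extMap_mk0 {p : (Ideal (𝓞 k))⁰} {P : (Ideal (𝓞 F))⁰}
    (h : (P : Ideal (𝓞 F)) = (p : Ideal (𝓞 k)).map (algebraMap (𝓞 k) (𝓞 F))) :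
    extMap k F (FractionalIdeal.mk0 k p) = FractionalIdeal.mk0 F P :=
  idealMap_mk0 _ h.symm

omit [NumberField k] [IsGalois k F] in
theorem exists_conjMap_mk0_eq (P : (Ideal (𝓞 F))⁰) :
    ∃ Q : (Ideal (𝓞 F))⁰, (Q : Ideal (𝓞 F)) = conjIdeal σ P ∧
      conjMap σ (FractionalIdeal.mk0 F P) = FractionalIdeal.mk0 F Q := by
  obtain ⟨Q, hQ⟩ := exists_idealMap_mk0_eq (σ : F →+* F) P
  exact ⟨Q, hQ.symm, idealMap_mk0 _ hQ⟩

theorem mk0_prime_trichotomy (h2 : Module.finrank k F = 2) {σ : F ≃ₐ[k] F} (hσ : σ ≠ 1)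
    (P : (Ideal (𝓞 F))⁰) [hP : (P : Ideal (𝓞 F)).IsPrime] :
    FractionalIdeal.mk0 F P ∈ (extMap k F).range ∨
      (FractionalIdeal.mk0 F P * conjMap σ (FractionalIdeal.mk0 F P) ∈ (extMap k F).range ∧
        (conjIdeal σ P = P →
          ∀ x, RingOfIntegers.mapRingHom (σ : F →+* F) x - x ∈ (P : Ideal (𝓞 F)))) := by
  have hP0 : (P : Ideal (𝓞 F)) ≠ ⊥ := mem_nonZeroDivisors_iff_ne_zero.mp P.2
  have hp0 : (P : Ideal (𝓞 F)).under (𝓞 k) ≠ 0 := Ideal.under_ne_bot _ hP0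
  obtain ⟨p, hp⟩ : ∃ p : (Ideal (𝓞 k))⁰, (p : Ideal (𝓞 k)) = (P : Ideal (𝓞 F)).under (𝓞 k) :=
    ⟨⟨_, mem_nonZeroDivisors_of_ne_zero hp0⟩, rfl⟩
  have htri := prime_trichotomy h2 hσ P hP0
  rw [← hp] at htri
  refine htri.imp (fun h => ⟨_, extMap_mk0 h⟩) (And.imp_left fun h => ?_)
  obtain ⟨Q, hQ, hQ'⟩ := exists_conjMap_mk0_eq σ P
  rw [hQ', ← map_mul]
  exact ⟨_, extMap_mk0 (by rw [Submonoid.coe_mul, hQ, h])⟩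

/-- Every nonzero ideal is a product of primes. -/
theorem nonZeroIdeal_induction {C : (Ideal (𝓞 F))⁰ → Prop} (h1 : C 1)
    (hmul : ∀ P a : (Ideal (𝓞 F))⁰, (P : Ideal (𝓞 F)).IsPrime → C a → C (P * a))
    (a : (Ideal (𝓞 F))⁰) : C a := by
  obtain ⟨a, ha⟩ := a
  induction a using UniqueFactorizationMonoid.induction_on_prime with
  | h₁ => exact absurd rfl (mem_nonZeroDivisors_iff_ne_zero.mp ha)
  | h₂ x hx =>
    obtain rfl : x = 1 := (Ideal.isUnit_iff.mp hx).trans Ideal.one_eq_top.symm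
    exact h1
  | h₃ a P ha' hP ih =>
    exact hmul ⟨P, mem_nonZeroDivisors_of_ne_zero hP.ne_zero⟩
      ⟨a, mem_nonZeroDivisors_of_ne_zero ha'⟩ (Ideal.isPrime_of_prime hP) (ih _)

theorem mul_conjMap_mem_range (h2 : Module.finrank k F = 2) {σ : F ≃ₐ[k] F} (hσ : σ ≠ 1)
    (A : IdealGroup F) : A * conjMap σ A ∈ (extMap k F).range := by
  have h : ∀ a : (Ideal (𝓞 F))⁰, FractionalIdeal.mk0 F a * conjMap σ (FractionalIdeal.mk0 F a) ∈
      (extMap k F).range := by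
    refine nonZeroIdeal_induction ?_ fun P a hP ih => ?_
    · rw [map_one, map_one, one_mul]
      exact one_mem _
    · rw [map_mul, map_mul, mul_mul_mul_comm]
      refine mul_mem ?_ ih
      rcases mk0_prime_trichotomy h2 hσ P with ⟨B, hB⟩ | ⟨h, -⟩
      · rw [← hB, conjMap_extMap]
        exact mul_mem ⟨_, rfl⟩ ⟨_, rfl⟩
      · exact h
  obtain ⟨a, b, hab⟩ := exists_mul_mk0_eq_mk0 A
  have h1 := h b
  rw [← hab, map_mul, mul_mul_mul_comm] at h1
  exact (Subgroup.mul_mem_cancel_right _ (h a)).mp h1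

/-- The prime ideals fixed pointwise, modulo themselves, by `σ`. -/
def ramifiedPrimes : Set (IdealGroup F) :=
  {A | ∃ P : (Ideal (𝓞 F))⁰, (P : Ideal (𝓞 F)).IsPrime ∧
    (∀ x, RingOfIntegers.mapRingHom (σ : F →+* F) x - x ∈ (P : Ideal (𝓞 F))) ∧
    FractionalIdeal.mk0 F P = A}

end Quadratic

section Ambiguous

variable {k F : Type*} [Field k] [NumberField k] [Field F] [NumberField F] [Algebra k F]
  [IsGalois k F]

theorem conjIdeal_conjIdeal (h2 : Module.finrank k F = 2) (σ : F ≃ₐ[k] F) (P : Ideal (𝓞 F)) :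
    conjIdeal σ (conjIdeal σ P) = P := by
  rw [← smul_ideal_eq_conjIdeal, ← smul_ideal_eq_conjIdeal, smul_smul, gal_mul_self σ h2, one_smul]

theorem mk0_mem_of_conjIdeal_eq (h2 : Module.finrank k F = 2) {σ : F ≃ₐ[k] F} (hσ : σ ≠ 1)
    (a : Ideal (𝓞 F)) (ha : a ∈ (Ideal (𝓞 F))⁰) (h : conjIdeal σ a = a) :
    FractionalIdeal.mk0 F ⟨a, ha⟩ ∈ (extMap k F).range ⊔ Subgroup.closure (ramifiedPrimes σ) := by
  induction a using WellFounded.induction (wellFounded_dvdNotUnit (α := Ideal (𝓞 F))) with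
  | h a ih =>
  by_cases hu : IsUnit a
  · obtain rfl : a = 1 := (Ideal.isUnit_iff.mp hu).trans Ideal.one_eq_top.symm
    have : (⟨1, ha⟩ : (Ideal (𝓞 F))⁰) = 1 := rfl
    rw [this, map_one]
    exact one_mem _
  have ha0 := mem_nonZeroDivisors_iff_ne_zero.mp ha
  obtain ⟨P, hPi, hPa⟩ := WfDvdMonoid.exists_irreducible_factor hu ha0
  have hPp := Ideal.isPrime_of_prime hPi.prime
  obtain ⟨P', rfl⟩ : ∃ P' : (Ideal (𝓞 F))⁰, (P' : Ideal (𝓞 F)) = P :=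
    ⟨⟨P, mem_nonZeroDivisors_of_ne_zero hPi.ne_zero⟩, rfl⟩
  suffices hc : ∃ c : (Ideal (𝓞 F))⁰, (c : Ideal (𝓞 F)) ∣ a ∧ ¬ IsUnit (c : Ideal (𝓞 F)) ∧
      conjIdeal σ c = c ∧ FractionalIdeal.mk0 F c ∈
        (extMap k F).range ⊔ Subgroup.closure (ramifiedPrimes σ) by
    obtain ⟨c, ⟨b, rfl⟩, hcu, hcσ, hcm⟩ := hc
    have hb0 : b ≠ 0 := right_ne_zero_of_mul ha0
    have hbσ : conjIdeal σ b = b := by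
      apply mul_left_cancel₀ (left_ne_zero_of_mul ha0)
      calc _ = conjIdeal σ c * conjIdeal σ b := by rw [hcσ]
        _ = _ := (Ideal.map_mul _ _ _).symm.trans h
    have := ih b ⟨hb0, c, hcu, mul_comm _ _⟩ (mem_nonZeroDivisors_of_ne_zero hb0) hbσ
    have h3 : (⟨c * b, ha⟩ : (Ideal (𝓞 F))⁰) = c * ⟨b, mem_nonZeroDivisors_of_ne_zero hb0⟩ := rfl
    rw [h3, map_mul]
    exact mul_mem hcm this
  by_cases hPσ : conjIdeal σ P' = P'
  · refine ⟨P', hPa, hPi.not_isUnit, hPσ, ?_⟩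
    rcases mk0_prime_trichotomy h2 hσ P' with hP | ⟨-, hP⟩
    · exact Subgroup.mem_sup_left hP
    · exact Subgroup.mem_sup_right (Subgroup.subset_closure ⟨P', hPp, hP hPσ, rfl⟩)
  · obtain ⟨Q, hQ, hQ'⟩ := exists_conjMap_mk0_eq σ P'
    refine ⟨P' * Q, ?_, ?_, ?_, ?_⟩
    · obtain ⟨b, rfl⟩ := hPa
      have hQp : (Q : Ideal (𝓞 F)).IsPrime := by
        rw [hQ, ← smul_ideal_eq_conjIdeal]
        infer_instance
      have hQp' := Ideal.prime_of_isPrime (mem_nonZeroDivisors_iff_ne_zero.mp Q.2) hQp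
      have hQa : (Q : Ideal (𝓞 F)) ∣ P' * b := by
        rw [← h, hQ]
        exact ⟨conjIdeal σ b, Ideal.map_mul _ _ _⟩
      refine mul_dvd_mul_left _ ((hQp'.dvd_or_dvd hQa).resolve_left fun hd => hPσ ?_)
      rw [← hQ]
      exact associated_iff_eq.mp ((hQp'.dvd_prime_iff_associated hPi.prime).mp hd)
    · exact fun hu' => hPi.not_isUnit (isUnit_of_mul_isUnit_left hu')
    · rw [Submonoid.coe_mul, conjIdeal, Ideal.map_mul, hQ]
      change conjIdeal σ P' * conjIdeal σ (conjIdeal σ P') = _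
      rw [conjIdeal_conjIdeal h2, mul_comm]
    · rw [map_mul, ← hQ']
      exact Subgroup.mem_sup_left (mul_conjMap_mem_range h2 hσ _)

theorem mem_of_conjMap_eq (h2 : Module.finrank k F = 2) {σ : F ≃ₐ[k] F} (hσ : σ ≠ 1)
    (A : IdealGroup F) (h : conjMap σ A = A) :
    A ∈ (extMap k F).range ⊔ Subgroup.closure (ramifiedPrimes σ) := by
  obtain ⟨a, b, hab⟩ := exists_mul_mk0_eq_mk0 A
  obtain ⟨c, -, hc⟩ := exists_conjMap_mk0_eq σ a
  have h1 := mul_conjMap_mem_range h2 hσ (FractionalIdeal.mk0 F a)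
  have h3 : A * (FractionalIdeal.mk0 F a * conjMap σ (FractionalIdeal.mk0 F a)) =
      FractionalIdeal.mk0 F (b * c) := by
    rw [map_mul, ← hab, ← hc, mul_assoc]
  have h4 : conjIdeal σ (b * c : (Ideal (𝓞 F))⁰) = (b * c : (Ideal (𝓞 F))⁰) := by
    obtain ⟨d, hd, hd'⟩ := exists_conjMap_mk0_eq σ (b * c)
    rw [← hd]
    congr 1
    apply mk0_injective
    rw [← hd', ← h3, map_mul, h]
    obtain ⟨B, hB⟩ := h1
    rw [← hB, conjMap_extMap]
  have h5 := mk0_mem_of_conjIdeal_eq h2 hσ _ (b * c).2 h4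
  rw [Subtype.coe_eta, ← h3] at h5
  exact (Subgroup.mul_mem_cancel_right _ (Subgroup.mem_sup_left h1)).mp h5

/-- The embedding of the multiplicative groups. -/
noncomputable abbrev unitsEmb (k F : Type*) [Field k] [Field F] [Algebra k F] : kˣ →* Fˣ :=
  Units.map (algebraMap k F : k →* F)

omit [NumberField k] [NumberField F] [IsGalois k F] in
theorem unitsEmb_injective : Function.Injective (unitsEmb k F) :=
  Units.map_injective (algebraMap k F).injective

theorem relIndex_selmer_comap_le (h2 : Module.finrank k F = 2) {σ : F ≃ₐ[k] F} (hσ : σ ≠ 1)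
    (R : Finset (IdealGroup F)) (hR : ramifiedPrimes σ ⊆ R)
    (Tk : Subgroup (IdealGroup k)) (TF : Subgroup (IdealGroup F))
    (hT : ∀ t ∈ TF, conjMap σ t * t⁻¹ ∈ squares (IdealGroup F) →
      ∃ u : IdealGroup F, ∃ t' ∈ Tk, t = u ^ 2 * extMap k F t') :
    (selmer Tk).relIndex ((selmer TF).comap (unitsEmb k F)) ≠ 0 ∧
      (selmer Tk).relIndex ((selmer TF).comap (unitsEmb k F)) ≤ 2 ^ R.card := by
  classical
  set Dk := squares (IdealGroup k) ⊔ Tk with hDk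
  set DF := squares (IdealGroup F) ⊔ TF with hDF
  have hcomap : (selmer TF).comap (unitsEmb k F) =
      (DF.comap (extMap k F)).comap (toPrincipalIdeal (𝓞 k) k) := by
    ext x
    simp only [selmer, Subgroup.mem_comap]
    rw [idealMap_toPrincipalIdeal]
  have hsq : ∀ P ∈ ramifiedPrimes σ, ∃ N, P ^ 2 = extMap k F N := by
    rintro _ ⟨P, hP, hPσ, rfl⟩
    rcases mk0_prime_trichotomy h2 hσ P with ⟨N, hN⟩ | ⟨⟨N, hN⟩, -⟩
    · exact ⟨N ^ 2, by rw [map_pow, hN]⟩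
    · refine ⟨N, ?_⟩
      have hle : conjIdeal σ P ≤ P := by
        rw [Ideal.map_le_iff_le_comap]
        intro x hx
        have := add_mem (hPσ x) hx
        rwa [sub_add_cancel] at this
      have hPm : (conjIdeal σ P).IsMaximal := by
        have hp' : (conjIdeal σ P).IsPrime := by
          rw [← smul_ideal_eq_conjIdeal]
          infer_instance
        exact hp'.isMaximal (map_mapRingHom_ne_bot _ (mem_nonZeroDivisors_iff_ne_zero.mp P.2))
      have heq := hPm.eq_of_le hP.ne_top hle
      rw [hN, sq, show conjMap σ (FractionalIdeal.mk0 F P) = FractionalIdeal.mk0 F P from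
        idealMap_mk0 _ heq]
  choose! N hN using hsq
  let R' := R.filter (· ∈ ramifiedPrimes σ)
  set C := Subgroup.closure ((R'.image N : Finset (IdealGroup k)) : Set (IdealGroup k)) with hC
  have hle : DF.comap (extMap k F) ≤ Dk ⊔ C := by
    intro J hJ
    rw [Subgroup.mem_comap, hDF, Subgroup.mem_sup] at hJ
    obtain ⟨_, ⟨A, rfl⟩, t, ht, hAt⟩ := hJ
    rw [powMonoidHom_apply] at hAt
    have h3 : conjMap σ t * t⁻¹ = (A * (conjMap σ A)⁻¹) ^ 2 := by
      have h4 := congrArg (conjMap σ) hAt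
      rw [conjMap_extMap, ← hAt, map_mul, map_pow] at h4
      have h5 : conjMap σ t = (conjMap σ A ^ 2)⁻¹ * (A ^ 2 * t) := by
        rw [← h4, inv_mul_cancel_left]
      rw [h5, mul_pow, inv_pow, mul_assoc, mul_assoc, mul_inv_cancel, mul_one, mul_comm]
    obtain ⟨u, t', ht', rfl⟩ := hT t ht ⟨_, h3.symm⟩
    have h6 : extMap k F (J * t'⁻¹) = (A * u) ^ 2 := by
      rw [map_mul, map_inv, ← hAt, mul_pow]
      group
    have h7 : conjMap σ (A * u) = A * u := by
      apply idealGroup_sq_injective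
      rw [powMonoidHom_apply, powMonoidHom_apply, ← map_pow, ← h6, conjMap_extMap]
    have h8 := mem_of_conjMap_eq h2 hσ _ h7
    have h9 : (A * u) ^ 2 ∈ (squares (IdealGroup k) ⊔ C).map (extMap k F) := by
      have : (extMap k F).range ⊔ Subgroup.closure (ramifiedPrimes σ) ≤
          ((squares (IdealGroup k) ⊔ C).map (extMap k F)).comap (powMonoidHom 2) := by
        refine sup_le ?_ ((Subgroup.closure_le _).mpr fun P hP => ?_)
        · rintro _ ⟨B, rfl⟩
          exact ⟨B ^ 2, Subgroup.mem_sup_left (sq_mem_squares B), by simp⟩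
        · refine ⟨N P, Subgroup.mem_sup_right (Subgroup.subset_closure ?_), (hN P hP).symm⟩
          exact Finset.mem_coe.mpr (Finset.mem_image_of_mem N
            (Finset.mem_filter.mpr ⟨hR hP, hP⟩))
      exact this h8
    obtain ⟨B, hB, hB'⟩ := h9
    have h10 : J * t'⁻¹ = B := idealMap_injective _ (h6.trans hB'.symm)
    rw [← inv_mul_cancel_right J t', h10]
    refine mul_mem ((sup_le_sup_right (le_sup_left : _ ≤ Dk) C) hB) ?_
    exact Subgroup.mem_sup_left (Subgroup.mem_sup_right ht')
  obtain ⟨hC0, hC1⟩ := relIndex_closure_le Dk le_sup_left (R'.image N)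
  rw [← hC, ← Subgroup.relIndex_sup_right] at hC0 hC1
  have hcard : (R'.image N).card ≤ R.card := Finset.card_image_le.trans (Finset.card_filter_le _ _)
  rw [hcomap, selmer, Subgroup.relIndex_comap]
  have hle' := (Subgroup.map_comap_le (toPrincipalIdeal (𝓞 k) k) _).trans hle
  rw [sup_comm] at hle'
  exact ⟨fun h0 => hC0 (Subgroup.relIndex_eq_zero_of_le_right hle' h0),
    (Subgroup.relIndex_le_of_le_right hle' hC0).trans
      (hC1.trans (Nat.pow_le_pow_right two_pos hcard))⟩

end Ambiguous

section QuadraticSelmer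

variable {k F : Type*} [Field k] [NumberField k] [Field F] [NumberField F] [Algebra k F]
  [IsGalois k F]

theorem mem_unitsEmb_range (h2 : Module.finrank k F = 2) {σ : F ≃ₐ[k] F} (hσ : σ ≠ 1) (x : Fˣ)
    (hx : σ x = x) : x ∈ (unitsEmb k F).range := by
  have : FiniteDimensional k F := Module.finite_of_finrank_pos (by omega)
  obtain ⟨y, hy⟩ := (IsGalois.mem_range_algebraMap_iff_fixed (F := k) (x : F)).mpr fun τ => by
    rcases gal_eq_one_or_eq h2 hσ τ with rfl | rfl
    · rfl
    · exact hx
  have hy0 : y ≠ 0 := by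
    rintro rfl
    exact x.ne_zero (by rw [← hy, map_zero])
  exact ⟨Units.mk0 y hy0, Units.ext hy⟩

theorem mem_sup_squares_of_norm_eq_sq (h2 : Module.finrank k F = 2) {σ : F ≃ₐ[k] F} (hσ : σ ≠ 1)
    (x a : Fˣ) (ha : a ∈ (unitsEmb k F).range)
    (h : x * Units.map (σ : F →* F) x = a ^ 2) :
    x ∈ (unitsEmb k F).range ⊔ squares Fˣ := by
  have hσa : σ a = a := by
    obtain ⟨b, rfl⟩ := ha
    exact σ.commutes _
  have h' : (x : F) * σ x = a ^ 2 := by simpa using congrArg Units.val h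
  have hσσ (y : F) : σ (σ y) = y := DFunLike.congr_fun (gal_mul_self σ h2) y
  by_cases hw : (a + x : F) = 0
  · refine Subgroup.mem_sup_left (mem_unitsEmb_range h2 hσ x ?_)
    rw [eq_neg_of_add_eq_zero_right hw, map_neg, hσa]
  · have h3 : (x : F) * (a + σ x) = a * (a + x) := by linear_combination h'
    have hw' : (a + σ x : F) ≠ 0 := by
      rw [← hσa, ← map_add]
      exact (map_ne_zero σ).mpr hw
    let w := Units.mk0 _ hw
    let n := Units.mk0 _ (mul_ne_zero hw hw')
    have hn : n ∈ (unitsEmb k F).range := by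
      refine mem_unitsEmb_range h2 hσ n ?_
      simp only [n, Units.val_mk0, map_mul, map_add, hσσ, hσa, mul_comm]
    have hx : x = (a * n⁻¹) * w ^ 2 := by
      rw [mul_assoc, mul_comm n⁻¹, ← mul_assoc, eq_mul_inv_iff_mul_eq]
      ext
      simp only [n, w, Units.val_mul, Units.val_pow_eq_pow_val, Units.val_mk0]
      linear_combination (a + x : F) * h3
    rw [hx]
    exact mul_mem (Subgroup.mem_sup_left (mul_mem ha (inv_mem hn)))
      (Subgroup.mem_sup_right (sq_mem_squares w))

omit [IsGalois k F] in
theorem selmer_map_le {Tk : Subgroup (IdealGroup k)} {TF : Subgroup (IdealGroup F)}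
    (hTk : Tk.map (extMap k F) ≤ squares (IdealGroup F) ⊔ TF) :
    (selmer Tk).map (unitsEmb k F) ≤ selmer TF := by
  rintro _ ⟨x, hx, rfl⟩
  rw [selmer, Subgroup.mem_comap, ← idealMap_toPrincipalIdeal]
  have : (squares (IdealGroup k) ⊔ Tk).map (extMap k F) ≤ squares (IdealGroup F) ⊔ TF := by
    rw [Subgroup.map_sup]
    refine sup_le ?_ hTk
    rintro _ ⟨_, ⟨y, rfl⟩, rfl⟩
    exact Subgroup.mem_sup_left ⟨extMap k F y, (map_pow (extMap k F) y 2).symm⟩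
  exact this ⟨_, hx, rfl⟩

theorem relIndex_selmer_mul_two_le (h2 : Module.finrank k F = 2) {σ : F ≃ₐ[k] F} (hσ : σ ≠ 1)
    (s : Fˣ) (d : kˣ) (hs : s ^ 2 = unitsEmb k F d) (hsσ : σ s = -s)
    (R : Finset (IdealGroup F)) (hR : ramifiedPrimes σ ⊆ R)
    (Tk : Subgroup (IdealGroup k)) (TF : Subgroup (IdealGroup F))
    (hTk : Tk.map (extMap k F) ≤ squares (IdealGroup F) ⊔ TF)
    (hT : ∀ t ∈ TF, conjMap σ t * t⁻¹ ∈ squares (IdealGroup F) →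
      ∃ u : IdealGroup F, ∃ t' ∈ Tk, t = u ^ 2 * extMap k F t')
    (J : Subgroup kˣ)
    (hJ : ∀ x ∈ selmer TF, ∀ y, unitsEmb k F y = x * Units.map (σ : F →* F) x → y ∈ J)
    (hJ0 : (squares kˣ).relIndex J ≠ 0) (hH0 : (squares kˣ).relIndex (selmer Tk) ≠ 0) :
    (squares Fˣ).relIndex (selmer TF) * 2 ≤
      (squares kˣ).relIndex J * ((squares kˣ).relIndex (selmer Tk) * 2 ^ R.card) := by
  have hσσ (y : F) : σ (σ y) = y := DFunLike.congr_fun (gal_mul_self σ h2) y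
  have hinj : Function.Injective (unitsEmb k F) := unitsEmb_injective
  have hK2 : (unitsEmb k F).range.map (powMonoidHom 2) = (squares kˣ).map (unitsEmb k F) := by
    ext x
    constructor
    · rintro ⟨_, ⟨y, rfl⟩, rfl⟩
      exact ⟨y ^ 2, sq_mem_squares y, map_pow _ _ _⟩
    · rintro ⟨_, ⟨y, rfl⟩, rfl⟩
      exact ⟨_, ⟨y, rfl⟩, (map_pow (unitsEmb k F) y 2).symm⟩
  obtain ⟨hV0, hV1⟩ := relIndex_selmer_comap_le h2 hσ R hR Tk TF hT
  have hle : selmer Tk ≤ (selmer TF).comap (unitsEmb k F) :=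
    Subgroup.map_le_iff_le_comap.mp (selmer_map_le hTk)
  have key := relIndex_squares_mul_two_le (Units.map (σ : F →* F)) (unitsEmb k F).range
    (selmer TF) ((selmer Tk).map (unitsEmb k F)) (J.map (unitsEmb k F))
    (((selmer TF).comap (unitsEmb k F)).map (unitsEmb k F))
    (mem_sup_squares_of_norm_eq_sq h2 hσ) (squares_le_selmer TF)
    (hK2 ▸ Subgroup.map_mono (squares_le_selmer Tk))
    (fun x hx => by
      obtain ⟨y, hy⟩ := mem_unitsEmb_range h2 hσ (x * Units.map (σ : F →* F) x)
        (by simp [hσσ, mul_comm])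
      exact ⟨y, hJ x hx y hy, hy⟩)
    (by rwa [hK2, Subgroup.relIndex_map_map_of_injective _ _ hinj])
    (by rw [Subgroup.map_comap_eq]) (Subgroup.map_mono hle)
    (by rwa [Subgroup.relIndex_map_map_of_injective _ _ hinj])
    (by rwa [hK2, Subgroup.relIndex_map_map_of_injective _ _ hinj])
    (unitsEmb k F d) ⟨d, rfl⟩ (hs ▸ sq_mem_squares s) (by
      rintro ⟨_, ⟨y, rfl⟩, hy⟩
      have hy' : (s : F) ^ 2 = algebraMap k F y ^ 2 := by
        simpa using congrArg Units.val (hs.trans hy.symm)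
      have hfix : σ s = s := by
        rcases sq_eq_sq_iff_eq_or_eq_neg.mp hy' with h | h <;> rw [h]
        · exact σ.commutes _
        · rw [map_neg, σ.commutes]
      have h0 : (2 : F) * s = 0 := by linear_combination hsσ - hfix
      exact mul_ne_zero two_ne_zero s.ne_zero h0)
  rw [hK2, Subgroup.relIndex_map_map_of_injective _ _ hinj,
    Subgroup.relIndex_map_map_of_injective _ _ hinj,
    Subgroup.relIndex_map_map_of_injective _ _ hinj] at key
  exact key.trans (Nat.mul_le_mul_left _ (Nat.mul_le_mul_left _ hV1))

theorem mem_selmer_of_eq_norm (h2 : Module.finrank k F = 2) {σ : F ≃ₐ[k] F} (hσ : σ ≠ 1)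
    {Tk : Subgroup (IdealGroup k)} {TF : Subgroup (IdealGroup F)}
    (hTN : ∀ t ∈ TF, ∃ t' ∈ squares (IdealGroup k) ⊔ Tk, t * conjMap σ t = extMap k F t')
    (x : Fˣ) (hx : x ∈ selmer TF) (y : kˣ)
    (hy : unitsEmb k F y = x * Units.map (σ : F →* F) x) : y ∈ selmer Tk := by
  rw [selmer, Subgroup.mem_comap, Subgroup.mem_sup] at hx
  obtain ⟨_, ⟨A, rfl⟩, t, ht, hAt⟩ := hx
  obtain ⟨t', ht', htt'⟩ := hTN t ht
  obtain ⟨B, hB⟩ := mul_conjMap_mem_range h2 hσ A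
  have h3 : toPrincipalIdeal (𝓞 k) k y = B ^ 2 * t' := by
    apply idealMap_injective (algebraMap k F)
    rw [idealMap_toPrincipalIdeal, map_mul, map_pow]
    change toPrincipalIdeal (𝓞 F) F (unitsEmb k F y) = extMap k F B ^ 2 * extMap k F t'
    have h4 : toPrincipalIdeal (𝓞 F) F (Units.map (σ : F →* F) x) =
        conjMap σ (toPrincipalIdeal (𝓞 F) F x) := (idealMap_toPrincipalIdeal (σ : F →+* F) x).symm
    rw [hy, map_mul, h4, ← hAt, hB, ← htt', map_mul, powMonoidHom_apply, map_pow, mul_pow]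
    exact mul_mul_mul_comm _ _ _ _
  rw [selmer, Subgroup.mem_comap, h3]
  exact mul_mem (Subgroup.mem_sup_left (sq_mem_squares B)) ht'

end QuadraticSelmer

section OddClassNumber

variable {k F : Type*} [Field k] [NumberField k] [Field F] [NumberField F] [Algebra k F]
  [IsGalois k F]

theorem relIndex_squares_selmer_bot (K : Type*) [Field K] [NumberField K] [IsTotallyComplex K]
    {N : ℕ} (hN : Module.finrank ℚ K = 2 * N) :
    (squares Kˣ).relIndex (selmer ⊥) = 2 ^ N * (squares (ClassGroup (𝓞 K))).index := by
  rw [relIndex_squares_selmer ⊥ hN, Subgroup.map_bot, sup_bot_eq, sup_bot_eq,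
    Subgroup.relIndex_self, mul_one]

theorem index_squares_classGroup_mul_le [IsTotallyComplex k]
    (hk : (squares (ClassGroup (𝓞 k))).index = 1)
    (h2 : Module.finrank k F = 2) {σ : F ≃ₐ[k] F} (hσ : σ ≠ 1)
    (s : Fˣ) (d : kˣ) (hs : s ^ 2 = unitsEmb k F d) (hsσ : σ s = -s)
    (R : Finset (IdealGroup F)) (hR : ramifiedPrimes σ ⊆ R) (J : Subgroup kˣ) {m : ℕ}
    (hJm : (squares kˣ).relIndex J * m ≤ (squares kˣ).relIndex (selmer ⊥))
    (hJ0 : (squares kˣ).relIndex J ≠ 0)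
    (hJ : ∀ x ∈ selmer (⊥ : Subgroup (IdealGroup F)), ∀ y,
      unitsEmb k F y = x * Units.map (σ : F →* F) x → y ∈ J) :
    (squares (ClassGroup (𝓞 F))).index * 2 * m ≤ 2 ^ R.card := by
  have : IsTotallyComplex F := isTotallyComplex_of_algebra k F
  have hN := rank_add_one k
  set N := Units.rank k + 1
  have hNF : Module.finrank ℚ F = 2 * (2 * N) := by
    rw [← Module.finrank_mul_finrank ℚ k F, h2, ← hN, mul_comm]
  have h1 := relIndex_squares_selmer_bot k hN.symm
  rw [hk, mul_one] at h1
  have key := relIndex_selmer_mul_two_le h2 hσ s d hs hsσ R hR ⊥ ⊥ (by simp)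
    (fun t ht _ => ⟨1, 1, one_mem _, by simpa using ht⟩) J hJ hJ0 (by rw [h1]; positivity)
  rw [relIndex_squares_selmer_bot F hNF, h1] at key
  rw [h1] at hJm
  have hpos : 0 < 2 ^ N * 2 ^ N := by positivity
  refine Nat.le_of_mul_le_mul_left ?_ hpos
  calc 2 ^ N * 2 ^ N * ((squares (ClassGroup (𝓞 F))).index * 2 * m)
      = (2 ^ (2 * N) * (squares (ClassGroup (𝓞 F))).index * 2) * m := by ring
    _ ≤ _ := Nat.mul_le_mul_right m key
    _ = ((squares kˣ).relIndex J * m) * (2 ^ N * 2 ^ R.card) := by ring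
    _ ≤ 2 ^ N * (2 ^ N * 2 ^ R.card) := Nat.mul_le_mul_right _ hJm
    _ = _ := by ring

theorem index_squares_classGroup_mul_two_le [IsTotallyComplex k]
    (hk : (squares (ClassGroup (𝓞 k))).index = 1)
    (h2 : Module.finrank k F = 2) {σ : F ≃ₐ[k] F} (hσ : σ ≠ 1)
    (s : Fˣ) (d : kˣ) (hs : s ^ 2 = unitsEmb k F d) (hsσ : σ s = -s)
    (R : Finset (IdealGroup F)) (hR : ramifiedPrimes σ ⊆ R) :
    (squares (ClassGroup (𝓞 F))).index * 2 ≤ 2 ^ R.card := by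
  have h1 := relIndex_squares_selmer_bot k (rank_add_one k).symm
  have := index_squares_classGroup_mul_le hk h2 hσ s d hs hsσ R hR (selmer ⊥) (m := 1)
    (mul_one _).le (by rw [h1, hk]; positivity)
    (mem_selmer_of_eq_norm h2 hσ fun t ht => ⟨1, one_mem _, by
      rw [Subgroup.mem_bot.mp ht, map_one, map_one, mul_one]⟩)
  rwa [mul_one] at this

end OddClassNumber

section Weber

theorem isPrincipalIdealRing_of_isCyclotomicExtension_four (K : Type*) [Field K] [NumberField K]
    [hK : IsCyclotomicExtension {4} ℚ K] : IsPrincipalIdealRing (𝓞 K) := by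
  have hK' : IsCyclotomicExtension {2 ^ (1 + 1)} ℚ K := hK
  have h4 : Nat.totient 4 = 2 := by decide
  apply RingOfIntegers.isPrincipalIdealRing_of_abs_discr_lt
  rw [IsCyclotomicExtension.Rat.discr_prime_pow_succ 2 1 K,
    IsCyclotomicExtension.finrank (n := 4) K (Polynomial.cyclotomic.irreducible_rat (by simp)),
    IsCyclotomicExtension.Rat.nrComplexPlaces_eq_totient_div_two 4, h4]
  norm_num [Nat.factorial]
  have := Real.pi_gt_three
  nlinarith

theorem squares_classGroup_index_of_isPrincipalIdealRing (K : Type*) [Field K] [NumberField K]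
    [IsPrincipalIdealRing (𝓞 K)] : (squares (ClassGroup (𝓞 K))).index = 1 := by
  refine Subgroup.index_eq_one.mpr (eq_top_iff.mpr fun c _ => ?_)
  obtain ⟨I, rfl⟩ := ClassGroup.mk0_surjective c
  rw [(ClassGroup.mk0_eq_one_iff I.2).mpr (IsPrincipalIdealRing.principal _)]
  exact one_mem _

theorem liesOver_span_of_mem {K : Type*} [Field K] [NumberField K] {ℓ : ℕ} (hℓ : ℓ.Prime)
    (P : Ideal (𝓞 K)) [hP : P.IsPrime] (h : (ℓ : 𝓞 K) ∈ P) :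
    P.LiesOver (Ideal.span {(ℓ : ℤ)}) := by
  have hmax : (Ideal.span {(ℓ : ℤ)}).IsMaximal :=
    PrincipalIdealRing.isMaximal_of_irreducible (Nat.prime_iff_prime_int.mp hℓ).irreducible
  refine ⟨hmax.eq_of_le (Ideal.comap_ne_top _ hP.ne_top) ?_⟩
  rw [Ideal.span_singleton_le_iff_mem, Ideal.mem_comap]
  simpa using h

theorem squares_classGroup_index_cyclotomic (n : ℕ) : ∀ (K : Type*) [Field K] [NumberField K]
    [IsCyclotomicExtension {2 ^ (n + 2)} ℚ K], (squares (ClassGroup (𝓞 K))).index = 1 := by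
  induction n with
  | zero =>
    intro K _ _ hK
    have hK' : IsCyclotomicExtension {4} ℚ K := hK
    have := isPrincipalIdealRing_of_isCyclotomicExtension_four K
    exact squares_classGroup_index_of_isPrincipalIdealRing K
  | succ n ih =>
    intro F _ _ hF
    obtain ⟨ζ, hζ⟩ := hF.exists_isPrimitiveRoot rfl (by positivity)
    have hζ2 : IsPrimitiveRoot (ζ ^ 2) (2 ^ (n + 2)) := hζ.pow (by positivity) (by ring)
    let k := IntermediateField.adjoin ℚ {ζ ^ 2}
    have hk : IsCyclotomicExtension {2 ^ (n + 2)} ℚ k :=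
      hζ2.intermediateField_adjoin_isCyclotomicExtension ℚ
    have : IsGalois ℚ F := IsCyclotomicExtension.isGalois {2 ^ (n + 1 + 2)} ℚ F
    have : IsTotallyComplex k := IsCyclotomicExtension.Rat.isTotallyComplex (n := 2 ^ (n + 2)) k
      ((by norm_num : 2 < 2 ^ 2).trans_le (Nat.pow_le_pow_right two_pos (by omega)))
    have h2 : Module.finrank k F = 2 := by
      have h3 := Module.finrank_mul_finrank ℚ k F
      rw [IsCyclotomicExtension.finrank (n := 2 ^ (n + 2)) k
          (Polynomial.cyclotomic.irreducible_rat (by positivity)),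
        IsCyclotomicExtension.finrank (n := 2 ^ (n + 1 + 2)) F
          (Polynomial.cyclotomic.irreducible_rat (by positivity)),
        Nat.totient_prime_pow_succ Nat.prime_two, show n + 1 + 2 = (n + 2) + 1 by ring,
        Nat.totient_prime_pow_succ Nat.prime_two, pow_succ 2 (n + 1)] at h3
      have h4 : 0 < 2 ^ (n + 1) := by positivity
      refine Nat.eq_of_mul_eq_mul_left h4 ?_
      linarith
    obtain ⟨σ, hσ⟩ : ∃ σ : F ≃ₐ[k] F, σ ≠ 1 := by
      have : 1 < Nat.card (F ≃ₐ[k] F) := by rw [card_gal_eq_two h2]; norm_num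
      have := Finite.one_lt_card_iff_nontrivial.mp this
      exact exists_ne 1
    have hsq : σ (ζ ^ 2) = ζ ^ 2 :=
      σ.commutes (IntermediateField.AdjoinSimple.gen ℚ (ζ ^ 2))
    have hσζ : σ ζ = -ζ := by
      rw [map_pow] at hsq
      refine (sq_eq_sq_iff_eq_or_eq_neg.mp hsq).resolve_left fun h => hσ ?_
      have h5 := (hζ.powerBasis ℚ).algHom_ext (f := (σ.restrictScalars ℚ : F →ₐ[ℚ] F))
        (g := AlgHom.id ℚ F) (by simpa using h)
      ext x
      exact DFunLike.congr_fun h5 x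
    have hP (P : (Ideal (𝓞 F))⁰) (hP : (P : Ideal (𝓞 F)).IsPrime)
        (hPσ : ∀ x, RingOfIntegers.mapRingHom (σ : F →+* F) x - x ∈ (P : Ideal (𝓞 F))) :
        (P : Ideal (𝓞 F)) = Ideal.span {hζ.toInteger - 1} := by
      have h6 : (2 : 𝓞 F) ∈ (P : Ideal (𝓞 F)) := by
        have h7 : RingOfIntegers.mapRingHom (σ : F →+* F) hζ.toInteger - hζ.toInteger =
            -2 * hζ.toInteger := by
          apply RingOfIntegers.ext
          change σ ζ - ζ = _
          rw [hσζ]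
          simp only [map_mul, map_neg, map_ofNat]
          change _ = -2 * ζ
          ring
        have h8 := hPσ hζ.toInteger
        rw [h7] at h8
        have h9 := P.1.mul_mem_right (-(hζ.toInteger ^ (2 ^ (n + 1 + 2) - 1))) h8
        have h10 : hζ.toInteger * hζ.toInteger ^ (2 ^ (n + 1 + 2) - 1) = 1 := by
          rw [← pow_succ', Nat.sub_add_cancel Nat.one_le_two_pow]
          exact hζ.toInteger_isPrimitiveRoot.pow_eq_one
        rwa [neg_mul, neg_mul_neg, mul_assoc, h10, mul_one] at h9
      have : (P : Ideal (𝓞 F)).LiesOver (Ideal.span {((2 : ℕ) : ℤ)}) :=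
        liesOver_span_of_mem Nat.prime_two P.1 (by exact_mod_cast h6)
      exact IsCyclotomicExtension.Rat.eq_span_zeta_sub_one_of_liesOver 2 (n + 2) F hζ P
    have hR : (ramifiedPrimes σ).Subsingleton := by
      rintro _ ⟨P, hP1, hP2, rfl⟩ _ ⟨Q, hQ1, hQ2, rfl⟩
      rw [Subtype.ext ((hP P hP1 hP2).trans (hP Q hQ1 hQ2).symm)]
    have hfin := hR.finite
    have hc : hfin.toFinset.card ≤ 1 := Finset.card_le_one.mpr fun a ha b hb =>
      hR (hfin.mem_toFinset.mp ha) (hfin.mem_toFinset.mp hb)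
    have key := index_squares_classGroup_mul_two_le (ih k) h2 hσ
      (Units.mk0 ζ (hζ.ne_zero (by positivity)))
      (Units.mk0 (IntermediateField.AdjoinSimple.gen ℚ (ζ ^ 2)) fun h =>
        pow_ne_zero 2 (hζ.ne_zero (by positivity)) (congrArg (algebraMap k F) h))
      (Units.ext rfl) hσζ hfin.toFinset (by simp)
    have h0 : (squares (ClassGroup (𝓞 F))).index ≠ 0 := Subgroup.index_ne_zero_of_finite
    have := Nat.pow_le_pow_right two_pos hc
    omega

end Weber

section CyclotomicFrobenius

variable {m : ℕ} [NeZero m] {K : Type*} [Field K] [NumberField K] [IsCyclotomicExtension {m} ℚ K]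

theorem frobenius_pow_sub_mem {ζ : K} (hζ : IsPrimitiveRoot ζ m) {ℓ f : ℕ} [hℓ : Fact ℓ.Prime]
    (h : ℓ ^ f ≡ 1 [MOD m]) (x : 𝓞 K) : x ^ ℓ ^ f - x ∈ Ideal.span {(ℓ : 𝓞 K)} := by
  have : CharP (𝓞 K ⧸ Ideal.span {(ℓ : 𝓞 K)}) ℓ := by
    refine CharP.quotient _ ℓ fun hu => hℓ.out.ne_one ?_
    rw [← map_natCast (algebraMap ℤ (𝓞 K)), isUnit_map_iff] at hu
    exact Nat.isUnit_iff.mp (Int.ofNat_isUnit.mp (by exact_mod_cast hu))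
  have hroot : hζ.toInteger ^ ℓ ^ f = hζ.toInteger := by
    have ho := hζ.toInteger_isPrimitiveRoot.eq_orderOf.symm
    conv_rhs => rw [← pow_one hζ.toInteger]
    rw [← pow_mod_orderOf, ← pow_mod_orderOf _ 1, ho, h]
  have hx : x ∈ Algebra.adjoin ℤ {hζ.toInteger} := by
    rw [IsCyclotomicExtension.Rat.adjoin_singleton_eq_top hζ]
    trivial
  rw [← Ideal.Quotient.mk_eq_mk_iff_sub_mem, map_pow, ← iterateFrobenius_def]
  induction hx using Algebra.adjoin_induction with
  | mem x hx =>
    rw [Set.mem_singleton_iff.mp hx, iterateFrobenius_def, ← map_pow, hroot]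
  | algebraMap r => simp
  | add x y _ _ hx hy => rw [map_add, map_add, hx, hy]
  | mul x y _ _ hx hy => rw [map_mul, map_mul, hx, hy]

theorem mem_span_of_sq_mem_span {ζ : K} (hζ : IsPrimitiveRoot ζ m) {ℓ : ℕ} [hℓ : Fact ℓ.Prime]
    (h : ℓ.Coprime m) {x : 𝓞 K} (hx : x ^ 2 ∈ Ideal.span {(ℓ : 𝓞 K)}) :
    x ∈ Ideal.span {(ℓ : 𝓞 K)} := by
  have h1 := frobenius_pow_sub_mem hζ (Nat.ModEq.pow_totient h) x
  refine (Submodule.sub_mem_iff_right _ ?_).mp h1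
  have h2 : 2 ≤ ℓ ^ Nat.totient m := hℓ.out.two_le.trans
    (Nat.le_self_pow (Nat.totient_pos.mpr (NeZero.pos m)).ne' _)
  exact Ideal.mem_of_dvd _ (pow_dvd_pow x h2) hx

theorem ncard_primesOver_cyclotomic (ℓ : ℕ) [Fact ℓ.Prime] (h : ¬ ℓ ∣ m) :
    ((Ideal.span {(ℓ : ℤ)}).primesOver (𝓞 K)).ncard * orderOf (ℓ : ZMod m) = m.totient := by
  have : IsGalois ℚ K := IsCyclotomicExtension.isGalois {m} ℚ K
  have h1 := Ideal.ncard_primesOver_mul_ramificationIdxIn_mul_inertiaDegIn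
    (Ideal.span {(ℓ : ℤ)}) (𝓞 K) Gal(K/ℚ)
  rwa [IsCyclotomicExtension.Rat.ramificationIdxIn_eq_of_not_dvd ℓ K h,
    IsCyclotomicExtension.Rat.inertiaDegIn_eq_of_not_dvd ℓ K h, one_mul,
    IsGalois.card_aut_eq_finrank, IsCyclotomicExtension.finrank (n := m) K
      (Polynomial.cyclotomic.irreducible_rat (NeZero.pos m))] at h1

end CyclotomicFrobenius

section PowModTwoPow

theorem pow_two_pow_mod {p : ℕ} (hp : p % 16 = 9) (j : ℕ) :
    p ^ 2 ^ j % 2 ^ (j + 4) = 2 ^ (j + 3) + 1 := by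
  induction j with
  | zero => simpa using hp
  | succ j ih =>
    have h := Nat.div_add_mod (p ^ 2 ^ j) (2 ^ (j + 4))
    rw [ih] at h
    set a := p ^ 2 ^ j / 2 ^ (j + 4)
    have h1 : p ^ 2 ^ (j + 1) =
        2 ^ (j + 1 + 4) * (2 ^ (j + 3) * a ^ 2 + a * (2 ^ (j + 3) + 1) + 2 ^ (j + 1)) +
        (2 ^ (j + 1 + 3) + 1) := by
      rw [pow_succ 2 j, pow_mul, ← h]
      ring
    rw [h1, Nat.mul_add_mod]
    exact Nat.mod_eq_of_lt (by
      rw [pow_succ 2 (j + 1 + 3)]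
      have := Nat.one_lt_two_pow (n := j + 1 + 3) (by omega)
      omega)

theorem pow_two_pow_modEq_one {p : ℕ} (hp : p % 16 = 9) (j : ℕ) :
    p ^ 2 ^ j ≡ 1 [MOD 2 ^ (j + 3)] := by
  have h := pow_two_pow_mod hp j
  have h1 : p ^ 2 ^ j ≡ 2 ^ (j + 3) + 1 [MOD 2 ^ (j + 3)] := by
    have h2 : p ^ 2 ^ j ≡ 2 ^ (j + 3) + 1 [MOD 2 ^ (j + 4)] := h ▸ (Nat.mod_modEq _ _).symm
    exact h2.of_dvd (pow_dvd_pow 2 (by omega))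
  simpa [Nat.ModEq] using h1

theorem not_pow_two_pow_modEq_one {p : ℕ} (hp : p % 16 = 9) (j : ℕ) :
    ¬ p ^ 2 ^ j ≡ 1 [MOD 2 ^ (j + 4)] := by
  intro h
  have h1 := pow_two_pow_mod hp j
  rw [h, Nat.mod_eq_of_lt (Nat.one_lt_two_pow (by omega))] at h1
  have := Nat.two_pow_pos (j + 3)
  omega

theorem orderOf_natCast_zmod {p : ℕ} (hp : p % 16 = 9) (j : ℕ) :
    orderOf (p : ZMod (2 ^ (j + 3))) = 2 ^ j := by
  have h1 (i k : ℕ) : (p : ZMod (2 ^ (k + 3))) ^ 2 ^ i = 1 ↔ p ^ 2 ^ i ≡ 1 [MOD 2 ^ (k + 3)] := by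
    rw [← ZMod.natCast_eq_natCast_iff]
    push_cast
    rfl
  cases j with
  | zero =>
    rw [pow_zero, orderOf_eq_one_iff]
    simpa using (h1 0 0).mpr (pow_two_pow_modEq_one hp 0)
  | succ j =>
    exact orderOf_eq_prime_pow ((h1 j (j + 1)).not.mpr (not_pow_two_pow_modEq_one hp j))
      ((h1 (j + 1) (j + 1)).mpr (pow_two_pow_modEq_one hp (j + 1)))

theorem ncard_primesOver_eq_four {p : ℕ} [Fact p.Prime] (hp : p % 16 = 9) (j : ℕ)
    (K : Type*) [Field K] [NumberField K] [IsCyclotomicExtension {2 ^ (j + 3)} ℚ K] :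
    ((Ideal.span {(p : ℤ)}).primesOver (𝓞 K)).ncard = 4 := by
  have h := ncard_primesOver_cyclotomic (K := K) (m := 2 ^ (j + 3)) p fun hd => by
    have := (Nat.prime_dvd_prime_iff_eq Fact.out Nat.prime_two).mp
      ((Fact.out : p.Prime).dvd_of_dvd_pow hd)
    omega
  rw [orderOf_natCast_zmod hp, Nat.totient_prime_pow_succ Nat.prime_two] at h
  have h2 : 0 < 2 ^ j := by positivity
  refine Nat.eq_of_mul_eq_mul_right h2 (h.trans ?_)
  rw [pow_add]
  ring

end PowModTwoPow

section QuadraticGenerator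

variable {k F : Type*} [Field k] [NumberField k] [Field F] [NumberField F] [Algebra k F]

theorem finrank_eq_two_of_sq {x : F} {d : k} (hx : x ^ 2 = algebraMap k F d) (hd : ¬ IsSquare d)
    (htop : IntermediateField.adjoin k {x} = ⊤) : Module.finrank k F = 2 := by
  have hirr : Irreducible (Polynomial.X ^ 2 - Polynomial.C d) :=
    X_pow_sub_C_irreducible_of_prime Nat.prime_two fun b hb => hd ⟨b, by rw [← hb, sq]⟩
  have hmin : Polynomial.X ^ 2 - Polynomial.C d = minpoly k x :=
    minpoly.eq_of_irreducible_of_monic hirr (by simp [hx])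
      (Polynomial.monic_X_pow_sub_C d two_ne_zero)
  have h1 := IntermediateField.adjoin.finrank (Algebra.IsIntegral.isIntegral (R := k) x)
  rw [htop, IntermediateField.finrank_top', ← hmin, Polynomial.natDegree_X_pow_sub_C] at h1
  exact h1

theorem isGalois_of_finrank_eq_two (h : Module.finrank k F = 2) : IsGalois k F := by
  have : Algebra.IsQuadraticExtension k F := ⟨h⟩
  infer_instance

theorem exists_conj_of_sq [IsGalois k F] (h2 : Module.finrank k F = 2) {x : F} {d : k}
    (hx : x ^ 2 = algebraMap k F d) (hd : ¬ IsSquare d) :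
    ∃ σ : F ≃ₐ[k] F, σ ≠ 1 ∧ σ x = -x := by
  obtain ⟨σ, hσ⟩ : ∃ σ : F ≃ₐ[k] F, σ ≠ 1 := by
    have : 1 < Nat.card (F ≃ₐ[k] F) := by rw [card_gal_eq_two h2]; norm_num
    have := Finite.one_lt_card_iff_nontrivial.mp this
    exact exists_ne 1
  refine ⟨σ, hσ, ?_⟩
  have h1 : σ x ^ 2 = x ^ 2 := by rw [← map_pow, hx, σ.commutes]
  refine (sq_eq_sq_iff_eq_or_eq_neg.mp h1).resolve_left fun h => hd ?_
  obtain ⟨y, rfl⟩ := (IsGalois.mem_range_algebraMap_iff_fixed (F := k) x).mpr fun τ => by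
    rcases gal_eq_one_or_eq h2 hσ τ with rfl | rfl
    · rfl
    · exact h
  exact ⟨y, (algebraMap k F).injective (by rw [← hx, sq, map_mul])⟩

theorem exists_algebraMap_eq_of_fixed [IsGalois k F] (h2 : Module.finrank k F = 2)
    {σ : F ≃ₐ[k] F} (hσ : σ ≠ 1) (x : 𝓞 F)
    (hx : RingOfIntegers.mapRingHom (σ : F →+* F) x = x) :
    ∃ y : 𝓞 k, algebraMap (𝓞 k) (𝓞 F) y = x := by
  have hx' : σ x = x := congrArg (algebraMap (𝓞 F) F) hx
  obtain ⟨y, hy⟩ := (IsGalois.mem_range_algebraMap_iff_fixed (F := k) (x : F)).mpr fun τ => by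
    rcases gal_eq_one_or_eq h2 hσ τ with rfl | rfl
    · rfl
    · exact hx'
  have hint : IsIntegral ℤ y := by
    rw [← isIntegral_algebraMap_iff (algebraMap k F).injective, hy]
    exact x.isIntegral_coe
  exact ⟨⟨y, hint⟩, RingOfIntegers.ext hy⟩

end QuadraticGenerator

theorem charP_of_prime_of_natCast_eq_zero {R : Type*} [Ring R] [Nontrivial R] {ℓ : ℕ}
    (hℓ : ℓ.Prime) (h : (ℓ : R) = 0) : CharP R ℓ := by
  obtain ⟨c, hc⟩ := CharP.exists R
  rcases (Nat.dvd_prime hℓ).mp ((CharP.cast_eq_zero_iff R c ℓ).mp h) with rfl | rfl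
  · exact absurd rfl (CharP.char_ne_one R 1)
  · exact hc

section QuadraticOverCyclotomic

variable {K L : Type*} [Field K] [NumberField K] [Field L] [NumberField L] [Algebra K L]
  [IsGalois K L]

/-- An automorphism acting on the ring of integers. -/
abbrev conjInt (σ : L ≃ₐ[K] L) : 𝓞 L →+* 𝓞 L := RingOfIntegers.mapRingHom (σ : L →+* L)

theorem conjInt_conjInt (h2 : Module.finrank K L = 2) (σ : L ≃ₐ[K] L) (x : 𝓞 L) :
    conjInt σ (conjInt σ x) = x :=
  RingOfIntegers.ext (DFunLike.congr_fun (gal_mul_self σ h2) (x : L))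

variable {m : ℕ} [NeZero m] [IsCyclotomicExtension {m} ℚ K] {ζ : K} {p : ℕ} [hp : Fact p.Prime]
  {σ : L ≃ₐ[K] L} {S : 𝓞 L}

theorem exists_trace_and_difference (h2 : Module.finrank K L = 2) (hσ : σ ≠ 1)
    (hζ : IsPrimitiveRoot ζ m) (hpm : p.Coprime m) (hS : S ^ 2 = p) (hcS : conjInt σ S = -S)
    (x : 𝓞 L) : ∃ u v : 𝓞 K, x + conjInt σ x = algebraMap (𝓞 K) (𝓞 L) u ∧
      x - conjInt σ x = S * algebraMap (𝓞 K) (𝓞 L) v := by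
  have hcc := conjInt_conjInt h2 σ x
  obtain ⟨u, hu⟩ := exists_algebraMap_eq_of_fixed h2 hσ (x + conjInt σ x) (by
    rw [map_add, hcc, add_comm])
  obtain ⟨w, hw⟩ := exists_algebraMap_eq_of_fixed h2 hσ (S * (x - conjInt σ x)) (by
    rw [map_mul, map_sub, hcc, hcS]; ring)
  obtain ⟨t, ht⟩ := exists_algebraMap_eq_of_fixed h2 hσ ((x - conjInt σ x) ^ 2) (by
    rw [map_pow, map_sub, hcc]; ring)
  have hinj : Function.Injective (algebraMap (𝓞 K) (𝓞 L)) := FaithfulSMul.algebraMap_injective _ _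
  have hw2 : w ^ 2 = p * t := hinj (by
    rw [map_pow, map_mul, hw, ht, map_natCast, mul_pow, hS])
  obtain ⟨v, hv⟩ := Ideal.mem_span_singleton.mp
    (mem_span_of_sq_mem_span hζ hpm
      (hw2 ▸ Ideal.mul_mem_right _ _ (Ideal.mem_span_singleton_self _)))
  have hS0 : S ≠ 0 := by
    rintro rfl
    rw [zero_pow two_ne_zero] at hS
    exact hp.out.ne_zero (by exact_mod_cast hS.symm)
  refine ⟨u, v, hu.symm, mul_left_cancel₀ hS0 ?_⟩
  rw [← hw, hv, map_mul, map_natCast, ← hS]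
  ring

theorem exists_two_mul_sub_mem (h2 : Module.finrank K L = 2) (hσ : σ ≠ 1)
    (hζ : IsPrimitiveRoot ζ m) (hpm : p.Coprime m) (hS : S ^ 2 = p) (hcS : conjInt σ S = -S)
    {P : Ideal (𝓞 L)} (hSP : S ∈ P) (x : 𝓞 L) :
    ∃ u : 𝓞 K, 2 * x - algebraMap (𝓞 K) (𝓞 L) u ∈ P := by
  obtain ⟨u, v, hu, hv⟩ := exists_trace_and_difference h2 hσ hζ hpm hS hcS x
  refine ⟨u, ?_⟩
  have : 2 * x - algebraMap (𝓞 K) (𝓞 L) u = S * algebraMap (𝓞 K) (𝓞 L) v := by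
    rw [← hu, ← hv]; ring
  rw [this]
  exact P.mul_mem_right _ hSP

omit [IsGalois K L] [NumberField K] hp in
theorem mem_of_isRamified (hp4 : p % 4 = 1) (hS : S ^ 2 = p) (hcS : conjInt σ S = -S)
    {P : Ideal (𝓞 L)} (hP : ∀ x, conjInt σ x - x ∈ P) : S ∈ P := by
  have hr : IsIntegral ℤ ((1 + (S : L)) / 2) := by
    have hS' : (S : L) ^ 2 = p := by exact_mod_cast congrArg (algebraMap (𝓞 L) L) hS
    have h4 : (p : L) = 4 * ((p / 4 : ℕ) : L) + 1 := by
      have : p = 4 * (p / 4) + 1 := by omega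
      exact_mod_cast this
    refine ⟨Polynomial.X ^ 2 - Polynomial.X - Polynomial.C ((p / 4 : ℕ) : ℤ), by monicity!, ?_⟩
    have hC : Polynomial.eval₂ (algebraMap ℤ L) ((1 + (S : L)) / 2)
        (Polynomial.C ((p / 4 : ℕ) : ℤ)) = ((p / 4 : ℕ) : L) := by
      rw [Polynomial.eval₂_C, map_natCast]
    rw [Polynomial.eval₂_sub, Polynomial.eval₂_sub, Polynomial.eval₂_pow, Polynomial.eval₂_X, hC]
    linear_combination (1 / 4 : L) * hS' + (1 / 4 : L) * h4
  let r : 𝓞 L := ⟨_, hr⟩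
  have h : conjInt σ r - r = -S := by
    apply RingOfIntegers.ext
    have h1 : σ (S : L) = -S := congrArg (algebraMap (𝓞 L) L) hcS
    have h3 : (conjInt σ r : L) = (1 - (S : L)) / 2 := by
      change σ ((1 + (S : L)) / 2) = _
      rw [map_div₀, map_add, map_one, map_ofNat, h1, sub_eq_add_neg]
    have h4 : ((conjInt σ r - r : 𝓞 L) : L) = conjInt σ r - r := rfl
    rw [h4, h3]
    change _ - (1 + (S : L)) / 2 = -(S : L)
    ring
  simpa [h] using hP r

omit [NumberField L] hp in
theorem natCast_notMem_of_coprime {P : Ideal (𝓞 L)} [P.IsPrime] (hpP : (p : 𝓞 L) ∈ P) {a : ℕ}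
    (ha : a.Coprime p) : (a : 𝓞 L) ∉ P := by
  intro h
  refine Ideal.IsPrime.ne_top' (I := P) ((Ideal.eq_top_iff_one _).mpr ?_)
  have h1 : ((Nat.gcd a p : ℤ) : 𝓞 L) = 1 := by rw [ha]; simp
  rw [← h1, Nat.gcd_eq_gcd_ab]
  push_cast
  exact P.add_mem (P.mul_mem_right _ h) (P.mul_mem_right _ hpP)

theorem exists_finset_ramifiedPrimes {j : ℕ} [IsCyclotomicExtension {2 ^ (j + 3)} ℚ K]
    (h2 : Module.finrank K L = 2) (hσ : σ ≠ 1) (hp16 : p % 16 = 9)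
    (hζ : IsPrimitiveRoot ζ (2 ^ (j + 3))) (hS : S ^ 2 = p) (hcS : conjInt σ S = -S) :
    ∃ R : Finset (IdealGroup L), ramifiedPrimes σ ⊆ R ∧ R.card ≤ 4 := by
  have hp2 : Nat.Coprime 2 p := (Nat.coprime_primes Nat.prime_two hp.out).mpr (by omega)
  have hpm : p.Coprime (2 ^ (j + 3)) := (hp2.pow_left _).symm
  set X : Set (Ideal (𝓞 L)) := {P | P.IsPrime ∧ S ∈ P} with hX
  have hmem {P : Ideal (𝓞 L)} (hSP : S ∈ P) : (p : 𝓞 L) ∈ P := by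
    rw [← hS]; exact P.pow_mem_of_mem hSP 2 two_pos
  have hmaps : Set.MapsTo (fun P : Ideal (𝓞 L) => P.under (𝓞 K)) X
      ((Ideal.span {(p : ℤ)}).primesOver (𝓞 K)) := by
    rintro P ⟨hP, hSP⟩
    have hP' : (P.under (𝓞 K)).IsPrime := inferInstance
    refine ⟨hP', liesOver_span_of_mem hp.out _ ?_⟩
    rw [Ideal.mem_under, map_natCast]
    exact hmem hSP
  have hinj : Set.InjOn (fun P : Ideal (𝓞 L) => P.under (𝓞 K)) X := by
    have key {P Q : Ideal (𝓞 L)} (hP : P ∈ X) (hQ : Q ∈ X) (h : P.under (𝓞 K) = Q.under (𝓞 K)) :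
        P ≤ Q := by
      intro x hx
      obtain ⟨u, v, hu, hv⟩ := exists_trace_and_difference h2 hσ hζ hpm hS hcS x
      have h2x : 2 * x = algebraMap (𝓞 K) (𝓞 L) u + S * algebraMap (𝓞 K) (𝓞 L) v := by
        rw [← hu, ← hv]; ring
      have huP : u ∈ P.under (𝓞 K) := by
        rw [Ideal.mem_under]
        have := P.sub_mem (P.mul_mem_left 2 hx)
          (P.mul_mem_right (algebraMap (𝓞 K) (𝓞 L) v) hP.2)
        rwa [h2x, add_sub_cancel_right] at this
      rw [h, Ideal.mem_under] at huP
      have := Q.add_mem huP (Q.mul_mem_right (algebraMap (𝓞 K) (𝓞 L) v) hQ.2)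
      rw [← h2x] at this
      have hQp := hQ.1
      refine (hQp.mem_or_mem this).resolve_left ?_
      exact_mod_cast natCast_notMem_of_coprime (hmem hQ.2) hp2
    exact fun P hP Q hQ h => le_antisymm (key hP hQ h) (key hQ hP h.symm)
  have h4 := ncard_primesOver_eq_four hp16 j K
  have hfin := Set.finite_of_ncard_ne_zero (h4.trans_ne four_ne_zero)
  have hXfin : X.Finite := Set.Finite.of_injOn hmaps hinj hfin
  have hXcard : X.ncard ≤ 4 := h4 ▸ Set.ncard_le_ncard_of_injOn _ hmaps hinj hfin
  classical
  let f : Ideal (𝓞 L) → IdealGroup L := fun P =>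
    if h : P ∈ (Ideal (𝓞 L))⁰ then FractionalIdeal.mk0 L ⟨P, h⟩ else 1
  refine ⟨hXfin.toFinset.image f, ?_, Finset.card_image_le.trans ?_⟩
  · rintro _ ⟨P, hP, hram, rfl⟩
    refine Finset.mem_coe.mpr (Finset.mem_image.mpr ⟨P, ?_, ?_⟩)
    · rw [Set.Finite.mem_toFinset]
      exact ⟨hP, mem_of_isRamified (by omega) hS hcS hram⟩
    · rw [show f P = _ from dif_pos P.2]
  · rwa [← Set.ncard_eq_toFinset_card X hXfin]

end QuadraticOverCyclotomic

section NormResidue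

variable {K L : Type*} [Field K] [NumberField K] [Field L] [NumberField L] [Algebra K L]
  [IsGalois K L] {ζ : K} {p : ℕ} [hp : Fact p.Prime] {σ : L ≃ₐ[K] L} {S : 𝓞 L}

theorem pow_sub_self_mem {m : ℕ} [NeZero m] [IsCyclotomicExtension {m} ℚ K]
    (h2 : Module.finrank K L = 2) (hσ : σ ≠ 1)
    (hζ : IsPrimitiveRoot ζ m) (hp2 : Nat.Coprime 2 p) (hpm : p.Coprime m)
    (hS : S ^ 2 = p) (hcS : conjInt σ S = -S)
    {P : Ideal (𝓞 L)} [P.IsPrime] (hSP : S ∈ P) {f : ℕ} (hf : p ^ f ≡ 1 [MOD m]) (x : 𝓞 L) :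
    x ^ p ^ f - x ∈ P := by
  have hpP : (p : 𝓞 L) ∈ P := hS ▸ P.pow_mem_of_mem hSP 2 two_pos
  have : CharP (𝓞 L ⧸ P) p := by
    refine charP_of_prime_of_natCast_eq_zero hp.out ?_
    rwa [← map_natCast (Ideal.Quotient.mk P), Ideal.Quotient.eq_zero_iff_mem]
  obtain ⟨u, hu⟩ := exists_two_mul_sub_mem h2 hσ hζ hpm hS hcS hSP x
  have hu1 : (algebraMap (𝓞 K) (𝓞 L) u) ^ p ^ f - algebraMap (𝓞 K) (𝓞 L) u ∈ P := by
    obtain ⟨w, hw⟩ := Ideal.mem_span_singleton.mp (frobenius_pow_sub_mem hζ hf u)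
    rw [← map_pow, ← map_sub, hw, map_mul, map_natCast]
    exact P.mul_mem_right _ hpP
  rw [← Ideal.Quotient.mk_eq_mk_iff_sub_mem] at hu hu1 ⊢
  have h20 : (2 : 𝓞 L ⧸ P) ≠ 0 := by
    have := natCast_notMem_of_coprime hpP hp2
    rwa [← Ideal.Quotient.eq_zero_iff_mem, map_natCast, Nat.cast_ofNat] at this
  have h2f : (2 : 𝓞 L ⧸ P) ^ p ^ f = 2 := by
    rw [← iterateFrobenius_def, map_ofNat]
  rw [map_pow, ← hu, map_mul, map_ofNat, mul_pow, h2f] at hu1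
  rw [map_pow]
  exact mul_left_cancel₀ h20 hu1

theorem mul_conj_ne_zeta {j : ℕ} [IsCyclotomicExtension {2 ^ (j + 3)} ℚ K]
    (h2 : Module.finrank K L = 2) (hσ : σ ≠ 1) (hp16 : p % 16 = 9)
    (hζ : IsPrimitiveRoot ζ (2 ^ (j + 3))) (hS : S ^ 2 = p) (hcS : conjInt σ S = -S) (x : L) :
    x * σ x ≠ algebraMap K L ζ := by
  intro hx
  have hp2 : Nat.Coprime 2 p := (Nat.coprime_primes Nat.prime_two hp.out).mpr (by omega)
  have hpm : p.Coprime (2 ^ (j + 3)) := (hp2.pow_left _).symm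
  have hSu : ¬ IsUnit S := by
    intro h
    have h1 : IsUnit ((p : ℤ) : 𝓞 L) := by rw [Int.cast_natCast, ← hS]; exact h.pow 2
    have h3 := (isUnit_map_iff (algebraMap ℤ (𝓞 L)) (p : ℤ)).mp h1
    exact hp.out.ne_one (Nat.isUnit_iff.mp (Int.ofNat_isUnit.mp h3))
  obtain ⟨P, hP, hSP⟩ := exists_max_ideal_of_mem_nonunits hSu
  have hPp : P.IsPrime := hP.isPrime
  have hpP : (p : 𝓞 L) ∈ P := hS ▸ P.pow_mem_of_mem hSP 2 two_pos
  have hP0 : P ≠ ⊥ := by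
    rintro rfl
    exact hp.out.ne_zero (by exact_mod_cast (Submodule.mem_bot _).mp hpP)
  set z : 𝓞 L := algebraMap (𝓞 K) (𝓞 L) hζ.toInteger with hz
  have hzz : (z : L) = algebraMap K L ζ := rfl
  obtain ⟨a, b, hab, hPab⟩ : ∃ a b : 𝓞 L, a * conjInt σ a = z * (b * conjInt σ b) ∧
      (a ∉ P ∨ b ∉ P) := by
    obtain ⟨n, d, h | h⟩ :=
      (⟨P, hPp, hP0⟩ :
        IsDedekindDomain.HeightOneSpectrum (𝓞 L)).exists_primeCompl_mul_eq_or_mul_eq x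
    · refine ⟨n, d, RingOfIntegers.ext ?_, Or.inr d.2⟩
      change (n : L) * σ (n : L) = (z : L) * ((d : 𝓞 L) * σ ((d : 𝓞 L) : L))
      change x * ((d : 𝓞 L) : L) = n at h
      rw [hzz, ← hx, ← h, map_mul]
      ring
    · refine ⟨d, n, RingOfIntegers.ext ?_, Or.inl d.2⟩
      change ((d : 𝓞 L) : L) * σ ((d : 𝓞 L) : L) = (z : L) * (n * σ (n : L))
      change x * n = ((d : 𝓞 L) : L) at h
      rw [hzz, ← hx, ← h, map_mul]
      ring
  let φ := Ideal.Quotient.mk P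
  have hc (y : 𝓞 L) : φ (conjInt σ y) = φ y := by
    obtain ⟨u, v, -, hv⟩ := exists_trace_and_difference h2 hσ hζ hpm hS hcS y
    refine ((Ideal.Quotient.mk_eq_mk_iff_sub_mem _ _).mpr ?_).symm
    rw [hv]
    exact P.mul_mem_right _ hSP
  have hφ : φ a ^ 2 = φ z * φ b ^ 2 := by
    have := congrArg φ hab
    rw [map_mul, map_mul, map_mul, hc, hc] at this
    rw [sq, sq, this]
  obtain ⟨t, ht⟩ : ∃ t, p ^ 2 ^ j = 2 * (2 ^ (j + 2) * (2 * t + 1)) + 1 := by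
    refine ⟨p ^ 2 ^ j / 2 ^ (j + 4), ?_⟩
    conv_lhs => rw [← Nat.div_add_mod (p ^ 2 ^ j) (2 ^ (j + 4)), pow_two_pow_mod hp16 j]
    ring
  set e := 2 ^ (j + 2) * (2 * t + 1) with he
  have hfermat (y : 𝓞 L) (hy : φ y ≠ 0) : (φ y ^ 2) ^ e = 1 := by
    have h := pow_sub_self_mem h2 hσ hζ hp2 hpm hS hcS hSP (pow_two_pow_modEq_one hp16 j) y
    rw [← Ideal.Quotient.mk_eq_mk_iff_sub_mem, map_pow, ht, pow_succ, pow_mul] at h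
    exact mul_right_cancel₀ hy (h.trans (one_mul _).symm)
  have hzu : z ^ 2 ^ (j + 2) = -1 := by
    have h1 : hζ.toInteger ^ 2 ^ (j + 2) = -1 := by
      have h3 := (hζ.toInteger_isPrimitiveRoot.pow (a := 2 ^ (j + 2)) (b := 2) (by positivity)
        (by ring))
      exact h3.eq_neg_one_of_two_right
    rw [hz, ← map_pow, h1, map_neg, map_one]
  have hze : φ z ^ e = -1 := by
    rw [he, pow_mul, ← map_pow, hzu, map_neg, map_one, Odd.neg_one_pow ⟨t, rfl⟩]
  have hz0 : φ z ≠ 0 := by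
    intro h
    rw [h, zero_pow (by positivity)] at hze
    simp at hze
  have ha0 : φ a ≠ 0 := by
    intro h
    have h' : φ b = 0 := by
      rw [h, zero_pow two_ne_zero] at hφ
      simpa [hz0] using hφ.symm
    rw [Ideal.Quotient.eq_zero_iff_mem] at h h'
    tauto
  have hb0 : φ b ≠ 0 := by
    intro h
    rw [h, zero_pow two_ne_zero, mul_zero] at hφ
    exact ha0 (pow_eq_zero_iff two_ne_zero |>.mp hφ)
  have h1 := congrArg (· ^ e) hφ
  simp only [mul_pow, hfermat a ha0, hfermat b hb0, hze, mul_one] at h1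
  have h3 : ((2 : ℕ) : 𝓞 L) ∈ P := by
    rw [← Ideal.Quotient.eq_zero_iff_mem, map_natCast]
    push_cast
    linear_combination h1
  exact natCast_notMem_of_coprime hpP hp2 h3

theorem index_squares_classGroup_le_four {j : ℕ} [IsCyclotomicExtension {2 ^ (j + 3)} ℚ K]
    (h2 : Module.finrank K L = 2) (hσ : σ ≠ 1) (hp16 : p % 16 = 9)
    (hζ : IsPrimitiveRoot ζ (2 ^ (j + 3))) (hS : S ^ 2 = p) (hcS : conjInt σ S = -S) :
    (squares (ClassGroup (𝓞 L))).index ≤ 4 := by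
  have : IsTotallyComplex K := IsCyclotomicExtension.Rat.isTotallyComplex (n := 2 ^ (j + 3)) K
    (by have := Nat.one_lt_two_pow (n := j + 2) (by omega); rw [pow_succ]; omega)
  have hK : IsCyclotomicExtension {2 ^ (j + 1 + 2)} ℚ K := ‹_›
  obtain ⟨R, hR, hR4⟩ := exists_finset_ramifiedPrimes h2 hσ hp16 hζ hS hcS
  have hp0 : (p : K) ≠ 0 := Nat.cast_ne_zero.mpr hp.out.ne_zero
  have hSL : (S : L) ^ 2 = p := by exact_mod_cast congrArg (algebraMap (𝓞 L) L) hS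
  have hS0 : (S : L) ≠ 0 := by
    intro h
    rw [h, zero_pow two_ne_zero] at hSL
    exact hp.out.ne_zero (by exact_mod_cast hSL.symm)
  set N : Subgroup Kˣ :=
    ((MonoidHom.id Lˣ * Units.map (σ : L →* L)).range).comap (unitsEmb K L) with hN
  have hmemN (y : Kˣ) : y ∈ N ↔ ∃ x : Lˣ, x * Units.map (σ : L →* L) x = unitsEmb K L y := Iff.rfl
  have hsqJ : squares Kˣ ≤ N ⊓ selmer ⊥ := by
    refine le_inf ?_ (squares_le_selmer _)
    rintro _ ⟨y, rfl⟩
    refine (hmemN _).mpr ⟨unitsEmb K L y, Units.ext ?_⟩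
    change algebraMap K L y * σ (algebraMap K L y) = algebraMap K L (y ^ 2 : Kˣ)
    rw [σ.commutes, Units.val_pow_eq_pow_val, sq, map_mul]
  let z : Kˣ := Units.mk0 ζ (hζ.ne_zero (by positivity))
  have hzsel : z ∈ selmer (⊥ : Subgroup (IdealGroup K)) := by
    have hzk : z ∈ (toPrincipalIdeal (𝓞 K) K).ker := by
      rw [toPrincipalIdeal_ker]
      exact ⟨(hζ.toInteger_isPrimitiveRoot.isUnit (by positivity)).unit, Units.ext rfl⟩
    change toPrincipalIdeal (𝓞 K) K z ∈ (squares (IdealGroup K) ⊔ ⊥ : Subgroup _)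
    rw [MonoidHom.mem_ker.mp hzk]
    exact one_mem _
  have hzN : z ∉ N := by
    rintro ⟨x, hx⟩
    exact mul_conj_ne_zeta h2 hσ hp16 hζ hS hcS x (congrArg Units.val hx)
  have hfin : (squares Kˣ).relIndex (selmer ⊥) ≠ 0 := by
    rw [relIndex_squares_selmer_bot K (rank_add_one K).symm,
      squares_classGroup_index_cyclotomic (j + 1) K]
    positivity
  have hmul :=
    Subgroup.relIndex_mul_relIndex (squares Kˣ) (N ⊓ selmer ⊥) (selmer ⊥) hsqJ inf_le_right
  have hJ0 : (squares Kˣ).relIndex (N ⊓ selmer ⊥) ≠ 0 := by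
    intro h
    rw [h, zero_mul] at hmul
    exact hfin hmul.symm
  have hne1 : (N ⊓ selmer ⊥).relIndex (selmer ⊥) ≠ 1 := fun h =>
    hzN (Subgroup.relIndex_eq_one.mp h hzsel).1
  have hne0 : (N ⊓ selmer ⊥).relIndex (selmer ⊥) ≠ 0 := by
    intro h
    rw [h, mul_zero] at hmul
    exact hfin hmul.symm
  have key := index_squares_classGroup_mul_le (squares_classGroup_index_cyclotomic (j + 1) K) h2 hσ
    (Units.mk0 (S : L) hS0) (Units.mk0 (p : K) hp0) (Units.ext (by
      change (S : L) ^ 2 = algebraMap K L p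
      rw [hSL, map_natCast])) (congrArg (algebraMap (𝓞 L) L) hcS) R hR (N ⊓ selmer ⊥) (m := 2)
    (hmul ▸ Nat.mul_le_mul_left _ (by omega)) hJ0 (fun x hx y hy =>
      ⟨(hmemN y).mpr ⟨x, hy.symm⟩, mem_selmer_of_eq_norm h2 hσ (fun t ht => ⟨1, one_mem _, by
      rw [Subgroup.mem_bot.mp ht, map_one, map_one, mul_one]⟩) x hx y hy⟩)
  have := key.trans (Nat.pow_le_pow_right two_pos hR4)
  omega

end NormResidue

section ResidueField

variable {K L : Type*} [Field K] [NumberField K] [Field L] [NumberField L] [Algebra K L]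
  [IsGalois K L] {m : ℕ} [NeZero m] [IsCyclotomicExtension {m} ℚ K] {ζ : K} {p q : ℕ}
  {σ : L ≃ₐ[K] L} {S : 𝓞 L}

theorem pow_natCast_sq_sub_self_mem (h2 : Module.finrank K L = 2) (hσ : σ ≠ 1)
    (hζ : IsPrimitiveRoot ζ m) (hp : p.Prime) (hq : q.Prime) (hq2 : Odd q) (hpq : p ≠ q)
    (hqm : q ^ 2 ≡ 1 [MOD m]) (hS : S ^ 2 = p) (hcS : conjInt σ S = -S)
    {P : Ideal (𝓞 L)} [P.IsPrime] (hqP : (q : 𝓞 L) ∈ P) (x : 𝓞 L) : x ^ q ^ 2 - x ∈ P := by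
  have : Fact q.Prime := ⟨hq⟩
  have hchar : CharP (𝓞 L ⧸ P) q := by
    refine charP_of_prime_of_natCast_eq_zero hq ?_
    rwa [← map_natCast (Ideal.Quotient.mk P), Ideal.Quotient.eq_zero_iff_mem]
  have hcc := conjInt_conjInt h2 σ x
  obtain ⟨u, hu⟩ := exists_algebraMap_eq_of_fixed h2 hσ (x + conjInt σ x) (by
    rw [map_add, hcc, add_comm])
  obtain ⟨w, hw⟩ := exists_algebraMap_eq_of_fixed h2 hσ (S * (x - conjInt σ x)) (by
    rw [map_mul, map_sub, hcc, hcS]; ring)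
  let φ := Ideal.Quotient.mk P
  have hK (y : 𝓞 K) : φ (algebraMap (𝓞 K) (𝓞 L) y) ^ q ^ 2 = φ (algebraMap (𝓞 K) (𝓞 L) y) := by
    obtain ⟨t, ht⟩ := Ideal.mem_span_singleton.mp (frobenius_pow_sub_mem hζ hqm y)
    rw [← map_pow, Ideal.Quotient.mk_eq_mk_iff_sub_mem, ← map_pow, ← map_sub, ht, map_mul,
      map_natCast]
    exact P.mul_mem_right _ hqP
  have hp0 : (p : 𝓞 L ⧸ P) ≠ 0 := by
    rw [← map_natCast (Ideal.Quotient.mk P), Ne, Ideal.Quotient.eq_zero_iff_mem]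
    exact natCast_notMem_of_coprime hqP ((Nat.coprime_primes hp hq).mpr hpq)
  have h20 : (2 : 𝓞 L ⧸ P) ≠ 0 := by
    have h := natCast_notMem_of_coprime hqP (hq2.coprime_two_left)
    rwa [← Ideal.Quotient.eq_zero_iff_mem, map_natCast, Nat.cast_ofNat] at h
  have hp1 : (p : 𝓞 L ⧸ P) ^ (q - 1) = 1 := by
    refine mul_right_cancel₀ hp0 ?_
    rw [← pow_succ, Nat.sub_add_cancel hq.one_le, one_mul, ← frobenius_def, map_natCast]
  have hφS : φ S ^ 2 = p := by rw [← map_pow, hS, map_natCast]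
  have hφS0 : φ S ≠ 0 := by
    intro h
    rw [h, zero_pow two_ne_zero] at hφS
    exact hp0 hφS.symm
  have hSq : φ S ^ q ^ 2 = φ S := by
    obtain ⟨k, hk⟩ := hq2
    have h3 : q ^ 2 = 2 * ((q - 1) * (k + 1)) + 1 := by
      rw [hk, Nat.add_sub_cancel]; ring
    rw [h3, pow_succ, pow_mul, hφS, pow_mul, hp1, one_pow, one_mul]
  have hx : 2 * φ S * φ x = φ S * φ (algebraMap (𝓞 K) (𝓞 L) u) + φ (algebraMap (𝓞 K) (𝓞 L) w) := by
    rw [hu, hw, ← map_mul, ← map_add, ← map_ofNat φ 2, ← map_mul, ← map_mul]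
    congr 1
    ring
  have h2q : (2 : 𝓞 L ⧸ P) ^ q ^ 2 = 2 := by
    rw [← iterateFrobenius_def, map_ofNat]
  have h4 := congrArg (iterateFrobenius (𝓞 L ⧸ P) q 2) hx
  simp only [map_add, map_mul] at h4
  simp only [iterateFrobenius_def, hSq, hK, h2q] at h4
  rw [← Ideal.Quotient.mk_eq_mk_iff_sub_mem, map_pow]
  exact mul_left_cancel₀ (mul_ne_zero h20 hφS0) (h4.trans hx.symm)

omit [NumberField K] [Algebra K L] [IsGalois K L] [IsCyclotomicExtension {m} ℚ K] in
theorem absNorm_le_of_pow_sub_self_mem {P : Ideal (𝓞 L)} [P.IsPrime] (hP : P ≠ ⊥) {N : ℕ}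
    (hN : 1 < N) (h : ∀ x : 𝓞 L, x ^ N - x ∈ P) : P.absNorm ≤ N := by
  classical
  have hfin : Finite (𝓞 L ⧸ P) := Ideal.finiteQuotientOfFreeOfNeBot P hP
  have := Fintype.ofFinite (𝓞 L ⧸ P)
  have hmax : P.IsMaximal := ‹P.IsPrime›.isMaximal hP
  let _ : Field (𝓞 L ⧸ P) := Ideal.Quotient.field P
  rw [Ideal.absNorm_apply, Submodule.cardQuot_apply, Nat.card_eq_fintype_card, ← Finset.card_univ,
    ← FiniteField.X_pow_card_sub_X_natDegree_eq (𝓞 L ⧸ P) hN]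
  refine Polynomial.card_le_degree_of_subset_roots fun y _ => ?_
  obtain ⟨x, rfl⟩ := Ideal.Quotient.mk_surjective y
  rw [Polynomial.mem_roots (FiniteField.X_pow_card_sub_X_ne_zero _ hN)]
  simpa [sub_eq_zero, ← map_pow, Ideal.Quotient.mk_eq_mk_iff_sub_mem] using h x

end ResidueField

section IntNorm

variable {k F : Type*} [Field k] [NumberField k] [Field F] [NumberField F] [Algebra k F]

theorem mem_span_natCast_of_algebraMap_mem {ℓ : ℕ} (hℓ : ℓ ≠ 0) {w : 𝓞 k}
    (hw : algebraMap (𝓞 k) (𝓞 F) w ∈ Ideal.span {(ℓ : 𝓞 F)}) : w ∈ Ideal.span {(ℓ : 𝓞 k)} := by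
  obtain ⟨y, hy⟩ := Ideal.mem_span_singleton.mp hw
  have hy' : algebraMap k F w = ℓ * y := congrArg (algebraMap (𝓞 F) F) hy
  have hℓk : (ℓ : k) ≠ 0 := Nat.cast_ne_zero.mpr hℓ
  have hℓF : (ℓ : F) ≠ 0 := Nat.cast_ne_zero.mpr hℓ
  have hint : IsIntegral ℤ ((w : k) / ℓ) := by
    rw [← isIntegral_algebraMap_iff (algebraMap k F).injective, map_div₀, map_natCast, hy',
      mul_div_cancel_left₀ _ hℓF]
    exact y.isIntegral_coe
  refine Ideal.mem_span_singleton.mpr ⟨⟨_, hint⟩, RingOfIntegers.ext ?_⟩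
  change (w : k) = ℓ * ((w : k) / ℓ)
  rw [mul_div_cancel₀ _ hℓk]

theorem algebraMap_intNorm_eq_prod [IsGalois k F] (x : 𝓞 F) :
    algebraMap (𝓞 k) (𝓞 F) (Algebra.intNorm (𝓞 k) (𝓞 F) x) = ∏ τ : F ≃ₐ[k] F, conjInt τ x := by
  apply RingOfIntegers.ext
  change algebraMap k F (algebraMap (𝓞 k) k _) = _
  rw [Algebra.algebraMap_intNorm (L := F), Algebra.norm_eq_prod_automorphisms]
  exact (map_prod (algebraMap (𝓞 F) F) (fun τ : F ≃ₐ[k] F => conjInt τ x) Finset.univ).symm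

theorem algebraMap_intNorm_eq_mul [IsGalois k F] (h2 : Module.finrank k F = 2)
    {σ : F ≃ₐ[k] F} (hσ : σ ≠ 1) (x : 𝓞 F) :
    algebraMap (𝓞 k) (𝓞 F) (Algebra.intNorm (𝓞 k) (𝓞 F) x) = x * conjInt σ x := by
  classical
  have huniv : (Finset.univ : Finset (F ≃ₐ[k] F)) = {1, σ} := by
    ext τ
    simpa using gal_eq_one_or_eq h2 hσ τ
  rw [algebraMap_intNorm_eq_prod, huniv, Finset.prod_pair hσ.symm]
  rfl

theorem intNorm_sub_mem_span [IsGalois k F] {ℓ : ℕ} (hℓ : ℓ ≠ 0) {x y : 𝓞 F}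
    (h : x - y ∈ Ideal.span {(ℓ : 𝓞 F)}) :
    Algebra.intNorm (𝓞 k) (𝓞 F) x - Algebra.intNorm (𝓞 k) (𝓞 F) y ∈ Ideal.span {(ℓ : 𝓞 k)} := by
  apply mem_span_natCast_of_algebraMap_mem (F := F) hℓ
  rw [map_sub, algebraMap_intNorm_eq_prod, algebraMap_intNorm_eq_prod,
    ← Ideal.Quotient.mk_eq_mk_iff_sub_mem, map_prod, map_prod]
  refine Finset.prod_congr rfl fun τ _ => ?_
  rw [Ideal.Quotient.mk_eq_mk_iff_sub_mem, ← map_sub]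
  obtain ⟨t, ht⟩ := Ideal.mem_span_singleton.mp h
  rw [ht, map_mul, map_natCast]
  exact Ideal.mul_mem_right _ _ (Ideal.mem_span_singleton_self _)

end IntNorm

section GaussianField

variable {E : Type*} [Field E] [NumberField E] [hE : IsCyclotomicExtension {4} ℚ E]

theorem finrank_gaussianField : Module.finrank ℚ E = 2 := by
  rw [IsCyclotomicExtension.finrank (n := 4) E
    (Polynomial.cyclotomic.irreducible_rat (by norm_num))]
  decide

theorem gaussianField_units_pow_four (u : (𝓞 E)ˣ) : u ^ 4 = 1 := by
  have : IsTotallyComplex E := IsCyclotomicExtension.Rat.isTotallyComplex (n := 4) E (by norm_num)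
  have h0 : Units.rank E = 0 := by
    have := rank_add_one E
    rw [finrank_gaussianField] at this
    omega
  have : IsEmpty (Fin (Units.rank E)) := by rw [h0]; infer_instance
  obtain ⟨ζe, hu, -⟩ := Units.exist_unique_eq_mul_prod E u
  rw [Fintype.prod_empty, mul_one] at hu
  have h4 : Units.torsionOrder E = 4 := by
    rw [IsCyclotomicExtension.Rat.torsionOrder_eq (n := 4), if_pos (by decide)]
  have h1 : ζe.1 ^ 4 = 1 := by
    rw [← h4]; exact pow_card_eq_one'
  rw [hu, ← Subgroup.coe_pow, h1, Subgroup.coe_one]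

theorem under_eq_span_of_inert {q : ℕ} (hq : q.Prime) (hq4 : q % 4 = 3) (P : Ideal (𝓞 E))
    [P.IsPrime] (hqP : (q : 𝓞 E) ∈ P) : P = Ideal.span {(q : 𝓞 E)} ∧ P.absNorm = q ^ 2 := by
  have : Fact q.Prime := ⟨hq⟩
  have := liesOver_span_of_mem hq P hqP
  have hf : P.inertiaDeg ℤ = 2 := by
    rw [IsCyclotomicExtension.Rat.inertiaDeg_eq_of_not_dvd (m := 4) q E P (fun h => by
      have := (Nat.dvd_prime_pow Nat.prime_two (m := 2)).mp h
      obtain ⟨k, hk, rfl⟩ := this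
      interval_cases k <;> omega)]
    have h3 : (q : ZMod 4) = 3 := by
      have := (ZMod.natCast_eq_natCast_iff q 3 4).mpr hq4
      exact_mod_cast this
    rw [h3]
    exact orderOf_eq_prime (by decide) (by decide)
  have hN : P.absNorm = q ^ 2 := by rw [← Ideal.pow_inertiaDeg q P, hf]
  refine ⟨?_, hN⟩
  obtain ⟨J, hJ⟩ := Ideal.dvd_iff_le.mpr ((Ideal.span_singleton_le_iff_mem P).mpr hqP)
  have h1 := congrArg Ideal.absNorm hJ
  rw [Ideal.absNorm_span_natCast, RingOfIntegers.rank, finrank_gaussianField, map_mul, hN] at h1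
  have h2 : J.absNorm = 1 := by
    have : 0 < q ^ 2 := pow_pos hq.pos 2
    nlinarith
  rw [Ideal.absNorm_eq_one_iff.mp h2, Ideal.mul_top] at hJ
  exact hJ.symm

end GaussianField

section NonSquareClass

variable {E K L : Type*} [Field E] [NumberField E] [Field K] [NumberField K] [Field L]
  [NumberField L] [Algebra E K] [Algebra K L] [Algebra E L] [IsScalarTower E K L]

theorem relNorm_eq_span_of_absNorm_le [IsCyclotomicExtension {4} ℚ E] {q : ℕ}
    (hq : q.Prime) (hq4 : q % 4 = 3) (P : Ideal (𝓞 L)) [P.IsPrime] (hqP : (q : 𝓞 L) ∈ P)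
    (hP0 : P ≠ ⊥) (hPN : P.absNorm ≤ q ^ 2) :
    Ideal.relNorm (𝓞 E) P = Ideal.span {(q : 𝓞 E)} := by
  have hPm : P.IsMaximal := ‹P.IsPrime›.isMaximal hP0
  have hq' : (q : 𝓞 E) ∈ P.under (𝓞 E) := by rwa [Ideal.mem_under, map_natCast]
  have hp : (P.under (𝓞 E)).IsPrime := inferInstance
  obtain ⟨h1, h2⟩ := under_eq_span_of_inert hq hq4 _ hq'
  have hm : (P.under (𝓞 E)).IsMaximal := Ideal.IsMaximal.under _ P
  have h3 := Ideal.relNorm_eq_pow_of_isMaximal P (P.under (𝓞 E))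
  have h4 := congrArg Ideal.absNorm h3
  rw [Ideal.absNorm_relNorm, map_pow, h2, ← pow_mul] at h4
  rw [h4] at hPN
  have h5 := (Nat.pow_le_pow_iff_right hq.one_lt).mp hPN
  have h6 := Ideal.inertiaDeg_pos P (𝓞 E)
  have h7 : P.inertiaDeg (𝓞 E) = 1 := by omega
  rw [h3, h7, pow_one, h1]

theorem intNorm_mul_sub_one_mem [IsGalois E K] {ℓ : ℕ} (hℓ : ℓ ≠ 0) {x y : 𝓞 K}
    (h : x * y - 1 ∈ Ideal.span {(ℓ : 𝓞 K)}) :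
    Algebra.intNorm (𝓞 E) (𝓞 K) x * Algebra.intNorm (𝓞 E) (𝓞 K) y - 1 ∈
      Ideal.span {(ℓ : 𝓞 E)} := by
  have := intNorm_sub_mem_span (k := E) hℓ h
  rwa [map_mul, map_one] at this

theorem intNorm_ne_unit_mul_natCast_mul_sq [IsGalois E K] [IsGalois K L]
    [IsCyclotomicExtension {4} ℚ E]
    {m : ℕ} [NeZero m] [IsCyclotomicExtension {m} ℚ K] {ζ : K} (hζ : IsPrimitiveRoot ζ m)
    {p q : ℕ} [hp : Fact p.Prime] (hp8 : p % 8 = 1) (hpm : p.Coprime m)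
    (h2 : Module.finrank K L = 2) {σ : L ≃ₐ[K] L} (hσ : σ ≠ 1) {S : 𝓞 L} (hS : S ^ 2 = p)
    (hcS : conjInt σ S = -S) (hq : ¬ IsSquare (q : ZMod p)) {γ β : 𝓞 L}
    (hγ : γ * β - 1 ∈ Ideal.span {(p : 𝓞 L)}) (u : (𝓞 E)ˣ) (b : 𝓞 E) :
    Algebra.intNorm (𝓞 E) (𝓞 L) γ ≠ u * q * b ^ 2 := by
  intro h
  have hp0 := hp.out.ne_zero
  obtain ⟨t, v, ht, hv⟩ := exists_trace_and_difference h2 hσ hζ hpm hS hcS γ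
  have hinj : Function.Injective (algebraMap (𝓞 K) (𝓞 L)) := FaithfulSMul.algebraMap_injective _ _
  set n := Algebra.intNorm (𝓞 K) (𝓞 L) γ with hn
  have h4n : 2 ^ 2 * n - t ^ 2 ∈ Ideal.span {(p : 𝓞 K)} := by
    refine Ideal.mem_span_singleton.mpr ⟨- v ^ 2, hinj ?_⟩
    rw [map_sub, map_mul, map_mul, map_pow, map_pow, map_neg, map_pow, map_natCast, map_ofNat,
      algebraMap_intNorm_eq_mul h2 hσ, ← ht, ← hS]
    linear_combination (-(γ - conjInt σ γ) - S * algebraMap (𝓞 K) (𝓞 L) v) * hv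
  have h4N := intNorm_sub_mem_span (k := E) hp0 h4n
  rw [map_mul, map_pow, map_pow, hn, Algebra.intNorm_intNorm, h] at h4N
  have hγN := intNorm_mul_sub_one_mem (E := E) hp0 (intNorm_mul_sub_one_mem (E := K) hp0 hγ)
  rw [Algebra.intNorm_intNorm, Algebra.intNorm_intNorm, h] at hγN
  have h2N := intNorm_mul_sub_one_mem (E := E) (x := (2 : 𝓞 K))
    (y := ((p / 2 + 1 : ℕ) : 𝓞 K)) hp0 (by
    refine Ideal.mem_span_singleton.mpr ⟨1, ?_⟩
    have : 2 * (p / 2 + 1) = p + 1 := by omega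
    rw [mul_one, sub_eq_iff_eq_add]
    exact_mod_cast this)
  set e := Algebra.intNorm (𝓞 E) (𝓞 K) 2
  set r := Algebra.intNorm (𝓞 E) (𝓞 K) t
  have hpu : (p : 𝓞 E) ∈ nonunits (𝓞 E) := by
    intro h
    rw [← map_natCast (algebraMap ℤ (𝓞 E)), isUnit_map_iff] at h
    exact hp.out.ne_one (Nat.isUnit_iff.mp (Int.ofNat_isUnit.mp (by exact_mod_cast h)))
  obtain ⟨P, hPm, hpP⟩ := exists_max_ideal_of_mem_nonunits hpu
  have hPp := hPm.isPrime
  have hle : Ideal.span {(p : 𝓞 E)} ≤ P := (Ideal.span_singleton_le_iff_mem P).mpr hpP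
  let φ := Ideal.Quotient.mk P
  have hchar : CharP (𝓞 E ⧸ P) p := by
    refine charP_of_prime_of_natCast_eq_zero hp.out ?_
    rwa [← map_natCast (Ideal.Quotient.mk P), Ideal.Quotient.eq_zero_iff_mem]
  have hfermat (y : 𝓞 E) (hy : φ y ≠ 0) : φ y ^ (p - 1) = 1 := by
    have hζ4 := IsCyclotomicExtension.zeta_spec 4 ℚ E
    have h1 := hle (frobenius_pow_sub_mem hζ4 (ℓ := p) (f := 1) (by
      rw [pow_one]; change p % 4 = 1; omega) y)
    rw [pow_one, ← Ideal.Quotient.mk_eq_mk_iff_sub_mem, map_pow] at h1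
    refine mul_right_cancel₀ hy ?_
    rw [← pow_succ, Nat.sub_add_cancel hp.out.one_le, one_mul]
    exact h1
  have hφ := (Ideal.Quotient.mk_eq_mk_iff_sub_mem _ _).mpr (hle h4N)
  have hφγ := (Ideal.Quotient.mk_eq_mk_iff_sub_mem _ _).mpr (hle hγN)
  have hφ2 := (Ideal.Quotient.mk_eq_mk_iff_sub_mem _ _).mpr (hle h2N)
  change φ _ = φ _ at hφ hφγ hφ2
  simp only [map_mul, map_pow, map_one, map_natCast] at hφ hφγ hφ2
  have he0 : φ e ≠ 0 := left_ne_zero_of_mul_eq_one hφ2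
  have huqb := left_ne_zero_of_mul_eq_one hφγ
  have hb0 : φ b ≠ 0 := by
    intro h
    rw [h] at huqb
    simp at huqb
  have hr0 : φ r ≠ 0 := by
    intro h
    rw [h, zero_pow two_ne_zero] at hφ
    exact mul_ne_zero (pow_ne_zero 2 he0) huqb hφ
  obtain ⟨k, hk⟩ : ∃ k, p - 1 = 2 * (4 * k) := ⟨p / 8, by omega⟩
  have hsq (y : 𝓞 E) (hy : φ y ≠ 0) : (φ y ^ 2) ^ (4 * k) = 1 := by
    rw [← pow_mul, ← hk, hfermat y hy]
  have hu4 : φ u ^ (4 * k) = 1 := by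
    rw [pow_mul, ← map_pow, ← Units.val_pow_eq_pow_val, gaussianField_units_pow_four,
      Units.val_one, map_one, one_pow]
  have hq4 : (q : 𝓞 E ⧸ P) ^ (4 * k) = -1 := by
    have hq0 : (q : ZMod p) ≠ 0 := by
      intro h
      exact hq (h ▸ IsSquare.zero)
    have h1 := (ZMod.pow_div_two_eq_neg_one_or_one p hq0).resolve_left
      ((ZMod.euler_criterion p hq0).not.mp hq)
    have h3 : p / 2 = 4 * k := by omega
    rw [h3] at h1
    have := congrArg (ZMod.castHom dvd_rfl (𝓞 E ⧸ P)) h1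
    simpa using this
  have hfin := congrArg (· ^ (4 * k)) hφ
  simp only [mul_pow, hsq e he0, hsq b hb0, hsq r hr0, hu4, hq4, one_mul, mul_one] at hfin
  have h20 : ((2 : ℕ) : 𝓞 E) ∈ P := by
    rw [← Ideal.Quotient.eq_zero_iff_mem, map_natCast]
    push_cast
    linear_combination -hfin
  exact natCast_notMem_of_coprime hpP
    ((Nat.coprime_primes Nat.prime_two hp.out).mpr (by omega)) h20

end NonSquareClass

section CoprimeRepresentative

theorem exists_isCoprime_mk0_eq {R : Type*} [CommRing R] [IsDedekindDomain R] {I : Ideal R}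
    (hI : I ≠ ⊥) (y : ClassGroup R) : ∃ C : (Ideal R)⁰, I ⊔ C = ⊤ ∧ ClassGroup.mk0 C = y := by
  obtain ⟨B, hB⟩ := ClassGroup.mk0_surjective y⁻¹
  have hB0 : (B : Ideal R) ≠ ⊥ := nonZeroDivisors.ne_zero B.2
  obtain ⟨a, ha⟩ :=
    IsDedekindDomain.exists_sup_span_eq (I := I * (B : Ideal R)) (J := B) Ideal.mul_le_right
    (mul_ne_zero hI hB0)
  by_cases ha0 : a = 0
  · have h1 : I * (B : Ideal R) = ⊤ * B := by
      rw [Ideal.top_mul]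
      simpa [ha0] using ha
    have hI1 : I = ⊤ := mul_right_cancel₀ hB0 h1
    obtain ⟨C, hC⟩ := ClassGroup.mk0_surjective y
    exact ⟨C, by rw [hI1, top_sup_eq], hC⟩
  obtain ⟨C, hC⟩ := Ideal.dvd_iff_le.mpr (le_sup_right.trans ha.le)
  have hC0 : C ≠ ⊥ := by
    rintro rfl
    rw [Ideal.mul_bot, Ideal.span_singleton_eq_bot] at hC
    exact ha0 hC
  refine ⟨⟨C, mem_nonZeroDivisors_of_ne_zero hC0⟩, ?_, ?_⟩
  · refine mul_left_cancel₀ hB0 ?_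
    rw [Ideal.mul_sup, Ideal.mul_top, ← hC, mul_comm, ha]
  · rw [← inv_inv y, ← hB, ClassGroup.mk0_eq_mk0_inv_iff]
    exact ⟨a, ha0, by rw [hC, mul_comm]⟩

end CoprimeRepresentative

section NonSquareClass

variable {E K L : Type*} [Field E] [NumberField E] [Field K] [NumberField K] [Field L]
  [NumberField L] [Algebra E K] [Algebra K L] [Algebra E L] [IsScalarTower E K L]

theorem mk0_notMem_squares_classGroup [IsGalois E K] [IsGalois K L]
    [IsCyclotomicExtension {4} ℚ E]
    {m : ℕ} [NeZero m] [IsCyclotomicExtension {m} ℚ K] {ζ : K} (hζ : IsPrimitiveRoot ζ m)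
    {p q : ℕ} [hp : Fact p.Prime] (hp8 : p % 8 = 1) (hpm : p.Coprime m)
    (h2 : Module.finrank K L = 2) {σ : L ≃ₐ[K] L} (hσ : σ ≠ 1) {S : 𝓞 L} (hS : S ^ 2 = p)
    (hcS : conjInt σ S = -S) (hq : q.Prime) (hq4 : q % 4 = 3) (hqp : ¬ IsSquare (q : ZMod p))
    {P : (Ideal (𝓞 L))⁰} (hP : (P : Ideal (𝓞 L)).IsPrime) (hqP : (q : 𝓞 L) ∈ (P : Ideal (𝓞 L)))
    (hPN : (P : Ideal (𝓞 L)).absNorm ≤ q ^ 2) :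
    ClassGroup.mk0 P ∉ squares (ClassGroup (𝓞 L)) := by
  rintro ⟨y, hy⟩
  have hp0 : Ideal.span {(p : 𝓞 L)} ≠ ⊥ := by
    rw [Ne, Ideal.span_singleton_eq_bot]
    exact_mod_cast hp.out.ne_zero
  obtain ⟨C, hpC, hC⟩ := exists_isCoprime_mk0_eq hp0 y⁻¹
  have hprin : ClassGroup.mk0 (P * C ^ 2) = 1 := by
    rw [map_mul, map_pow, hC, ← hy]
    simp
  rw [ClassGroup.mk0_eq_one_iff (P * C ^ 2).2] at hprin
  obtain ⟨γ, hγ⟩ := hprin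
  change (P : Ideal (𝓞 L)) * (C : Ideal (𝓞 L)) ^ 2 = Ideal.span {γ} at hγ
  have hpP : Ideal.span {(p : 𝓞 L)} ⊔ P = ⊤ := by
    have hPm := hP.isMaximal (nonZeroDivisors.ne_zero P.2)
    rw [sup_comm]
    refine hPm.1.2 _ (left_lt_sup.mpr fun h => ?_)
    refine natCast_notMem_of_coprime hqP ?_ ((Ideal.span_singleton_le_iff_mem _).mp h)
    refine (Nat.coprime_primes hp.out hq).mpr ?_
    rintro rfl
    omega
  have hcop : Ideal.span {(p : 𝓞 L)} ⊔ Ideal.span {γ} = ⊤ := by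
    rw [← hγ]
    exact Ideal.sup_mul_eq_of_coprime_left hpP |>.trans (Ideal.sup_pow_eq_top hpC)
  obtain ⟨β, hβ⟩ : ∃ β, γ * β - 1 ∈ Ideal.span {(p : 𝓞 L)} := by
    obtain ⟨x, hx, y, hy, h⟩ := Submodule.mem_sup.mp (hcop ▸ Submodule.mem_top (x := (1 : 𝓞 L)))
    obtain ⟨β, rfl⟩ := Ideal.mem_span_singleton.mp hy
    refine ⟨β, ?_⟩
    rw [← h, sub_add_cancel_right]
    exact neg_mem hx
  have := isPrincipalIdealRing_of_isCyclotomicExtension_four E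
  obtain ⟨b, hb⟩ := IsPrincipalIdealRing.principal (Ideal.relNorm (𝓞 E) (C : Ideal (𝓞 L)))
  change _ = Ideal.span {b} at hb
  have hN := congrArg (Ideal.relNorm (𝓞 E)) hγ
  rw [map_mul, map_pow, relNorm_eq_span_of_absNorm_le hq hq4 _ hqP (nonZeroDivisors.ne_zero P.2)
    hPN, hb, Ideal.relNorm_singleton, Ideal.span_singleton_pow,
    Ideal.span_singleton_mul_span_singleton,
    Ideal.span_singleton_eq_span_singleton] at hN
  obtain ⟨u, hu⟩ := hN
  refine intNorm_ne_unit_mul_natCast_mul_sq (E := E) hζ hp8 hpm h2 hσ hS hcS hqp hβ u b ?_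
  rw [← hu]
  ring

end NonSquareClass

section Thue

theorem Nat.Prime.exists_sq_sub_two_mul_sq {p : ℕ} (hp : p.Prime) (hp8 : p % 8 = 1) :
    ∃ c d : ℤ, c ^ 2 - 2 * d ^ 2 = p := by
  have : Fact p.Prime := ⟨hp⟩
  obtain ⟨t, ht⟩ := (ZMod.exists_sq_eq_two_iff (p := p) (by omega)).mpr (Or.inl hp8)
  set k := p.sqrt with hk
  have hcard : Fintype.card (ZMod p) < Fintype.card (Fin (k + 1) × Fin (k + 1)) := by
    rw [ZMod.card, Fintype.card_prod, Fintype.card_fin]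
    exact Nat.lt_succ_sqrt p
  obtain ⟨⟨x₁, y₁⟩, ⟨x₂, y₂⟩, hne, heq⟩ := Fintype.exists_ne_map_eq_of_card_lt
    (fun z : Fin (k + 1) × Fin (k + 1) => (z.1 : ZMod p) - t * (z.2 : ℕ)) hcard
  obtain ⟨a, ha⟩ : ∃ a : ℤ, a = (x₁ : ℕ) - (x₂ : ℕ) := ⟨_, rfl⟩
  obtain ⟨b, hb⟩ : ∃ b : ℤ, b = (y₁ : ℕ) - (y₂ : ℕ) := ⟨_, rfl⟩
  have hkp : k ^ 2 < p := by
    refine lt_of_le_of_ne (Nat.sqrt_le' p) fun h => ?_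
    exact Nat.Prime.not_prime_pow le_rfl (h ▸ hp)
  have hsq (x y : Fin (k + 1)) : (((x : ℕ) : ℤ) - (y : ℕ)) ^ 2 < p := by
    have hkp' : (k : ℤ) ^ 2 < p := by exact_mod_cast hkp
    have h1 : ((x : ℕ) : ℤ) - (y : ℕ) ≤ k := by omega
    have h2 : -(k : ℤ) ≤ ((x : ℕ) : ℤ) - (y : ℕ) := by omega
    nlinarith
  have ha2 := ha ▸ hsq x₁ x₂
  have hb2 := hb ▸ hsq y₁ y₂
  have hab : (a : ZMod p) = t * b := by
    rw [ha, hb]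
    push_cast
    linear_combination heq
  obtain ⟨e, he⟩ : (p : ℤ) ∣ a ^ 2 - 2 * b ^ 2 := by
    rw [← ZMod.intCast_zmod_eq_zero_iff_dvd]
    push_cast
    rw [hab]
    linear_combination -(b : ZMod p) ^ 2 * ht
  have hp0 : (0 : ℤ) < p := by exact_mod_cast hp.pos
  have he1 : e < 1 := by nlinarith [sq_nonneg b]
  have he2 : -2 < e := by nlinarith [sq_nonneg a]
  obtain rfl | rfl : e = -1 ∨ e = 0 := by omega
  · exact ⟨a + 2 * b, a + b, by linear_combination -he⟩
  · have h0 := (Zsqrtd.norm_eq_zero (d := 2) (fun n hn => by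
      have h1 : n < 2 := by nlinarith
      have h2 : -2 < n := by nlinarith
      interval_cases n <;> omega) ⟨a, b⟩).mp (by
        rw [Zsqrtd.norm_def]; linear_combination he)
    have ha0 : a = 0 := congrArg Zsqrtd.re h0
    have hb0 : b = 0 := congrArg Zsqrtd.im h0
    exact absurd (Prod.ext (Fin.ext (by dsimp only; omega)) (Fin.ext (by dsimp only; omega))) hne

end Thue

section SqrtTwo

variable {A : Type*} [CommRing A] {w : A}

theorem sub_pow_three_sq (hw : w ^ 4 = -1) : (w - w ^ 3) ^ 2 = 2 := by
  linear_combination (w ^ 2 - 2) * hw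

theorem sub_pow_three_pow_prime (hw : w ^ 4 = -1) {q : ℕ} [Fact q.Prime] [CharP A q]
    (hq : q % 8 = 7) : (w - w ^ 3) ^ q = w - w ^ 3 := by
  have h8 : w ^ 8 = 1 := by linear_combination (w ^ 4 - 1) * hw
  have hwq : w ^ q = w ^ 7 := by
    rw [← Nat.div_add_mod q 8, pow_add, pow_mul, h8, one_pow, one_mul, hq]
  rw [sub_pow_char, pow_right_comm, hwq]
  linear_combination (-w ^ 17 + w ^ 13 - w ^ 9 + w ^ 5 + w ^ 3 - w) * hw

theorem exists_eq_sq_add_four_mul (hw : w ^ 4 = -1) {c d : ℤ} {p : ℕ} (hp8 : p % 8 = 1)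
    (hcd : c ^ 2 - 2 * d ^ 2 = p) : ∃ r g : A, c + d * (w - w ^ 3) = r ^ 2 + 4 * g := by
  obtain ⟨e, rfl⟩ : ∃ e, d = 2 * e := by
    obtain ⟨e, he | he⟩ := Int.even_or_odd' d
    · exact ⟨e, he⟩
    · obtain ⟨x, hx | hx⟩ := Int.even_or_odd' c
      · subst hx he
        ring_nf at hcd
        omega
      · subst hx he
        have h2 := Int.even_mul_succ_self x
        have h3 := Int.even_mul_succ_self e
        obtain ⟨y, hy⟩ := h2
        obtain ⟨z, hz⟩ := h3
        have : (p : ℤ) = 8 * (y - 2 * z) - 1 := by linear_combination -hcd + 4 * hy - 8 * hz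
        omega
  obtain ⟨x, hx⟩ : ∃ x, c = 2 * x + 1 := by
    obtain ⟨x, hx | hx⟩ := Int.even_or_odd' c
    · subst hx
      ring_nf at hcd
      omega
    · exact ⟨x, hx⟩
  obtain ⟨y, hy | hy⟩ := Int.even_or_odd' x <;> obtain ⟨f, hf | hf⟩ := Int.even_or_odd' e <;>
    subst hf hy hx
  · exact ⟨1, y + f * (w - w ^ 3), by push_cast; ring⟩
  · exact ⟨w ^ 2 * (1 + (w - w ^ 3)), y + 1 + (f + 1) * (w - w ^ 3), by
      push_cast; linear_combination -(1 + (w - w ^ 3)) ^ 2 * hw + sub_pow_three_sq hw⟩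
  · exact ⟨w ^ 2, y + 1 + f * (w - w ^ 3), by push_cast; linear_combination -hw⟩
  · exact ⟨1 + (w - w ^ 3), y + f * (w - w ^ 3), by
      push_cast; linear_combination -sub_pow_three_sq hw⟩

end SqrtTwo

section NonSquare

variable {K L : Type*} [Field K] [NumberField K] [Field L] [NumberField L] [Algebra K L]
  [IsGalois K L] {m : ℕ} [NeZero m] [IsCyclotomicExtension {m} ℚ K] {ζ : K} {p : ℕ}
  {D D' : 𝓞 K}

omit [NumberField K] in
theorem isSquare_of_isSquare_coe {x : 𝓞 K} (h : IsSquare (x : K)) : IsSquare x := by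
  obtain ⟨y, hy⟩ := h
  have hint : IsIntegral ℤ y := by
    refine IsIntegral.of_pow two_pos ?_
    rw [sq, ← hy]
    exact x.isIntegral_coe
  exact ⟨⟨y, hint⟩, RingOfIntegers.ext hy⟩

theorem not_isSquare_of_mul_eq_natCast (hζ : IsPrimitiveRoot ζ m) (hp : p.Prime)
    (hpm : p.Coprime m) (h : D * D' = p) (τ : 𝓞 K →+* 𝓞 K) (hτ : τ D = D') :
    ¬ IsSquare D := by
  rintro ⟨a, ha⟩
  have : Fact p.Prime := ⟨hp⟩
  have hp0 : (p : 𝓞 K) ≠ 0 := by exact_mod_cast hp.ne_zero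
  obtain ⟨t, ht⟩ := Ideal.mem_span_singleton.mp (mem_span_of_sq_mem_span hζ hpm (x := a * D')
    (Ideal.mem_span_singleton.mpr ⟨D', by linear_combination D' * h - D' ^ 2 * ha⟩))
  rw [← h] at ht hp0
  have hat : a * t = 1 := by
    have h0 : a * D' ≠ 0 := fun h0 => hp0 (by rw [ha, mul_assoc, h0, mul_zero])
    refine mul_left_cancel₀ h0 ?_
    linear_combination -ht - D' * t * ha
  have hu : IsUnit D := ha ▸ (IsUnit.of_mul_eq_one t hat).mul (IsUnit.of_mul_eq_one t hat)
  have hup : IsUnit (p : 𝓞 K) := h ▸ hu.mul (hτ ▸ hu.map τ)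
  rw [← map_natCast (algebraMap ℤ (𝓞 K)), isUnit_map_iff] at hup
  exact hp.ne_one (Nat.isUnit_iff.mp (Int.ofNat_isUnit.mp (by exact_mod_cast hup)))

theorem not_isSquare_algebraMap (h2 : Module.finrank K L = 2) {σ : L ≃ₐ[K] L} (hσ : σ ≠ 1)
    {S : 𝓞 L} (hS : S ^ 2 = p) (hcS : conjInt σ S = -S) (hp : p ≠ 0) (h : D * D' = p)
    (hD : ¬ IsSquare D) (hD' : ¬ IsSquare D') : ¬ IsSquare (algebraMap (𝓞 K) (𝓞 L) D) := by
  rintro ⟨y, hy⟩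
  have hinj : Function.Injective (algebraMap (𝓞 K) (𝓞 L)) := FaithfulSMul.algebraMap_injective _ _
  have hfix (x : 𝓞 K) : conjInt σ (algebraMap (𝓞 K) (𝓞 L) x) = algebraMap (𝓞 K) (𝓞 L) x :=
    RingOfIntegers.ext (σ.commutes (x : K))
  have h1 := congrArg (conjInt σ) hy
  rw [hfix, hy, map_mul] at h1
  rcases mul_self_eq_mul_self_iff.mp h1 with h3 | h3
  · obtain ⟨a, ha⟩ := exists_algebraMap_eq_of_fixed h2 hσ y h3.symm
    exact hD ⟨a, hinj (by rw [hy, map_mul, ha])⟩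
  · obtain ⟨a, ha⟩ := exists_algebraMap_eq_of_fixed h2 hσ (y * S) (by
      rw [map_mul, hcS]; linear_combination -S * h3)
    have hDD : D * D' ≠ 0 := by rw [h]; exact_mod_cast hp
    have hD0 := left_ne_zero_of_mul hDD
    refine hD' (isSquare_of_isSquare_coe ⟨(a : K) / D, ?_⟩)
    have h4 : a * a = D * (D * D') := hinj (by
      rw [map_mul, ha, h, map_mul, map_natCast, ← hS, hy]; ring)
    have h5 : (a : K) * a = D * (D * D') := by exact_mod_cast congrArg (algebraMap (𝓞 K) K) h4
    have h6 : (D : K) ≠ 0 := by exact_mod_cast hD0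
    field_simp
    linear_combination -h5

end NonSquare

section Unramified

variable {L M : Type*} [Field L] [NumberField L] [Field M] [NumberField M] [Algebra L M]
  {σ : M ≃ₐ[L] M}

omit [NumberField L] in
theorem mem_of_sq_eq_sq_add_four_mul {A : 𝓞 M} (hcA : conjInt σ A = -A) {r g : 𝓞 L}
    (hA : A ^ 2 = algebraMap (𝓞 L) (𝓞 M) (r ^ 2 + 4 * g)) {P : Ideal (𝓞 M)}
    (hP : ∀ x, conjInt σ x - x ∈ P) : A ∈ P := by
  set r' : M := algebraMap L M r
  have hA' : (A : M) ^ 2 = r' ^ 2 + 4 * algebraMap L M g := by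
    have := congrArg (algebraMap (𝓞 M) M) hA
    rw [map_pow, map_add, map_pow, map_mul, map_ofNat] at this
    rw [map_add, map_pow, map_mul, map_ofNat] at this
    exact this
  have hint : IsIntegral ℤ ((r' + A) / 2 : M) := by
    have hr : IsIntegral (𝓞 L) ((r' + A) / 2 : M) := by
      refine ⟨Polynomial.X ^ 2 - (Polynomial.C r * Polynomial.X + Polynomial.C g), ?_, ?_⟩
      · refine Polynomial.monic_X_pow_sub ?_
        compute_degree!
      · simp only [Polynomial.eval₂_sub, Polynomial.eval₂_add, Polynomial.eval₂_mul,
          Polynomial.eval₂_pow, Polynomial.eval₂_X, Polynomial.eval₂_C]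
        change _ - (r' * _ + algebraMap L M g) = 0
        linear_combination hA' / 4
    exact isIntegral_trans _ hr
  have hfix : σ r' = r' := σ.commutes _
  have h1 : σ (A : M) = -A := congrArg (algebraMap (𝓞 M) M) hcA
  have h2 : conjInt σ ⟨_, hint⟩ - ⟨_, hint⟩ = -A := by
    apply RingOfIntegers.ext
    change σ ((r' + A) / 2) - (r' + A) / 2 = -(A : M)
    rw [map_div₀, map_add, hfix, h1, map_ofNat]
    ring
  rw [← neg_mem_iff, ← h2]
  exact hP _

omit [NumberField L] in
theorem ramifiedPrimes_eq_empty {A B : 𝓞 M} (hcA : conjInt σ A = -A)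
    (hcB : conjInt σ B = -B) {D D' r r' g g' : 𝓞 L} (hD : D = r ^ 2 + 4 * g)
    (hD' : D' = r' ^ 2 + 4 * g') (hDD : IsCoprime D D')
    (hA : A ^ 2 = algebraMap (𝓞 L) (𝓞 M) D) (hB : B ^ 2 = algebraMap (𝓞 L) (𝓞 M) D') :
    ramifiedPrimes σ = ∅ := by
  rw [Set.eq_empty_iff_forall_notMem]
  rintro - ⟨P, hP, h, -⟩
  have h1 : A ∈ (P : Ideal (𝓞 M)) := mem_of_sq_eq_sq_add_four_mul hcA (hD ▸ hA) h
  have h2 : B ∈ (P : Ideal (𝓞 M)) := mem_of_sq_eq_sq_add_four_mul hcB (hD' ▸ hB) h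
  obtain ⟨x, y, hxy⟩ := hDD
  refine hP.one_notMem ?_
  rw [← map_one (algebraMap (𝓞 L) (𝓞 M)), ← hxy, map_add, map_mul, map_mul, ← hA, ← hB]
  exact add_mem (Ideal.mul_mem_left _ _ (Ideal.pow_mem_of_mem _ h1 2 two_pos))
    (Ideal.mul_mem_left _ _ (Ideal.pow_mem_of_mem _ h2 2 two_pos))

theorem exists_split_prime [IsGalois L M] (h2 : Module.finrank L M = 2) (hσ : σ ≠ 1) {A : 𝓞 M}
    (hcA : conjInt σ A = -A) {D r : 𝓞 L} (hA : A ^ 2 = algebraMap (𝓞 L) (𝓞 M) D)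
    {Q : Ideal (𝓞 L)} [Q.IsPrime] (hQ : Q ≠ ⊥) (h2Q : (2 : 𝓞 L) ∉ Q) (hDQ : D ∉ Q)
    (hr : D - r ^ 2 ∈ Q) :
    ∃ P : Ideal (𝓞 M), P.IsPrime ∧ conjIdeal σ P ≠ P ∧
      P * conjIdeal σ P = Q.map (algebraMap (𝓞 L) (𝓞 M)) := by
  have hQm : Q.IsMaximal := ‹Q.IsPrime›.isMaximal hQ
  obtain ⟨P, hP, hPQ⟩ : ∃ P : Ideal (𝓞 M), P.IsPrime ∧ P.under (𝓞 L) = Q := by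
    obtain ⟨P, hP, hlies⟩ := Ideal.exists_maximal_ideal_liesOver_of_isIntegral (S := 𝓞 M) Q
    exact ⟨P, hP.isPrime, hlies.over.symm⟩
  have hP0 : P ≠ ⊥ := by
    rintro rfl
    exact hQ (by rw [← hPQ, Ideal.under_bot])
  have hmem (x : 𝓞 L) : algebraMap (𝓞 L) (𝓞 M) x ∈ P ↔ x ∈ Q := by
    rw [← hPQ, Ideal.mem_under]
  set r' := algebraMap (𝓞 L) (𝓞 M) r with hr'
  have hrQ : r' ∉ P := by
    rw [hr', hmem]
    intro h
    refine hDQ ?_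
    have := Q.add_mem hr (Ideal.pow_mem_of_mem _ h 2 two_pos)
    rwa [sub_add_cancel] at this
  have h2P : (2 : 𝓞 M) ∉ P := by
    rw [← map_ofNat (algebraMap (𝓞 L) (𝓞 M)), hmem]; exact h2Q
  have hfix : conjInt σ r' = r' := RingOfIntegers.ext (σ.commutes (r : L))
  have hprod : (A - r') * (A + r') ∈ P := by
    have : (A - r') * (A + r') = algebraMap (𝓞 L) (𝓞 M) (D - r ^ 2) := by
      rw [map_sub, ← hA, map_pow]; ring
    rw [this, hmem]
    exact hr
  have hne : conjIdeal σ P ≠ P := by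
    intro h
    have hconj {x : 𝓞 M} (hx : x ∈ P) : conjInt σ x ∈ P := by
      have := Ideal.mem_map_of_mem (conjInt σ) hx
      rwa [show P.map (conjInt σ) = P from h] at this
    have h2r : 2 * r' ∈ P := by
      rcases hP.mem_or_mem hprod with h1 | h1
      · have := P.add_mem h1 (hconj h1)
        rw [map_sub, hcA, hfix] at this
        rw [← neg_mem_iff]
        convert this using 1
        ring
      · have := P.add_mem h1 (hconj h1)
        rw [map_add, hcA, hfix] at this
        convert this using 1
        ring
    exact (hP.mem_or_mem h2r).elim h2P hrQ
  refine ⟨P, hP, hne, ?_⟩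
  rcases prime_trichotomy h2 hσ P hP0 with h | h
  · refine absurd ?_ hne
    rw [h, conjIdeal, Ideal.map_map]
    congr 1
    ext x
    exact σ.commutes (x : L)
  · rw [h.1, hPQ]

end Unramified

section ResidueSquare

variable {L : Type*} [Field L] [NumberField L]

/-- An element of the prime field of the residue field is a square modulo `Q`. -/
theorem exists_sub_sq_mem_of_pow_sub_self_mem {q : ℕ} (hq : q.Prime) (hq4 : q % 4 = 3)
    {Q : Ideal (𝓞 L)} [Q.IsPrime] (hQ : Q ≠ ⊥) (hQN : Q.absNorm = q ^ 2) {D : 𝓞 L}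
    (hD : D ^ q - D ∈ Q) : ∃ r, D - r ^ 2 ∈ Q := by
  have hQm : Q.IsMaximal := ‹Q.IsPrime›.isMaximal hQ
  let := Ideal.Quotient.field Q
  have : Finite (𝓞 L ⧸ Q) := Ideal.finiteQuotientOfFreeOfNeBot Q hQ
  have := Fintype.ofFinite (𝓞 L ⧸ Q)
  have hcard : Fintype.card (𝓞 L ⧸ Q) = q ^ 2 := by
    rw [← hQN, Ideal.absNorm_apply, Submodule.cardQuot_apply, Nat.card_eq_fintype_card]
  let φ := Ideal.Quotient.mk Q
  by_cases hD0 : D ∈ Q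
  · exact ⟨0, by rwa [zero_pow two_ne_zero, sub_zero]⟩
  have hφD : φ D ≠ 0 := by rwa [Ne, Ideal.Quotient.eq_zero_iff_mem]
  have h1 : φ D ^ (q - 1) = 1 := by
    refine mul_right_cancel₀ hφD ?_
    rw [← pow_succ, Nat.sub_add_cancel hq.one_le, one_mul, ← map_pow]
    exact (Ideal.Quotient.mk_eq_mk_iff_sub_mem _ _).mpr hD
  have hsq : IsSquare (φ D) := by
    rw [FiniteField.isSquare_iff ?_ hφD, hcard]
    · obtain ⟨k, rfl⟩ : ∃ k, q = 2 * k + 1 := ⟨q / 2, by omega⟩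
      have : (2 * k + 1) ^ 2 / 2 = (2 * k + 1 - 1) * (k + 1) := by
        rw [Nat.add_sub_cancel, show (2 * k + 1) ^ 2 = 2 * (2 * k * (k + 1)) + 1 by ring]
        omega
      rw [this, pow_mul, h1, one_pow]
    · intro h
      have h2 := FiniteField.even_card_of_char_two h
      rw [hcard, Nat.pow_mod] at h2
      have : q % 2 = 1 := by omega
      rw [this] at h2
      omega
  obtain ⟨y, hy⟩ := hsq
  obtain ⟨r, rfl⟩ := Ideal.Quotient.mk_surjective y
  refine ⟨r, ?_⟩
  rw [← Ideal.Quotient.mk_eq_mk_iff_sub_mem, map_pow, sq]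
  exact hy

theorem absNorm_eq_sq_of_absNorm_le (E : Type*) [Field E] [NumberField E] [Algebra E L]
    [IsCyclotomicExtension {4} ℚ E] {q : ℕ} (hq : q.Prime) (hq4 : q % 4 = 3)
    (P : Ideal (𝓞 L)) [P.IsPrime] (hqP : (q : 𝓞 L) ∈ P) (hP0 : P ≠ ⊥)
    (hPN : P.absNorm ≤ q ^ 2) : P.absNorm = q ^ 2 := by
  rw [← Ideal.absNorm_relNorm (𝓞 E), relNorm_eq_span_of_absNorm_le hq hq4 P hqP hP0 hPN,
    Ideal.absNorm_span_natCast, RingOfIntegers.rank, finrank_gaussianField]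

end ResidueSquare

section QuadraticExtension

universe u

theorem exists_quadratic_extension {L : Type u} [Field L] [NumberField L] {d : L}
    (hd : ¬ IsSquare d) :
    ∃ (M : Type u) (_ : Field M) (_ : NumberField M) (_ : Algebra L M),
      Module.finrank L M = 2 ∧ ∃ x : M, x ^ 2 = algebraMap L M d := by
  have hirr : Fact (Irreducible (Polynomial.X ^ 2 - Polynomial.C d)) := by
    refine ⟨(X_pow_sub_C_irreducible_iff_of_prime Nat.prime_two).mpr fun b hb => hd ⟨b, ?_⟩⟩
    rw [← hb, sq]
  have hne := hirr.out.ne_zero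
  have hfr : Module.finrank L (AdjoinRoot (Polynomial.X ^ 2 - Polynomial.C d)) = 2 := by
    rw [(AdjoinRoot.powerBasis hne).finrank, AdjoinRoot.powerBasis_dim,
      Polynomial.natDegree_X_pow_sub_C]
  have : FiniteDimensional L (AdjoinRoot (Polynomial.X ^ 2 - Polynomial.C d)) :=
    Module.finite_of_finrank_pos (by omega)
  refine ⟨AdjoinRoot (Polynomial.X ^ 2 - Polynomial.C d), inferInstance,
    NumberField.of_module_finite L _, inferInstance, hfr, AdjoinRoot.root _, ?_⟩
  have := AdjoinRoot.eval₂_root (Polynomial.X ^ 2 - Polynomial.C d)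
  rw [Polynomial.eval₂_sub, Polynomial.eval₂_X_pow, Polynomial.eval₂_C, sub_eq_zero] at this
  exact this

end QuadraticExtension

section Parity

variable {K : Type*} [Field K] [NumberField K]

theorem exists_parity (P : (Ideal (𝓞 K))⁰) (hP : (P : Ideal (𝓞 K)).IsPrime) :
    ∃ φ : IdealGroup K →* Multiplicative (ZMod 2),
      φ (FractionalIdeal.mk0 K P) = Multiplicative.ofAdd 1 ∧
      ∀ P' : (Ideal (𝓞 K))⁰, (P' : Ideal (𝓞 K)).IsPrime → P' ≠ P →
        φ (FractionalIdeal.mk0 K P') = 1 := by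
  let v : IsDedekindDomain.HeightOneSpectrum (𝓞 K) := ⟨P, hP, nonZeroDivisors.ne_zero P.2⟩
  let ψ : IdealGroup K →* Multiplicative ℤ :=
    { toFun := fun I => Multiplicative.ofAdd (FractionalIdeal.count K v I)
      map_one' := by rw [Units.val_one, FractionalIdeal.count_one, ofAdd_zero]
      map_mul' := fun I J => by
        rw [Units.val_mul, FractionalIdeal.count_mul K v I.ne_zero J.ne_zero, ofAdd_add] }
  refine ⟨(AddMonoidHom.toMultiplicative (Int.castAddHom (ZMod 2))).comp ψ, ?_, ?_⟩
  · change Multiplicative.ofAdd ((FractionalIdeal.count K v (v.asIdeal : FractionalIdeal _ K) : ℤ) :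
      ZMod 2) = _
    rw [FractionalIdeal.count_self, Int.cast_one]
  · intro P' hP' hne
    let w : IsDedekindDomain.HeightOneSpectrum (𝓞 K) := ⟨P', hP', nonZeroDivisors.ne_zero P'.2⟩
    have hw : w ≠ v := fun h => hne (Subtype.ext (congrArg (·.asIdeal) h))
    change Multiplicative.ofAdd ((FractionalIdeal.count K v (w.asIdeal : FractionalIdeal _ K) : ℤ) :
      ZMod 2) = _
    rw [FractionalIdeal.count_maximal_coprime K v hw, Int.cast_zero, ofAdd_zero]

theorem squares_le_ker_of_zmod_two {A : Type*} [CommGroup A] (φ : A →* Multiplicative (ZMod 2)) :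
    squares A ≤ φ.ker := by
  rintro - ⟨a, rfl⟩
  have (z : Multiplicative (ZMod 2)) : z ^ 2 = 1 := by revert z; decide
  rw [MonoidHom.mem_ker, powMonoidHom_apply, map_pow, this]

theorem four_le_relIndex_squares {A : Type*} [CommGroup A] {φ ψ : A →* Multiplicative (ZMod 2)}
    {a b : A} (ha : φ a = Multiplicative.ofAdd 1) (hb : φ b = 1)
    (ha' : ψ a = 1) (hb' : ψ b = Multiplicative.ofAdd 1) :
    4 ≤ (squares A).relIndex (squares A ⊔ Subgroup.closure {a, b}) := by
  classical
  rw [Subgroup.relIndex_sup_left]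
  have h0 := (relIndex_closure_le (squares A) le_rfl {a, b}).1
  rw [Finset.coe_pair] at h0
  have hle : squares A ≤ (φ.prod ψ).ker := by
    rw [MonoidHom.ker_prod]
    exact le_inf (squares_le_ker_of_zmod_two φ) (squares_le_ker_of_zmod_two ψ)
  have hdvd := Nat.le_of_dvd (Nat.pos_of_ne_zero h0)
    (Subgroup.relIndex_dvd_of_le_left (Subgroup.closure {a, b}) hle)
  refine le_trans (le_of_eq ?_) hdvd
  rw [Subgroup.relIndex_ker]
  have htop : (Subgroup.closure {a, b}).map (φ.prod ψ) = ⊤ := by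
    rw [eq_top_iff]
    have h1 (z : Multiplicative (ZMod 2)) : ∃ n : ℕ, z = Multiplicative.ofAdd 1 ^ n :=
      ⟨z.toAdd.val, by revert z; decide⟩
    rintro ⟨x, y⟩ -
    obtain ⟨m, rfl⟩ := h1 x
    obtain ⟨n, rfl⟩ := h1 y
    refine ⟨a ^ m * b ^ n, mul_mem (pow_mem (Subgroup.subset_closure (by simp)) _)
      (pow_mem (Subgroup.subset_closure (by simp)) _), ?_⟩
    simp [ha, hb, ha', hb']
  rw [htop, Subgroup.card_top, Nat.card_prod]
  simp

end Parity

section Descent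

theorem zpow_mul_zpow_add_two_mul {A : Type*} [CommGroup A] (a b : A) (m k : ℤ) :
    a ^ m * b ^ (m + 2 * k) = (b ^ k) ^ 2 * (a * b) ^ m := by
  rw [mul_zpow, zpow_add, two_mul, zpow_add, sq]
  ac_rfl

theorem zpow_mul_zpow_mul_swap {A : Type*} [CommGroup A] (a b : A) (m n : ℤ) :
    a ^ m * b ^ n * (b ^ m * a ^ n) = (a * b) ^ (m + n) := by
  rw [mul_zpow, zpow_add, zpow_add]
  ac_rfl

variable {L M : Type*} [Field L] [NumberField L] [Field M] [NumberField M] [Algebra L M]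
  [IsGalois L M] [IsTotallyComplex L]

theorem squares_sup_zpowers_ne_top (h2 : Module.finrank L M = 2) {σ : M ≃ₐ[L] M} (hσ : σ ≠ 1)
    (s : Mˣ) (d : Lˣ) (hs : s ^ 2 = unitsEmb L M d) (hsσ : σ s = -s)
    (hR : ramifiedPrimes σ = ∅) (Q : (Ideal (𝓞 L))⁰) (P : Ideal (𝓞 M)) (hP : P.IsPrime)
    (hne : conjIdeal σ P ≠ P)
    (hPQ : P * conjIdeal σ P = (Q : Ideal (𝓞 L)).map (algebraMap (𝓞 L) (𝓞 M))) :
    squares (ClassGroup (𝓞 L)) ⊔ Subgroup.zpowers (ClassGroup.mk0 Q) ≠ ⊤ := by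
  classical
  intro htop
  obtain ⟨N, hN⟩ : ∃ N, Module.finrank ℚ L = 2 * N := ⟨_, (rank_add_one L).symm⟩
  have hNM : Module.finrank ℚ M = 2 * (2 * N) := by
    rw [← Module.finrank_mul_finrank ℚ L M, hN, h2]; ring
  have : IsTotallyComplex M := isTotallyComplex_of_algebra L M
  have hP0 : P ≠ ⊥ := by
    rintro rfl
    exact hne Ideal.map_bot
  lift P to (Ideal (𝓞 M))⁰ using mem_nonZeroDivisors_of_ne_zero hP0
  obtain ⟨P', hP', hPP'⟩ := exists_conjMap_mk0_eq σ P
  have hP'p : (P' : Ideal (𝓞 M)).IsPrime := by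
    rw [hP']
    exact Ideal.map_isPrime_of_equiv (RingOfIntegers.mapRingEquiv σ.toRingEquiv)
  set a := FractionalIdeal.mk0 M P
  set b := FractionalIdeal.mk0 M P'
  have hba : conjMap σ b = a := by rw [← hPP', conjMap_conjMap _ h2]
  have hab : a * b = extMap L M (FractionalIdeal.mk0 L Q) := by
    rw [extMap_mk0 (P := P * P') (by rw [← hPQ, ← hP']; rfl), map_mul]
  obtain ⟨φ, hφa, hφb⟩ := exists_parity P hP
  obtain ⟨ψ, hψb, hψa⟩ := exists_parity P' hP'p
  have hPne : P' ≠ P := fun h => hne (by rw [← hP', h])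
  replace hφa : φ a = Multiplicative.ofAdd 1 := hφa
  replace hφb : φ b = 1 := hφb P' hP'p hPne
  replace hψa : ψ a = 1 := hψa P hP hPne.symm
  set TL := Subgroup.zpowers (FractionalIdeal.mk0 L Q)
  set TM := Subgroup.closure {a, b}
  have hM := relIndex_squares_selmer TM hNM
  have hL := relIndex_squares_selmer TL hN
  have h4 := four_le_relIndex_squares hφa hφb hψa hψb
  have hidx : 1 ≤ (squares (ClassGroup (𝓞 M)) ⊔ TM.map (idealClass M)).index :=
    Nat.one_le_iff_ne_zero.mpr Subgroup.index_ne_zero_of_finite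
  have hTL := relIndex_closure_le (squares (IdealGroup L)) le_rfl {FractionalIdeal.mk0 L Q}
  rw [Finset.coe_singleton, ← Subgroup.zpowers_eq_closure, Finset.card_singleton] at hTL
  rw [MonoidHom.map_zpowers, idealClass_mk0, htop, Subgroup.index_top, mul_one,
    Subgroup.relIndex_sup_left] at hL
  have hL0 : (squares Lˣ).relIndex (selmer TL) ≠ 0 := by
    rw [hL]
    exact mul_ne_zero (pow_ne_zero _ two_ne_zero) hTL.1
  have hTM {t : IdealGroup M} (ht : t ∈ TM) : ∃ m n : ℤ, a ^ m * b ^ n = t :=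
    Subgroup.mem_closure_pair.mp ht
  have key := relIndex_selmer_mul_two_le h2 hσ s d hs hsσ ∅ (by rw [hR]; exact Set.empty_subset _)
    TL TM ?_ ?_ (selmer TL) (fun x hx y hy => mem_selmer_of_eq_norm h2 hσ ?_ x hx y hy) hL0 hL0
  · rw [hL, hM, Finset.card_empty, pow_zero, mul_one] at key
    have h5 : 2 ^ N * (squares (IdealGroup L)).relIndex TL ≤ 2 ^ N * 2 :=
      Nat.mul_le_mul_left _ (by simpa using hTL.2)
    have h6 : 2 ^ (2 * N) * 4 * 1 * 2 ≤ (2 ^ N * 2) * (2 ^ N * 2) :=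
      le_trans (Nat.mul_le_mul_right _ (Nat.mul_le_mul (Nat.mul_le_mul_left _ h4) hidx))
        (key.trans (Nat.mul_le_mul h5 h5))
    have h7 : 2 ^ (2 * N) = 2 ^ N * 2 ^ N := by rw [two_mul, pow_add]
    have h8 : 0 < 2 ^ N * 2 ^ N := by positivity
    rw [h7] at h6
    nlinarith
  · rw [MonoidHom.map_zpowers, ← hab, Subgroup.zpowers_le]
    exact Subgroup.mem_sup_right (mul_mem (Subgroup.subset_closure (by simp))
      (Subgroup.subset_closure (by simp)))
  · intro t ht hsq
    obtain ⟨m, n, rfl⟩ := hTM ht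
    have h1 := squares_le_ker_of_zmod_two φ hsq
    rw [MonoidHom.mem_ker] at h1
    simp only [map_mul, map_inv, map_zpow, hPP', hba, hφa, hφb, one_zpow, one_mul, mul_one] at h1
    obtain ⟨k, hk⟩ : ∃ k, n = m + 2 * k := by
      rw [← ofAdd_zsmul, ← ofAdd_zsmul, ← ofAdd_neg, ← ofAdd_add, ofAdd_eq_one] at h1
      have h3 : ((n - m : ℤ) : ZMod 2) = 0 := by
        push_cast
        rw [← h1]
        simp [sub_eq_add_neg]
      obtain ⟨k, hk⟩ := (ZMod.intCast_zmod_eq_zero_iff_dvd _ 2).mp h3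
      exact ⟨k, by push_cast at hk; omega⟩
    refine ⟨b ^ k, _, Subgroup.zpow_mem_zpowers _ m, ?_⟩
    rw [map_zpow, ← hab, hk]
    exact zpow_mul_zpow_add_two_mul a b m k
  · intro t ht
    obtain ⟨m, n, rfl⟩ := hTM ht
    refine ⟨_, Subgroup.mem_sup_right (Subgroup.zpow_mem_zpowers _ (m + n)), ?_⟩
    rw [map_mul, map_zpow, map_zpow, map_zpow, hPP', hba, ← hab]
    exact zpow_mul_zpow_mul_swap a b m n

end Descent

theorem pow_eq_self_of_intCast_add_mul {A : Type*} [CommRing A] {w : A} (hw : w ^ 4 = -1) {q : ℕ}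
    [Fact q.Prime] [CharP A q] (hq : q % 8 = 7) (c d : ℤ) :
    ((c : A) + d * (w - w ^ 3)) ^ q = c + d * (w - w ^ 3) := by
  rw [← frobenius_def, map_add, map_mul, map_intCast, map_intCast, frobenius_def,
    sub_pow_three_pow_prime hw hq]

theorem exists_isCoprime_two_mul {c d : ℤ} {p : ℕ} (hp : p.Prime) (hp2 : p ≠ 2)
    (hcd : c ^ 2 - 2 * d ^ 2 = p) : IsCoprime (2 * c) (p : ℤ) := by
  have hpp := Nat.prime_iff_prime_int.mp hp
  rw [isCoprime_comm, hpp.irreducible.coprime_iff_not_dvd, hpp.dvd_mul]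
  have h2 : ¬ (p : ℤ) ∣ 2 := by
    intro h
    exact hp2 ((Nat.prime_dvd_prime_iff_eq hp Nat.prime_two).mp (by exact_mod_cast h))
  rintro (h | h)
  · exact h2 h
  · have h3 : (p : ℤ) ∣ 2 * d ^ 2 := by
      rw [show 2 * d ^ 2 = c * c - p by linear_combination -hcd]
      exact dvd_sub (h.mul_right c) dvd_rfl
    obtain ⟨x, rfl⟩ := h
    obtain ⟨y, rfl⟩ := hpp.dvd_of_dvd_pow ((hpp.dvd_mul.mp h3).resolve_left h2)
    refine hpp.not_isUnit (isUnit_of_dvd_one ⟨x ^ 2 - 2 * y ^ 2, ?_⟩)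
    refine mul_left_cancel₀ hpp.ne_zero ?_
    linear_combination -hcd

theorem exists_prime_nonresidue {p m : ℕ} [Fact p.Prime] (hp2 : p ≠ 2) (hpm : m.Coprime p)
    (hm : m ≠ 0) : ∃ q : ℕ, q.Prime ∧ (q + 1) % m = 0 ∧ ¬ IsSquare (q : ZMod p) := by
  obtain ⟨a, ha⟩ := FiniteField.exists_nonsquare (F := ZMod p) (by rwa [ZMod.ringChar_zmod_n])
  have ha0 : a ≠ 0 := by
    rintro rfl
    exact ha IsSquare.zero
  obtain ⟨x, hx1, hx2⟩ := Nat.chineseRemainder hpm (m - 1) a.val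
  have hmp : m * p ≠ 0 := mul_ne_zero hm (Fact.out : p.Prime).ne_zero
  have : NeZero (m * p) := ⟨hmp⟩
  have hu : IsUnit (x : ZMod (m * p)) := by
    rw [ZMod.isUnit_iff_coprime, Nat.coprime_mul_iff_right]
    constructor
    · rw [Nat.coprime_iff_gcd_eq_one, hx1.gcd_eq]
      exact (Nat.coprime_self_sub_left (Nat.one_le_iff_ne_zero.mpr hm)).mpr (Nat.coprime_one_left m)
    · rw [Nat.coprime_iff_gcd_eq_one, hx2.gcd_eq]
      refine (ZMod.isUnit_iff_coprime a.val p).mp ?_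
      rwa [ZMod.natCast_zmod_val, isUnit_iff_ne_zero]
  obtain ⟨q, -, hq, hqx⟩ := Nat.forall_exists_prime_gt_and_eq_mod hu 0
  have hqx' := (ZMod.natCast_eq_natCast_iff _ _ _).mp hqx
  refine ⟨q, hq, ?_, ?_⟩
  · have := ((hqx'.of_mul_right p).trans hx1).add_right 1
    rw [Nat.sub_add_cancel (Nat.one_le_iff_ne_zero.mpr hm)] at this
    exact Eq.trans (show (q + 1) % m = m % m from this) (Nat.mod_self m)
  · have := (ZMod.natCast_eq_natCast_iff _ _ _).mpr ((hqx'.of_mul_left m).trans hx2)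
    rwa [this, ZMod.natCast_zmod_val]

theorem exists_ringHom_zeta_pow (K : Type*) [Field K] [NumberField K] (j : ℕ)
    [IsCyclotomicExtension {2 ^ (j + 3)} ℚ K] :
    ∃ (w : 𝓞 K) (τ : 𝓞 K →+* 𝓞 K), w ^ 4 = -1 ∧ τ w = -w := by
  have hz := IsCyclotomicExtension.zeta_spec (2 ^ (j + 3)) ℚ K
  set z := hz.toInteger
  have hzi : IsPrimitiveRoot z (2 ^ (j + 3)) := hz.toInteger_isPrimitiveRoot
  have hw : (z ^ 2 ^ j) ^ 4 = -1 := by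
    have h1 : IsPrimitiveRoot ((z ^ 2 ^ j) ^ 4) 2 :=
      (hzi.pow (by positivity) (pow_add 2 j 3)).pow (by norm_num) (by norm_num : 2 ^ 3 = 4 * 2)
    exact h1.eq_neg_one_of_two_right
  have hz5 := hz.pow_of_coprime 5 (Nat.Coprime.pow_right _ (by norm_num))
  let τ := IsCyclotomicExtension.fromZetaAut hz5
    (Polynomial.cyclotomic.irreducible_rat (by positivity))
  have hτ : τ (IsCyclotomicExtension.zeta (2 ^ (j + 3)) ℚ K) = _ :=
    IsCyclotomicExtension.fromZetaAut_spec hz5 _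
  refine ⟨z ^ 2 ^ j, RingOfIntegers.mapRingHom (τ : K →+* K), hw, ?_⟩
  rw [map_pow]
  have : RingOfIntegers.mapRingHom (τ : K →+* K) z = z ^ 5 := RingOfIntegers.ext hτ
  rw [this, ← pow_mul, mul_comm, pow_mul, pow_succ, hw, neg_one_mul]

theorem sup_zpowers_eq_top_of_index_le_two {A : Type*} [CommGroup A] [Finite A] {H : Subgroup A}
    (hH : H.index ≤ 2) {a : A} (ha : a ∉ H) : H ⊔ Subgroup.zpowers a = ⊤ := by
  have h := Subgroup.relIndex_mul_index (le_sup_left : H ≤ H ⊔ Subgroup.zpowers a)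
  have h0 : H.index ≠ 0 := Subgroup.index_ne_zero_of_finite
  have h1 : H.relIndex (H ⊔ Subgroup.zpowers a) ≠ 1 := by
    rw [Ne, Subgroup.relIndex_eq_one]
    exact fun hle => ha (hle (Subgroup.mem_sup_right (Subgroup.mem_zpowers a)))
  have h2 : H.relIndex (H ⊔ Subgroup.zpowers a) ≠ 0 := by
    intro h3
    rw [h3, zero_mul] at h
    exact h0 h.symm
  have h4 : 2 ≤ H.relIndex (H ⊔ Subgroup.zpowers a) := by omega
  rw [← Subgroup.index_eq_one]
  have h5 : (H ⊔ Subgroup.zpowers a).index ≠ 0 := Subgroup.index_ne_zero_of_finite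
  nlinarith [Nat.pos_of_ne_zero h5]

section LowerBound

variable {K L : Type*} [Field K] [NumberField K] [Field L] [NumberField L] [Algebra K L]

theorem two_lt_index_squares_classGroup (E : Type*) [Field E] [NumberField E] [Algebra E K]
    [Algebra E L] [IsScalarTower E K L] [IsGalois E K] [IsGalois K L]
    [IsCyclotomicExtension {4} ℚ E] {j : ℕ} [IsCyclotomicExtension {2 ^ (j + 3)} ℚ K]
    {p : ℕ} [hp : Fact p.Prime] (h2 : Module.finrank K L = 2) {σ : L ≃ₐ[K] L} (hσ : σ ≠ 1)
    (hp8 : p % 8 = 1) {S : 𝓞 L} (hS : S ^ 2 = p) (hcS : conjInt σ S = -S) :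
    2 < (squares (ClassGroup (𝓞 L))).index := by
  have hζ := IsCyclotomicExtension.zeta_spec (2 ^ (j + 3)) ℚ K
  have hp2 : Nat.Coprime 2 p := (Nat.coprime_primes Nat.prime_two hp.out).mpr (by omega)
  have hmp : (2 ^ (j + 3)).Coprime p := hp2.pow_left _
  have hpm := hmp.symm
  obtain ⟨q, hq, hqm, hqp⟩ := exists_prime_nonresidue (p := p) (by omega) hmp (by positivity)
  have : Fact q.Prime := ⟨hq⟩
  have hq8 : q % 8 = 7 := by
    have h8 : 8 ∣ q + 1 := dvd_trans ⟨2 ^ j, by ring⟩ (Nat.dvd_of_mod_eq_zero hqm)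
    omega
  have hpq : p ≠ q := by
    rintro rfl
    omega
  have hq2m : q ^ 2 ≡ 1 [MOD 2 ^ (j + 3)] := by
    refine (Nat.modEq_of_dvd ?_).symm
    push_cast
    rw [show (q : ℤ) ^ 2 - 1 = (q + 1) * (q - 1) by ring]
    exact Dvd.dvd.mul_right (by exact_mod_cast Nat.dvd_of_mod_eq_zero hqm) _
  -- a prime of `L` above `q`
  obtain ⟨Q, hQm, hqQ⟩ := exists_max_ideal_of_mem_nonunits (a := (q : 𝓞 L)) (by
    intro h
    rw [← map_natCast (algebraMap ℤ (𝓞 L)), isUnit_map_iff] at h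
    exact hq.ne_one (Nat.isUnit_iff.mp (Int.ofNat_isUnit.mp (by exact_mod_cast h))))
  have hQp := hQm.isPrime
  have hQ0 : Q ≠ ⊥ := by
    rintro rfl
    exact hq.ne_zero (by exact_mod_cast (Ideal.mem_bot.mp hqQ))
  have hQN : Q.absNorm ≤ q ^ 2 :=
    absNorm_le_of_pow_sub_self_mem hQ0 (Nat.one_lt_pow two_ne_zero hq.one_lt)
      (pow_natCast_sq_sub_self_mem h2 hσ hζ hp.out hq (Nat.odd_iff.mpr (by omega)) hpq hq2m hS hcS
        hqQ)
  have hQN' := absNorm_eq_sq_of_absNorm_le E hq (by omega) Q hqQ hQ0 hQN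
  have hpQ : (p : 𝓞 L) ∉ Q :=
    natCast_notMem_of_coprime hqQ ((Nat.coprime_primes hp.out hq).mpr hpq)
  have h2Q : (2 : 𝓞 L) ∉ Q := by
    have := natCast_notMem_of_coprime hqQ ((Nat.coprime_primes Nat.prime_two hq).mpr (by omega))
    rwa [Nat.cast_ofNat] at this
  have hchar : CharP (𝓞 L ⧸ Q) q := by
    refine charP_of_prime_of_natCast_eq_zero hq ?_
    rwa [← map_natCast (Ideal.Quotient.mk Q), Ideal.Quotient.eq_zero_iff_mem]
  -- the element `c + d√2` of norm `p`
  obtain ⟨c, d, hcd⟩ := hp.out.exists_sq_sub_two_mul_sq hp8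
  obtain ⟨w, τ, hw, hτ⟩ := exists_ringHom_zeta_pow K j
  obtain ⟨D, hD⟩ : ∃ D, D = c + d * (w - w ^ 3) := ⟨_, rfl⟩
  obtain ⟨D', hD'⟩ : ∃ D', D' = c + (-d : ℤ) * (w - w ^ 3) := ⟨_, rfl⟩
  have hcd' : ((c : ℤ) : 𝓞 K) ^ 2 - 2 * d ^ 2 = p := by exact_mod_cast congrArg (Int.cast) hcd
  have hDD : D * D' = p := by
    rw [hD, hD', ← hcd']
    push_cast
    linear_combination -(d : 𝓞 K) ^ 2 * sub_pow_three_sq hw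
  have hτD : τ D = D' := by
    rw [hD, hD']
    simp only [map_add, map_mul, map_sub, map_pow, map_intCast, hτ]
    push_cast
    ring
  have hτD' : τ D' = D := by
    rw [hD, hD']
    simp only [map_add, map_mul, map_sub, map_pow, map_intCast, hτ]
    push_cast
    ring
  have hDns := not_isSquare_of_mul_eq_natCast hζ hp.out hpm hDD τ hτD
  have hDns' := not_isSquare_of_mul_eq_natCast hζ hp.out hpm ((mul_comm _ _).trans hDD) τ hτD'
  obtain ⟨r, g, hrg⟩ := exists_eq_sq_add_four_mul hw hp8 hcd
  obtain ⟨r', g', hrg'⟩ := exists_eq_sq_add_four_mul hw (c := c) (d := -d) hp8 (by rw [neg_sq, hcd])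
  have hcop : IsCoprime D D' := by
    obtain ⟨u, v, huv⟩ := exists_isCoprime_two_mul hp.out (by omega) hcd
    have huv' : (u : 𝓞 K) * (2 * c) + v * p = 1 := by exact_mod_cast congrArg (Int.cast) huv
    refine ⟨u + v * D', u, ?_⟩
    rw [← huv', ← hDD, hD, hD']
    push_cast
    ring
  let f := algebraMap (𝓞 K) (𝓞 L)
  have hDL := not_isSquare_algebraMap h2 hσ hS hcS hp.out.ne_zero hDD hDns hDns'
  obtain ⟨M, _, _, _, hM2, x, hx⟩ := exists_quadratic_extension (d := (f D : L))
    (fun h => hDL (isSquare_of_isSquare_coe h))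
  have : IsGalois L M := isGalois_of_finrank_eq_two hM2
  obtain ⟨ρ, hρ, hρx⟩ := exists_conj_of_sq hM2 hx (fun h => hDL (isSquare_of_isSquare_coe h))
  have hxD : x ^ 2 = algebraMap (𝓞 L) M (f D) := hx
  have hSM : (algebraMap (𝓞 L) M S) ^ 2 = algebraMap (𝓞 L) M (f D) * algebraMap (𝓞 L) M (f D') := by
    rw [← map_pow, hS, ← map_mul, ← map_mul, hDD, map_natCast, map_natCast, map_natCast]
  have hD0 : algebraMap (𝓞 L) M (f D) ≠ 0 := by
    intro h
    refine hDL ?_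
    rw [(map_eq_zero_iff _ (FaithfulSMul.algebraMap_injective (𝓞 L) M)).mp h]
    exact IsSquare.zero
  have hx0 : x ≠ 0 := by
    rintro rfl
    exact hD0 (by rw [← hxD, zero_pow two_ne_zero])
  have hint {y : M} {z : 𝓞 L} (hy : y ^ 2 = algebraMap (𝓞 L) M z) : IsIntegral ℤ y :=
    IsIntegral.of_pow two_pos
      (hy ▸ (RingOfIntegers.isIntegral z).map (algebraMap (𝓞 L) M).toIntAlgHom)
  have hyD : (algebraMap (𝓞 L) M S / x) ^ 2 = algebraMap (𝓞 L) M (f D') := by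
    rw [div_pow, hSM, hxD, mul_div_cancel_left₀ _ hD0]
  let A : 𝓞 M := ⟨x, hint hxD⟩
  let B : 𝓞 M := ⟨_, hint hyD⟩
  have hA : A ^ 2 = algebraMap (𝓞 L) (𝓞 M) (f D) := RingOfIntegers.ext hxD
  have hB : B ^ 2 = algebraMap (𝓞 L) (𝓞 M) (f D') := RingOfIntegers.ext hyD
  have hcA : conjInt ρ A = -A := RingOfIntegers.ext hρx
  have hcB : conjInt ρ B = -B := by
    apply RingOfIntegers.ext
    change ρ (algebraMap L M S / x) = -(algebraMap L M S / x)
    rw [map_div₀, ρ.commutes, hρx, div_neg]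
  have hR : ramifiedPrimes ρ = ∅ := by
    refine ramifiedPrimes_eq_empty hcA hcB (r := f r) (r' := f r') (g := f g) (g' := f g') ?_ ?_
      (hcop.map f) hA hB
    · rw [hD, hrg, map_add, map_pow, map_mul, map_ofNat]
    · rw [hD', hrg', map_add, map_pow, map_mul, map_ofNat]
  have hDQ : f D ∉ Q := by
    intro h
    refine hpQ ?_
    rw [← map_natCast f, ← hDD, map_mul]
    exact Q.mul_mem_right _ h
  have hDq : f D ^ q - f D ∈ Q := by
    rw [← Ideal.Quotient.mk_eq_mk_iff_sub_mem, map_pow]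
    let π := (Ideal.Quotient.mk Q).comp f
    have hπw : π w ^ 4 = -1 := by rw [← map_pow, hw, map_neg, map_one]
    have hπD : Ideal.Quotient.mk Q (f D) = c + d * (π w - π w ^ 3) := by
      change π D = _
      rw [hD]
      simp only [map_add, map_mul, map_sub, map_pow, map_intCast]
    rw [hπD]
    exact pow_eq_self_of_intCast_add_mul hπw hq8 c d
  obtain ⟨t, ht⟩ := exists_sub_sq_mem_of_pow_sub_self_mem hq (by omega) hQ0 hQN' hDq
  obtain ⟨P, hP, hne, hPQ⟩ := exists_split_prime hM2 hρ hcA hA hQ0 h2Q hDQ ht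
  lift Q to (Ideal (𝓞 L))⁰ using mem_nonZeroDivisors_of_ne_zero hQ0
  have : IsTotallyComplex K :=
    IsCyclotomicExtension.Rat.isTotallyComplex (n := 2 ^ (j + 3)) K
      (lt_of_lt_of_le (by norm_num) (Nat.pow_le_pow_right two_pos (Nat.le_add_left 3 j)))
  have : IsTotallyComplex L := isTotallyComplex_of_algebra K L
  by_contra! hle
  have hDL0 : (f D : L) ≠ 0 := fun h => hDL (by
    rw [RingOfIntegers.coe_eq_zero_iff.mp h]; exact IsSquare.zero)
  exact squares_sup_zpowers_ne_top hM2 hρ (Units.mk0 x hx0) (Units.mk0 _ hDL0) (Units.ext hx) hρx hR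
    Q P hP hne hPQ (sup_zpowers_eq_top_of_index_le_two hle
      (mk0_notMem_squares_classGroup (E := E) hζ hp8 hpm h2 hσ hS hcS hq (by omega) hqp
        hQp hqQ hQN))

end LowerBound

section Rank

theorem isIntegral_of_sq_eq_natCast {R : Type*} [CommRing R] {a : R} {p : ℕ} (h : a ^ 2 = p) :
    IsIntegral ℤ a := by
  refine IsIntegral.of_pow two_pos ?_
  rw [h, ← map_natCast (algebraMap ℤ R)]
  exact isIntegral_algebraMap

theorem not_isSquare_natCast {m : ℕ} [NeZero m] {K : Type*} [Field K] [NumberField K]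
    [IsCyclotomicExtension {m} ℚ K] {ζ : K} (hζ : IsPrimitiveRoot ζ m) {p : ℕ} (hp : p.Prime)
    (hpm : p.Coprime m) : ¬ IsSquare (p : K) := by
  rintro ⟨a, ha⟩
  have : Fact p.Prime := ⟨hp⟩
  have hint : IsIntegral ℤ a :=
    isIntegral_of_sq_eq_natCast (by rw [sq, ← ha])
  let b : 𝓞 K := ⟨a, hint⟩
  have hb : b ^ 2 = p := by
    apply RingOfIntegers.ext
    change a ^ 2 = _
    rw [sq, ← ha]
    exact (map_natCast (algebraMap (𝓞 K) K) p).symm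
  obtain ⟨t, ht⟩ := Ideal.mem_span_singleton.mp (mem_span_of_sq_mem_span hζ hpm (x := b)
    (by rw [hb]; exact Ideal.mem_span_singleton_self _))
  have hp0 : (p : 𝓞 K) ≠ 0 := Nat.cast_ne_zero.mpr hp.ne_zero
  have hup : IsUnit (p : 𝓞 K) := by
    refine IsUnit.of_mul_eq_one (t ^ 2) (mul_left_cancel₀ hp0 ?_)
    rw [mul_one]
    nth_rw 3 [← hb]
    rw [ht]
    ring
  rw [← map_natCast (algebraMap ℤ (𝓞 K)), isUnit_map_iff] at hup
  exact hp.ne_one (Nat.isUnit_iff.mp (Int.ofNat_isUnit.mp (by exact_mod_cast hup)))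

theorem closure_setOf_eq_sq (A : Type*) [CommGroup A] :
    Subgroup.closure {x : A | ∃ y, x = y ^ 2} = squares A := by
  rw [← Subgroup.closure_eq (squares A)]
  congr 1
  ext x
  exact exists_congr fun _ => eq_comm

theorem index_squares_eq_four {A : Type*} [CommGroup A] [Finite A]
    (h : 2 < (squares A).index) (h' : (squares A).index ≤ 4) : (squares A).index = 4 := by
  by_contra hne
  have h3 : (squares A).index = 3 := by omega
  have hcard : Nat.card (A ⧸ squares A) = 3 := h3
  have : Nontrivial (A ⧸ squares A) := Finite.one_lt_card_iff_nontrivial.mp (by omega)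
  obtain ⟨x, hx⟩ := exists_ne (1 : A ⧸ squares A)
  refine hx ?_
  have h1 : x ^ 3 = 1 := hcard ▸ pow_card_eq_one'
  have h2 : x ^ 2 = 1 := by
    obtain ⟨a, rfl⟩ := QuotientGroup.mk_surjective x
    rw [← QuotientGroup.mk_pow, QuotientGroup.eq_one_iff]
    exact ⟨a, rfl⟩
  rwa [pow_succ, h2, one_mul] at h1

theorem index_squares_classGroup_eq_four {K L : Type*} [Field K] [NumberField K] [Field L]
    [NumberField L] [Algebra K L] {j : ℕ} [IsCyclotomicExtension {2 ^ (j + 3)} ℚ K] {ζ : K}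
    (hζ : IsPrimitiveRoot ζ (2 ^ (j + 3))) {p : ℕ} (hp : p.Prime) (hp9 : p % 16 = 9) {s : L}
    (hs : s ^ 2 = (p : L)) (htop : IntermediateField.adjoin K {s} = ⊤) :
    (squares (ClassGroup (𝓞 L))).index = 4 := by
  have : Fact p.Prime := ⟨hp⟩
  have hpm : p.Coprime (2 ^ (j + 3)) :=
    ((Nat.coprime_primes hp Nat.prime_two).mpr (by omega)).pow_right _
  have hns := not_isSquare_natCast hζ hp hpm
  have hs' : s ^ 2 = algebraMap K L (p : K) := by rw [hs, map_natCast]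
  have h2 := finrank_eq_two_of_sq hs' hns htop
  have : IsGalois K L := isGalois_of_finrank_eq_two h2
  obtain ⟨σ, hσ, hσs⟩ := exists_conj_of_sq h2 hs' hns
  let S : 𝓞 L := ⟨s, isIntegral_of_sq_eq_natCast hs⟩
  have hS : S ^ 2 = p := by
    apply RingOfIntegers.ext
    change s ^ 2 = _
    rw [hs]
    exact (map_natCast (algebraMap (𝓞 L) L) p).symm
  have hcS : conjInt σ S = -S := RingOfIntegers.ext hσs
  have hi : IsPrimitiveRoot (ζ ^ 2 ^ (j + 1)) 4 :=
    hζ.pow (by positivity) (pow_add 2 (j + 1) 2)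
  have : IsCyclotomicExtension {4} ℚ ℚ⟮ζ ^ 2 ^ (j + 1)⟯ :=
    hi.intermediateField_adjoin_isCyclotomicExtension ℚ
  have : IsGalois ℚ K := IsCyclotomicExtension.isGalois {2 ^ (j + 3)} ℚ K
  have : IsGalois ℚ⟮ζ ^ 2 ^ (j + 1)⟯ K := IsGalois.tower_top_of_isGalois ℚ _ K
  exact index_squares_eq_four
    (two_lt_index_squares_classGroup ℚ⟮ζ ^ 2 ^ (j + 1)⟯ (j := j) h2 hσ (by omega) hS hcS)
    (index_squares_classGroup_le_four h2 hσ hp9 hζ hS hcS)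

end Rank

/-- For n ≥ 3 and a prime p ≡ 9 (mod 16), the 2-class group of
L_{n,p} = Q(ζ_{2^n}, √p) has rank exactly 2. -/
theorem stmt_15 (n : ℕ) (hn : 3 ≤ n) (p : ℕ) (hp : p.Prime) (hp9 : p % 16 = 9)
    (L : Type*) [Field L] [NumberField L] (ζ s : L)
    (hζ : IsPrimitiveRoot ζ (2 ^ n)) (hs : s ^ 2 = (p : L))
    (hL : IntermediateField.adjoin ℚ {ζ, s} = ⊤) :
    rank2 L = 2 := by
  obtain ⟨j, rfl⟩ := Nat.exists_eq_add_of_le' hn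
  have : IsCyclotomicExtension {2 ^ (j + 3)} ℚ ℚ⟮ζ⟯ :=
    hζ.intermediateField_adjoin_isCyclotomicExtension ℚ
  have hζ' : IsPrimitiveRoot (AdjoinSimple.gen ℚ ζ) (2 ^ (j + 3)) :=
    IsPrimitiveRoot.coe_submonoidClass_iff.mp hζ
  have htop : IntermediateField.adjoin ℚ⟮ζ⟯ {s} = ⊤ := by
    rw [← restrictScalars_eq_top_iff (K := ℚ)]
    exact (adjoin_simple_adjoin_simple ℚ ζ s).trans hL
  rw [rank2, closure_setOf_eq_sq]
  change Nat.log 2 (squares (ClassGroup (𝓞 L))).index = 2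
  rw [index_squares_classGroup_eq_four hζ' hp hp9 hs htop]
  exact Nat.log_pow one_lt_two 2
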